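/- arXiv:2605.21761 — 2 statements merged into one kernel-verified Lean document; each statement's English description precedes it below -/
import Mathlib

section
/- Let φ be a circle covering map of degree two of class C² with positive derivative, with φ(0)=0, φ′(0)=1 and φ″(0)=0. Suppose φ is not topologically conjugate to the doubling map x ↦ 2x (mod 1), and that the collection of all maximal periodic intervals of φ is finite and nonempty, say I₁,…,I_r; let Λ := 𝕊¹ \ ⋃_{n≥0} φ^{-n}(I₁ ∪ ⋯ ∪ I_r) (the exceptional minimal set of the associated Thompson group action). Then the Lebesgue measure of Λ is zero. -/
open Set Filter MeasureTheory Topology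

noncomputable section

/-- `F : ℝ → ℝ` is a lift of `φ : 𝕊¹ → 𝕊¹` witnessing that `φ` is a
circle covering map of degree two. -/
def IsLiftDeg2 (φ : UnitAddCircle → UnitAddCircle) (F : ℝ → ℝ) : Prop :=
  Continuous F ∧ StrictMono F ∧ (∀ x : ℝ, F (x + 1) = F x + 2) ∧
    ∀ x : ℝ, φ (x : UnitAddCircle) = ((F x : ℝ) : UnitAddCircle)

/-- The closed arc on the circle starting at `a` (counterclockwise) of length `ℓ`. -/
def closedArc (a ℓ : ℝ) : Set UnitAddCircle :=
  (fun t : ℝ => (t : UnitAddCircle)) '' Set.Icc a (a + ℓ)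

/-- The open arc on the circle starting at `a` (counterclockwise) of length `ℓ`. -/
def openArc (a ℓ : ℝ) : Set UnitAddCircle :=
  (fun t : ℝ => (t : UnitAddCircle)) '' Set.Ioo a (a + ℓ)

/-- The open arc `(x, x + ε)` counterclockwise. -/
def rightArc (x : UnitAddCircle) (ε : ℝ) : Set UnitAddCircle :=
  {y | ∃ t : ℝ, 0 < t ∧ t < ε ∧ y = x + (t : UnitAddCircle)}

/-- The open arc `(x - ε, x)` counterclockwise. -/
def leftArc (x : UnitAddCircle) (ε : ℝ) : Set UnitAddCircle :=
  {y | ∃ t : ℝ, 0 < t ∧ t < ε ∧ y = x - (t : UnitAddCircle)}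

/-- `I` is a periodic interval of `φ` of period `s`: a proper nondegenerate closed arc
mapped onto itself homeomorphically by `φ^s`. -/
def IsPeriodicInterval (φ : UnitAddCircle → UnitAddCircle) (s : ℕ)
    (I : Set UnitAddCircle) : Prop :=
  1 ≤ s ∧ (∃ a ℓ : ℝ, 0 < ℓ ∧ ℓ < 1 ∧ I = closedArc a ℓ) ∧ Set.BijOn (φ^[s]) I I

/-- A maximal periodic interval of `φ`. -/
def IsMaxPeriodicInterval (φ : UnitAddCircle → UnitAddCircle)
    (I : Set UnitAddCircle) : Prop :=
  (∃ s, IsPeriodicInterval φ s I) ∧ ∀ J, (∃ s, IsPeriodicInterval φ s J) → I ⊆ J → I = J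

/-- `Λ = 𝕊¹ \ ⋃ₙ φ⁻ⁿ(I₁ ∪ ⋯ ∪ I_r)`, the complement of all preimages of the
maximal periodic intervals. -/
def lambdaSet (φ : UnitAddCircle → UnitAddCircle) : Set UnitAddCircle :=
  Set.univ \ ⋃ n : ℕ, (φ^[n]) ⁻¹' (⋃ I ∈ {I | IsMaxPeriodicInterval φ I}, I)

/-- The doubling map `x ↦ 2x (mod 1)`. -/
def doubling : UnitAddCircle → UnitAddCircle := fun x => x + x

/-- `φ` is topologically conjugate to the doubling map. -/
def ConjugateToDoubling (φ : UnitAddCircle → UnitAddCircle) : Prop :=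
  ∃ h : UnitAddCircle ≃ₜ UnitAddCircle, ∀ x, h (φ x) = doubling (h x)

/-- `I` is a `φ`-dyadic interval of degree `n` (described via the lift `F` of `φ`):
a closed arc whose endpoints are consecutive `φⁿ`-preimages of `0`. -/
def IsDyadic (F : ℝ → ℝ) (n : ℕ) (I : Set UnitAddCircle) : Prop :=
  ∃ a b : ℝ, a < b ∧ (∃ k : ℤ, F^[n] a = (k : ℝ)) ∧ F^[n] b = F^[n] a + 1 ∧
    I = (fun t : ℝ => (t : UnitAddCircle)) '' Set.Icc a b

/-- `G` is a lift of the orientation-preserving circle homeomorphism `g`. -/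
def IsOPLift (g : UnitAddCircle → UnitAddCircle) (G : ℝ → ℝ) : Prop :=
  Continuous G ∧ StrictMono G ∧ (∀ x : ℝ, G (x + 1) = G x + 1) ∧
    ∀ x : ℝ, g (x : UnitAddCircle) = ((G x : ℝ) : UnitAddCircle)

/-- `g` belongs to the Ghys–Sergiescu Thompson group `T_φ` (with `F` a lift of `φ`):
`g` is an orientation-preserving circle homeomorphism and there are partitions of the
circle into `φ`-dyadic intervals `I k`, `J k` such that `g` maps `I k` onto `J k` and
`g = φ_{J k}⁻¹ ∘ φ_{I k}` on `I k`, i.e. `φ^[m k] ∘ g = φ^[n k]` on `I k`. -/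
def InThompsonGroup (φ : UnitAddCircle → UnitAddCircle) (F : ℝ → ℝ)
    (g : UnitAddCircle → UnitAddCircle) : Prop :=
  (∃ G : ℝ → ℝ, IsOPLift g G) ∧
  ∃ (r : ℕ) (I J : Fin r → Set UnitAddCircle) (n m : Fin r → ℕ),
    0 < r ∧
    (∀ k, IsDyadic F (n k) (I k)) ∧ (∀ k, IsDyadic F (m k) (J k)) ∧
    (⋃ k, I k) = Set.univ ∧ (⋃ k, J k) = Set.univ ∧
    (Pairwise fun k l => interior (I k) ∩ interior (I l) = ∅) ∧
    (Pairwise fun k l => interior (J k) ∩ interior (J l) = ∅) ∧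
    (∀ k, g '' I k = J k) ∧ (∀ k, ∀ x ∈ I k, φ^[m k] (g x) = φ^[n k] x)

/-- `x` is a nonexpandable point for the action of `T_φ`: `g′(x) ≤ 1` for every
`g ∈ T_φ` (derivatives are computed via lifts). -/
def NonExpandable (φ : UnitAddCircle → UnitAddCircle) (F : ℝ → ℝ)
    (x : UnitAddCircle) : Prop :=
  ∀ g G, InThompsonGroup φ F g → IsOPLift g G →
    ∀ x' : ℝ, (x' : UnitAddCircle) = x → deriv G x' ≤ 1

/-- `I` is nice for `φ`: no forward iterate of the boundary returns to the interior. -/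
def IsNice (φ : UnitAddCircle → UnitAddCircle) (I : Set UnitAddCircle) : Prop :=
  ∀ n : ℕ, 1 ≤ n → (φ^[n]) '' (frontier I) ∩ interior I = ∅

/-- A nice interval: a proper nondegenerate closed arc that is nice. -/
def IsNiceInterval (φ : UnitAddCircle → UnitAddCircle) (I : Set UnitAddCircle) : Prop :=
  (∃ a ℓ : ℝ, 0 < ℓ ∧ ℓ < 1 ∧ I = closedArc a ℓ) ∧ IsNice φ I

/-- `J` is a connected component of `S`. -/
def IsComponentOf (J S : Set UnitAddCircle) : Prop :=
  ∃ x ∈ S, J = connectedComponentIn S x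

/-- The set of left endpoints of connected components of `𝕊¹ \ Λ`. -/
def leftEndpoints (Λ : Set UnitAddCircle) : Set UnitAddCircle :=
  {z | ∃ C : Set UnitAddCircle, IsComponentOf C (Set.univ \ Λ) ∧
    ∃ a ℓ : ℝ, 0 < ℓ ∧ ℓ ≤ 1 ∧ C = openArc a ℓ ∧ z = (a : UnitAddCircle)}

/-- The set of right endpoints of connected components of `𝕊¹ \ Λ`. -/
def rightEndpoints (Λ : Set UnitAddCircle) : Set UnitAddCircle :=
  {z | ∃ C : Set UnitAddCircle, IsComponentOf C (Set.univ \ Λ) ∧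
    ∃ a ℓ : ℝ, 0 < ℓ ∧ ℓ ≤ 1 ∧ C = openArc a ℓ ∧ z = ((a + ℓ : ℝ) : UnitAddCircle)}

/-- `x` is a parabolic periodic point of `φ`: `φ^s(x) = x` and `(φ^s)′(x) = 1`
(the derivative computed via the lift `F`). -/
def IsParabolicPeriodicPt (φ : UnitAddCircle → UnitAddCircle) (F : ℝ → ℝ)
    (x : UnitAddCircle) : Prop :=
  ∃ s : ℕ, 1 ≤ s ∧ φ^[s] x = x ∧
    ∀ x' : ℝ, (x' : UnitAddCircle) = x → deriv (F^[s]) x' = 1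

/-- The data used throughout: a normalised degree-two lift `F` with inverse `g`, a monotone
semiconjugacy `H` from `F` to `x ↦ 2x`, and a constant `C` bounding the one-step distortion
of `F` on an interval by `exp (C * length)`. -/
structure SemiconjLift (F g H : ℝ → ℝ) (C : ℝ) : Prop where
  strictMono : StrictMono F
  map_add_one : ∀ x, F (x + 1) = F x + 2
  map_zero : F 0 = 0
  left_inv : Function.LeftInverse g F
  right_inv : Function.RightInverse g F
  monotone_H : Monotone H
  continuous_H : Continuous H
  H_add_one : ∀ x, H (x + 1) = H x + 1
  H_map : ∀ x, H (F x) = 2 * H x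
  nonneg : 0 ≤ C
  distortion : ∀ a b u v p q, a ≤ u → u ≤ v → v ≤ b → a ≤ p → p ≤ q → q ≤ b →
    (F v - F u) * (q - p) ≤ Real.exp (C * (b - a)) * ((F q - F p) * (v - u))

namespace SemiconjLift

variable {F g H : ℝ → ℝ} {C : ℝ}

lemma map_add_int (h : SemiconjLift F g H C) (x : ℝ) (k : ℤ) : F (x + k) = F x + 2 * k := by
  have hn : ∀ (n : ℕ) (x : ℝ), F (x + n) = F x + 2 * n := by
    intro n
    induction n with
    | zero => intro x; simp
    | succ n ih => intro x; push_cast; rw [← add_assoc, h.map_add_one, ih]; ring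
  obtain ⟨n, rfl | rfl⟩ := k.eq_nat_or_neg
  · simpa using hn n x
  · have := hn n (x + ((-n : ℤ) : ℝ))
    push_cast at this ⊢
    rw [neg_add_cancel_right] at this
    linarith

lemma iterate_add_int (h : SemiconjLift F g H C) (n : ℕ) (x : ℝ) (k : ℤ) :
    F^[n] (x + k) = F^[n] x + 2 ^ n * k := by
  induction n generalizing x k with
  | zero => simp
  | succ n ih =>
    rw [Function.iterate_succ_apply, Function.iterate_succ_apply, h.map_add_int]
    have := ih (F x) (2 * k)
    push_cast at this
    rw [this]; ring

lemma strictMono_iterate (h : SemiconjLift F g H C) (n : ℕ) : StrictMono F^[n] :=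
  h.strictMono.iterate n

lemma iterate_iterate_g (h : SemiconjLift F g H C) (n : ℕ) (x : ℝ) : F^[n] (g^[n] x) = x :=
  h.right_inv.iterate n x

lemma iterate_iterate_g_add (h : SemiconjLift F g H C) (i m : ℕ) (x : ℝ) :
    F^[i] (g^[i + m] x) = g^[m] x := by
  rw [Function.iterate_add_apply, h.iterate_iterate_g]

lemma strictMono_iterate_g (h : SemiconjLift F g H C) (n : ℕ) : StrictMono g^[n] := by
  intro a b hab
  apply (h.strictMono_iterate n).lt_iff_lt.mp
  rwa [h.iterate_iterate_g, h.iterate_iterate_g]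

lemma iterate_g_add_int (h : SemiconjLift F g H C) (n : ℕ) (x : ℝ) (k : ℤ) :
    g^[n] (x + 2 ^ n * k) = g^[n] x + k := by
  apply (h.strictMono_iterate n).injective
  rw [h.iterate_add_int, h.iterate_iterate_g, h.iterate_iterate_g]

lemma H_iterate (h : SemiconjLift F g H C) (n : ℕ) (x : ℝ) : H (F^[n] x) = 2 ^ n * H x := by
  induction n generalizing x with
  | zero => simp
  | succ n ih => rw [Function.iterate_succ_apply, ih, h.H_map]; ring

lemma H_add_int (h : SemiconjLift F g H C) (x : ℝ) (k : ℤ) : H (x + k) = H x + k := by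
  have hn : ∀ (n : ℕ) (x : ℝ), H (x + n) = H x + n := by
    intro n
    induction n with
    | zero => intro x; simp
    | succ n ih => intro x; push_cast; rw [← add_assoc, h.H_add_one, ih]; ring
  obtain ⟨n, rfl | rfl⟩ := k.eq_nat_or_neg
  · simpa using hn n x
  · have := hn n (x + ((-n : ℤ) : ℝ))
    push_cast at this ⊢
    rw [neg_add_cancel_right] at this
    linarith

lemma H_zero (h : SemiconjLift F g H C) : H 0 = 0 := by
  have := h.H_map 0
  rw [h.map_zero] at this
  linarith

lemma H_int (h : SemiconjLift F g H C) (k : ℤ) : H k = k := by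
  have := h.H_add_int 0 k
  rwa [zero_add, h.H_zero, zero_add] at this

lemma iterate_int (h : SemiconjLift F g H C) (n : ℕ) (k : ℤ) : F^[n] k = 2 ^ n * k := by
  have h0 : F^[n] 0 = 0 := Function.iterate_fixed h.map_zero n
  have := h.iterate_add_int n 0 k
  rwa [zero_add, h0, zero_add] at this

lemma lt_of_H_lt (h : SemiconjLift F g H C) {x y : ℝ} (hxy : H x < H y) : x < y :=
  lt_of_not_ge fun hle => absurd (h.monotone_H hle) (not_le.mpr hxy)

lemma floor_eq_floor_H (h : SemiconjLift F g H C) {x : ℝ} (hx : ∀ k : ℤ, H x ≠ k) :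
    ⌊x⌋ = ⌊H x⌋ := by
  symm
  rw [Int.floor_eq_iff]
  have h1 := h.monotone_H (Int.floor_le x)
  have h2 := h.monotone_H (Int.lt_floor_add_one x).le
  rw [h.H_int] at h1
  have h3 : H ((⌊x⌋ : ℝ) + 1) = ((⌊x⌋ + 1 : ℤ) : ℝ) := by
    rw [← h.H_int (⌊x⌋ + 1)]; push_cast; rfl
  rw [h3] at h2
  refine ⟨h1, ?_⟩
  have := lt_of_le_of_ne h2 (hx _)
  push_cast at this
  exact this

/-- Iterated distortion on an interval `[a, b]`. -/
lemma distortion_iterate (h : SemiconjLift F g H C) (n : ℕ) {a b u v p q : ℝ}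
    (hau : a ≤ u) (huv : u ≤ v) (hvb : v ≤ b) (hap : a ≤ p) (hpq : p ≤ q) (hqb : q ≤ b) :
    (F^[n] v - F^[n] u) * (q - p) ≤
      Real.exp (C * ∑ i ∈ Finset.range n, (F^[i] b - F^[i] a)) *
        ((F^[n] q - F^[n] p) * (v - u)) := by
  induction n with
  | zero => simp [mul_comm]
  | succ n ih =>
    have hm := (h.strictMono_iterate n).monotone
    have hd := h.distortion _ _ _ _ _ _ (hm hau) (hm huv) (hm hvb) (hm hap) (hm hpq) (hm hqb)
    rw [Finset.sum_range_succ, mul_add, Real.exp_add]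
    simp only [Function.iterate_succ_apply'] at *
    set E1 := Real.exp (C * ∑ i ∈ Finset.range n, (F^[i] b - F^[i] a))
    set E2 := Real.exp (C * (F^[n] b - F^[n] a))
    have hE1 : 0 < E1 := Real.exp_pos _
    have hE2 : 0 < E2 := Real.exp_pos _
    rcases hpq.eq_or_lt with rfl | hpq'
    · simp
    rcases huv.eq_or_lt with rfl | huv'
    · simp
    have hP : 0 < F^[n] q - F^[n] p := sub_pos.mpr (h.strictMono_iterate n hpq')
    have hV : 0 < F^[n] v - F^[n] u := sub_pos.mpr (h.strictMono_iterate n huv')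
    have hFP : 0 < F (F^[n] q) - F (F^[n] p) := sub_pos.mpr (h.strictMono (sub_pos.mp hP))
    have h1 : (F (F^[n] v) - F (F^[n] u)) * (q - p) * (F^[n] q - F^[n] p) ≤
        E1 * E2 * ((F (F^[n] q) - F (F^[n] p)) * (v - u)) * (F^[n] q - F^[n] p) := by
      calc _ = (F (F^[n] v) - F (F^[n] u)) * (F^[n] q - F^[n] p) * (q - p) := by ring
        _ ≤ E2 * ((F (F^[n] q) - F (F^[n] p)) * (F^[n] v - F^[n] u)) * (q - p) :=
          mul_le_mul_of_nonneg_right hd (sub_nonneg.mpr hpq)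
        _ = E2 * (F (F^[n] q) - F (F^[n] p)) * ((F^[n] v - F^[n] u) * (q - p)) := by ring
        _ ≤ E2 * (F (F^[n] q) - F (F^[n] p)) * (E1 * ((F^[n] q - F^[n] p) * (v - u))) :=
          mul_le_mul_of_nonneg_left ih (by positivity)
        _ = _ := by ring
    exact le_of_mul_le_mul_right h1 hP

/-- If the total length of the first iterates of `[p, q]` is bounded by `S`, then a definite
right extension of `[p, q]` stays comparable to `[p, q]` along these iterates. -/
lemma extend_right (h : SemiconjLift F g H C) {S p q r : ℝ} {n : ℕ} (hpq : p < q) (hqr : q ≤ r)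
    (hS : ∑ i ∈ Finset.range n, (F^[i] q - F^[i] p) ≤ S)
    (hr : r - q ≤ Real.exp (-(2 * C * S)) * (q - p)) :
    ∀ i ≤ n, F^[i] r - F^[i] q ≤ F^[i] q - F^[i] p := by
  intro i
  induction i using Nat.strong_induction_on with
  | _ i ih =>
    intro hin
    have hsum : ∑ j ∈ Finset.range i, (F^[j] r - F^[j] p) ≤ 2 * S := by
      have h1 : ∑ j ∈ Finset.range i, (F^[j] r - F^[j] p) ≤
          ∑ j ∈ Finset.range i, 2 * (F^[j] q - F^[j] p) := by
        apply Finset.sum_le_sum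
        intro j hj
        have hj' := Finset.mem_range.mp hj
        linarith [ih j hj' (by omega)]
      have h2 : ∑ j ∈ Finset.range i, (F^[j] q - F^[j] p) ≤
          ∑ j ∈ Finset.range n, (F^[j] q - F^[j] p) := by
        apply Finset.sum_le_sum_of_subset_of_nonneg
        · exact Finset.range_subset_range.mpr hin
        · intro j _ _
          exact sub_nonneg.mpr ((h.strictMono_iterate j).monotone hpq.le)
      rw [← Finset.mul_sum] at h1
      linarith
    have hd := h.distortion_iterate i hpq.le hqr le_rfl le_rfl hpq.le hqr
    have hP : 0 < F^[i] q - F^[i] p := sub_pos.mpr (h.strictMono_iterate i hpq)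
    have hE : Real.exp (C * ∑ j ∈ Finset.range i, (F^[j] r - F^[j] p)) ≤
        Real.exp (2 * C * S) := by
      apply Real.exp_le_exp.mpr
      nlinarith [h.nonneg]
    have hpq' : 0 < q - p := sub_pos.mpr hpq
    have : (F^[i] r - F^[i] q) * (q - p) ≤ (F^[i] q - F^[i] p) * (q - p) := by
      calc _ ≤ _ := hd
        _ ≤ Real.exp (2 * C * S) * ((F^[i] q - F^[i] p) *
            (Real.exp (-(2 * C * S)) * (q - p))) := by
          apply mul_le_mul hE _ _ (Real.exp_pos _).le
          · exact mul_le_mul_of_nonneg_left hr hP.le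
          · exact mul_nonneg hP.le (sub_nonneg.mpr hqr)
        _ = Real.exp (2 * C * S) * Real.exp (-(2 * C * S)) *
            ((F^[i] q - F^[i] p) * (q - p)) := by ring
        _ = _ := by rw [← Real.exp_add]; simp
    exact le_of_mul_le_mul_right this hpq'

/-- Pulled-back version of `extend_right`: the smallness of the extension is measured at the
final time. -/
lemma extend_right_of_image (h : SemiconjLift F g H C) {S p q r : ℝ} {n : ℕ} (hpq : p < q)
    (hqr : q ≤ r) (hS : ∑ i ∈ Finset.range n, (F^[i] q - F^[i] p) ≤ S)
    (hr : F^[n] r - F^[n] q ≤ Real.exp (-(4 * C * S)) * (F^[n] q - F^[n] p)) :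
    ∑ i ∈ Finset.range n, (F^[i] r - F^[i] p) ≤ 2 * S := by
  set δ := Real.exp (-(2 * C * S)) with hδ
  have hδ0 : 0 < δ := Real.exp_pos _
  have hpq' : 0 < q - p := sub_pos.mpr hpq
  set R := q + δ * (q - p) with hR
  have hqR : q ≤ R := by have := mul_pos hδ0 hpq'; linarith
  have hext := h.extend_right hpq hqR hS (by rw [hR]; linarith)
  have hsum : ∀ t, q ≤ t → t ≤ R → ∑ i ∈ Finset.range n, (F^[i] t - F^[i] p) ≤ 2 * S := by
    intro t _ htR
    calc _ ≤ ∑ i ∈ Finset.range n, 2 * (F^[i] q - F^[i] p) := by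
          apply Finset.sum_le_sum
          intro i hi
          have := hext i (Finset.mem_range.mp hi).le
          have := (h.strictMono_iterate i).monotone htR
          linarith
      _ ≤ _ := by rw [← Finset.mul_sum]; linarith
  apply hsum r hqr
  by_contra! hlt
  have hd := h.distortion_iterate n le_rfl hpq.le hqR hpq.le hqR le_rfl
  have hE : Real.exp (C * ∑ i ∈ Finset.range n, (F^[i] R - F^[i] p)) ≤
      Real.exp (2 * C * S) := by
    apply Real.exp_le_exp.mpr
    nlinarith [h.nonneg, hsum R hqR le_rfl]
  have hP : 0 < F^[n] q - F^[n] p := sub_pos.mpr (h.strictMono_iterate n hpq)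
  have hQ : F^[n] R < F^[n] r := h.strictMono_iterate n hlt
  have h4 : Real.exp (-(4 * C * S)) = δ * δ := by rw [hδ, ← Real.exp_add]; ring_nf
  have hEδ : Real.exp (2 * C * S) * δ = 1 := by rw [hδ, ← Real.exp_add]; simp
  have hRq : R - q = δ * (q - p) := by rw [hR]; ring
  have hR0 : 0 ≤ F^[n] R - F^[n] q := sub_nonneg.mpr ((h.strictMono_iterate n).monotone hqR)
  have h5 : (F^[n] q - F^[n] p) * (δ * (q - p)) ≤
      Real.exp (2 * C * S) * ((F^[n] R - F^[n] q) * (q - p)) := by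
    rw [← hRq]
    calc _ ≤ _ := hd
      _ ≤ _ := mul_le_mul_of_nonneg_right hE (by positivity)
  have h6 : (F^[n] q - F^[n] p) * δ ≤ Real.exp (2 * C * S) * (F^[n] R - F^[n] q) := by
    apply le_of_mul_le_mul_right _ hpq'
    linarith
  have h7 : (F^[n] q - F^[n] p) * δ * δ ≤ F^[n] R - F^[n] q := by
    calc _ ≤ Real.exp (2 * C * S) * (F^[n] R - F^[n] q) * δ :=
          mul_le_mul_of_nonneg_right h6 hδ0.le
      _ = Real.exp (2 * C * S) * δ * (F^[n] R - F^[n] q) := by ring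
      _ = _ := by rw [hEδ, one_mul]
  rw [h4] at hr
  nlinarith

end SemiconjLift

/-- Finitely many intervals whose interiors are pairwise disjoint modulo `ℤ`, each of length at
most one, have total length at most one. -/
lemma sum_length_le_one {ι : Type*} (A : Finset ι) (p q : ι → ℝ) (hpq : ∀ i ∈ A, p i ≤ q i)
    (hself : ∀ i ∈ A, q i ≤ p i + 1)
    (hdisj : ∀ i ∈ A, ∀ j ∈ A, i ≠ j → ∀ (k : ℤ), ∀ t ∈ Ioo (p i) (q i),
      t + k ∉ Ioo (p j) (q j)) :
    ∑ i ∈ A, (q i - p i) ≤ 1 := by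
  have hmeas : volume (⋃ i ∈ A, Ioo (p i) (q i)) = ∑ i ∈ A, volume (Ioo (p i) (q i)) := by
    apply measure_biUnion_finset
    · intro i hi j hj hij
      rw [Function.onFun, Set.disjoint_left]
      intro t ht ht'
      exact hdisj i hi j hj hij 0 t ht (by simpa using ht')
    · intro i _
      exact measurableSet_Ioo
  have hle : volume (⋃ i ∈ A, Ioo (p i) (q i)) ≤ 1 := by
    by_contra! hlt
    have hfd := isAddFundamentalDomain_Ioc (zero_lt_one' ℝ) 0 volume
    have hv : volume (Ioc (0 : ℝ) (0 + 1)) = 1 := by simp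
    obtain ⟨x, y, hxy, hnd⟩ := exists_pair_mem_lattice_not_disjoint_vadd hfd
      (s := ⋃ i ∈ A, Ioo (p i) (q i))
      (MeasurableSet.nullMeasurableSet
        (Finset.measurableSet_biUnion A fun i _ => measurableSet_Ioo)) (by rw [hv]; exact hlt)
    rw [Set.not_disjoint_iff] at hnd
    obtain ⟨t, ⟨u, hu, rfl⟩, ⟨w, hw, hwu⟩⟩ := hnd
    obtain ⟨kx, hkx⟩ := AddSubgroup.mem_zmultiples_iff.mp x.2
    obtain ⟨ky, hky⟩ := AddSubgroup.mem_zmultiples_iff.mp y.2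
    simp only [mem_iUnion, exists_prop] at hu hw
    obtain ⟨i, hi, hu⟩ := hu
    obtain ⟨j, hj, hw⟩ := hw
    change (y : ℝ) + w = (x : ℝ) + u at hwu
    rw [← hkx, ← hky] at hwu
    simp only [zsmul_eq_mul, mul_one] at hwu hkx hky
    have hw' : w = u + ((kx - ky : ℤ) : ℝ) := by push_cast; linarith
    rcases eq_or_ne i j with rfl | hij
    · have hk : kx ≠ ky := by
        rintro rfl
        exact hxy (Subtype.ext (hkx.symm.trans hky))
      have h1 := hself i hi
      have h2 : |((kx - ky : ℤ) : ℝ)| < 1 := by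
        rw [abs_lt]; constructor <;> linarith [hu.1, hu.2, hw.1, hw.2]
      have h3 : |kx - ky| < 1 := by exact_mod_cast h2
      rw [Int.abs_lt_one_iff] at h3
      omega
    · exact hdisj i hi j hj hij (kx - ky) u hu (hw' ▸ hw)
  rw [hmeas] at hle
  simp only [Real.volume_Ioo] at hle
  rw [← ENNReal.ofReal_sum_of_nonneg (fun i hi => sub_nonneg.mpr (hpq i hi))] at hle
  exact ENNReal.ofReal_le_one.mp hle

namespace SemiconjLift

variable {F g H : ℝ → ℝ} {C : ℝ}

lemma exists_H_eq (h : SemiconjLift F g H C) (v : ℝ) : ∃ x, H x = v := by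
  have hv : v ∈ Icc (H (⌊v⌋ : ℤ)) (H ((⌊v⌋ + 1 : ℤ))) := by
    rw [h.H_int, h.H_int]
    push_cast
    exact ⟨Int.floor_le v, (Int.lt_floor_add_one v).le⟩
  obtain ⟨x, -, hx⟩ := intermediate_value_Icc (by push_cast; linarith) h.continuous_H.continuousOn hv
  exact ⟨x, hx⟩

/-- Every fibre of `H` has a largest point. -/
lemma exists_fiber_max (h : SemiconjLift F g H C) (v : ℝ) :
    ∃ ζ, H ζ = v ∧ ∀ x, H x ≤ v → x ≤ ζ := by
  obtain ⟨x₀, hx₀⟩ := h.exists_H_eq v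
  have hbdd : BddAbove {x | H x ≤ v} := by
    refine ⟨x₀ + 1, fun x (hx : H x ≤ v) => ?_⟩
    apply (h.lt_of_H_lt _).le
    rw [h.H_add_one]
    linarith
  have hcl : IsClosed {x | H x ≤ v} := isClosed_le h.continuous_H continuous_const
  have hmem := hcl.csSup_mem ⟨x₀, hx₀.le⟩ hbdd
  refine ⟨_, le_antisymm hmem ?_, fun x hx => le_csSup hbdd hx⟩
  exact hx₀.symm.le.trans (h.monotone_H (le_csSup hbdd hx₀.le))

/-- Every fibre of `H` has a smallest point. -/
lemma exists_fiber_min (h : SemiconjLift F g H C) (v : ℝ) :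
    ∃ c, H c = v ∧ ∀ x, v ≤ H x → c ≤ x := by
  obtain ⟨x₀, hx₀⟩ := h.exists_H_eq v
  have hbdd : BddBelow {x | v ≤ H x} := by
    refine ⟨x₀ - 1, fun x (hx : v ≤ H x) => ?_⟩
    have : x₀ < x + 1 := by
      apply h.lt_of_H_lt
      rw [h.H_add_one]
      linarith
    linarith
  have hcl : IsClosed {x | v ≤ H x} := isClosed_le continuous_const h.continuous_H
  have hmem := hcl.csInf_mem ⟨x₀, hx₀.ge⟩ hbdd
  refine ⟨_, le_antisymm ?_ hmem, fun x hx => csInf_le hbdd hx⟩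
  exact (h.monotone_H (csInf_le hbdd hx₀.ge)).trans hx₀.le

/-- There are no wandering intervals: a nondegenerate fibre of `H` is eventually periodic
modulo `ℤ`. -/
lemma eventually_periodic_of_fiber (h : SemiconjLift F g H C) {c d : ℝ} (hcd : c < d)
    (hH : H c = H d) : ∃ i j : ℕ, i < j ∧ ∃ k : ℤ, 2 ^ j * H c = 2 ^ i * H c + k := by
  by_contra! hcon
  obtain ⟨ζ, hζ, hmax⟩ := h.exists_fiber_max (H c)
  have hcζ : c < ζ := hcd.trans_le (hmax d hH.ge)
  have hval : ∀ i, ∀ t ∈ Ioo (F^[i] c) (F^[i] ζ), H t = 2 ^ i * H c := by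
    intro i t ht
    apply le_antisymm
    · rw [← hζ, ← h.H_iterate]; exact h.monotone_H ht.2.le
    · rw [← h.H_iterate]; exact h.monotone_H ht.1.le
  have hself : ∀ i, F^[i] ζ ≤ F^[i] c + 1 := by
    intro i
    apply (h.lt_of_H_lt _).le
    rw [h.H_add_one, h.H_iterate, h.H_iterate, hζ]
    linarith
  have hsum : ∀ n, ∑ i ∈ Finset.range n, (F^[i] ζ - F^[i] c) ≤ 1 := by
    intro n
    apply sum_length_le_one _ (fun i => F^[i] c) (fun i => F^[i] ζ)
    · intro i _; exact (h.strictMono_iterate i).monotone hcζ.le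
    · intro i _; exact hself i
    · intro i _ j _ hij k t ht ht'
      have h1 := hval i t ht
      have h2 := hval j _ ht'
      rw [h.H_add_int, h1] at h2
      rcases lt_or_gt_of_ne hij with hlt | hlt
      · exact hcon i j hlt k h2.symm
      · apply hcon j i hlt (-k)
        push_cast
        linarith
  set r := ζ + Real.exp (-(2 * C * 1)) * (ζ - c) with hr
  have hζr : ζ < r := by
    have := mul_pos (Real.exp_pos (-(2 * C * 1))) (sub_pos.mpr hcζ)
    linarith
  have hHr : H c < H r := by
    by_contra! hle
    exact absurd (hmax r hle) (not_le.mpr hζr)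
  have hbd : ∀ n, 2 ^ n * (H r - H c) ≤ 1 := by
    intro n
    have h1 := h.extend_right hcζ hζr.le (hsum n) (by rw [hr]; linarith) n le_rfl
    have h2 := hself n
    have h3 : F^[n] r ≤ F^[n] ζ + 1 := by linarith
    have h4 := h.monotone_H h3
    rw [h.H_add_one, h.H_iterate, h.H_iterate, hζ] at h4
    linarith
  obtain ⟨n, hn⟩ := pow_unbounded_of_one_lt (1 / (H r - H c)) one_lt_two
  have := hbd n
  rw [div_lt_iff₀ (sub_pos.mpr hHr)] at hn
  linarith

end SemiconjLift

/-- Left endpoint of the level-`N` dyadic interval containing `x`. -/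
def dyadicLeft (F g : ℝ → ℝ) (N : ℕ) (x : ℝ) : ℝ := g^[N] ⌊F^[N] x⌋

/-- Right endpoint of the level-`N` dyadic interval containing `x`. -/
def dyadicRight (F g : ℝ → ℝ) (N : ℕ) (x : ℝ) : ℝ := g^[N] (⌊F^[N] x⌋ + 1)

/-- Total length of the first `N` iterates of the level-`N` dyadic interval containing `x`. -/
def dyadicSum (F g : ℝ → ℝ) (N : ℕ) (x : ℝ) : ℝ :=
  ∑ i ∈ Finset.range N, (F^[i] (dyadicRight F g N x) - F^[i] (dyadicLeft F g N x))

/-- `x` has dyadic neighbourhoods of arbitrarily high level whose iterates have uniformly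
bounded total length. -/
def HasSummableTimes (F g : ℝ → ℝ) (x : ℝ) : Prop :=
  ∃ K : ℝ, ∀ N₀, ∃ N ≥ N₀, dyadicSum F g N x ≤ K

/-- The `n`-th binary digit of `x` with respect to the degree-two lift `F`. -/
def digit (F : ℝ → ℝ) (x : ℝ) (n : ℕ) : ℤ := ⌊F^[n + 1] x⌋ - 2 * ⌊F^[n] x⌋

lemma floors_of_digits {F : ℝ → ℝ} {x y : ℝ} {i j M : ℕ}
    (hd : ∀ r < M, digit F x (i + r) = digit F y (j + r)) :
    ∃ k : ℤ, ∀ r ≤ M, ⌊F^[i + r] x⌋ = ⌊F^[j + r] y⌋ + 2 ^ r * k := by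
  refine ⟨⌊F^[i] x⌋ - ⌊F^[j] y⌋, fun r => ?_⟩
  induction r with
  | zero => intro _; simp
  | succ r ih =>
    intro hr
    have h1 := ih (by omega)
    have h2 := hd r (by omega)
    simp only [digit] at h2
    rw [← add_assoc, ← add_assoc]
    rw [pow_succ]
    linarith

namespace SemiconjLift

variable {F g H : ℝ → ℝ} {C : ℝ}

lemma floor_eq_of_iterate (h : SemiconjLift F g H C) {a b : ℝ} (s : ℕ)
    (hab : ⌊F^[s] a⌋ = ⌊F^[s] b⌋) : ⌊a⌋ = ⌊b⌋ := by
  have key : ∀ a b : ℝ, ⌊F^[s] a⌋ = ⌊F^[s] b⌋ → ⌊a⌋ ≤ ⌊b⌋ := by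
    intro a b hab
    rw [Int.le_floor]
    by_contra! hlt
    have h1 := h.strictMono_iterate s hlt
    have h2 := (h.strictMono_iterate s).monotone (Int.floor_le a)
    have e : F^[s] (⌊a⌋ : ℝ) = ((2 ^ s * ⌊a⌋ : ℤ) : ℝ) := by rw [h.iterate_int]; push_cast; rfl
    rw [e] at h1 h2
    have h3 := Int.le_floor.mpr h2
    have h4 := Int.floor_lt.mpr h1
    omega
  exact le_antisymm (key a b hab) (key b a hab.symm)

lemma iterate_g_lt (h : SemiconjLift F g H C) (N : ℕ) (m : ℤ) :
    g^[N] (m : ℝ) < g^[N] ((m : ℝ) + 1) := h.strictMono_iterate_g N (by linarith)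

lemma iterate_g_add_one_le (h : SemiconjLift F g H C) (n : ℕ) {t t' : ℝ} (ht : t' ≤ t + 1) :
    g^[n] t' ≤ g^[n] t + 1 := by
  have h1 := h.iterate_g_add_int n t 1
  push_cast at h1
  rw [← h1]
  apply (h.strictMono_iterate_g n).monotone
  have : (1 : ℝ) ≤ 2 ^ n := one_le_pow₀ one_le_two
  linarith

lemma iterate_dyadicLeft (h : SemiconjLift F g H C) {N i : ℕ} (hi : i ≤ N) (x : ℝ) :
    F^[i] (dyadicLeft F g N x) = g^[N - i] ⌊F^[N] x⌋ := by
  obtain ⟨m, rfl⟩ := Nat.exists_eq_add_of_le hi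
  rw [dyadicLeft, h.iterate_iterate_g_add]; simp

lemma iterate_dyadicRight (h : SemiconjLift F g H C) {N i : ℕ} (hi : i ≤ N) (x : ℝ) :
    F^[i] (dyadicRight F g N x) = g^[N - i] (⌊F^[N] x⌋ + 1) := by
  obtain ⟨m, rfl⟩ := Nat.exists_eq_add_of_le hi
  rw [dyadicRight, h.iterate_iterate_g_add]; simp

lemma iterate_dyadic_length_le_one (h : SemiconjLift F g H C) {N i : ℕ} (hi : i ≤ N) (x : ℝ) :
    F^[i] (dyadicRight F g N x) ≤ F^[i] (dyadicLeft F g N x) + 1 := by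
  rw [h.iterate_dyadicLeft hi, h.iterate_dyadicRight hi]
  exact h.iterate_g_add_one_le _ le_rfl

lemma dyadicLeft_lt_dyadicRight (h : SemiconjLift F g H C) (N : ℕ) (x : ℝ) :
    dyadicLeft F g N x < dyadicRight F g N x := h.iterate_g_lt N _

lemma digit_eq_of_mem (h : SemiconjLift F g H C) {N i r : ℕ} {x u : ℝ}
    (hu : u ∈ Ioo (F^[i] (dyadicLeft F g N x)) (F^[i] (dyadicRight F g N x)))
    (hr : i + r < N) : digit F u r = digit F x (i + r) := by
  have hN : ⌊F^[N - i] u⌋ = ⌊F^[N] x⌋ := by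
    have hm := h.strictMono_iterate (N - i)
    have h1 := hm hu.1
    have h2 := hm hu.2
    rw [h.iterate_dyadicLeft (by omega), h.iterate_iterate_g] at h1
    rw [h.iterate_dyadicRight (by omega), h.iterate_iterate_g] at h2
    exact Int.floor_eq_iff.mpr ⟨h1.le, h2⟩
  have key : ∀ r, i + r ≤ N → ⌊F^[r] u⌋ = ⌊F^[i + r] x⌋ := by
    intro r hr
    apply h.floor_eq_of_iterate (N - i - r)
    rw [← Function.iterate_add_apply, ← Function.iterate_add_apply]
    convert hN using 3
    · omega
    · omega
  simp only [digit]
  rw [key r (by omega), add_assoc, ← key (r + 1) (by omega)]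

lemma digit_add_int (h : SemiconjLift F g H C) (u : ℝ) (k : ℤ) (r : ℕ) :
    digit F (u + k) r = digit F u r := by
  simp only [digit]
  rw [h.iterate_add_int, h.iterate_add_int]
  have e : ∀ n : ℕ, (2 : ℝ) ^ n * k = ((2 ^ n * k : ℤ) : ℝ) := by intro n; push_cast; rfl
  rw [e, e, Int.floor_add_intCast, Int.floor_add_intCast, pow_succ]
  ring

/-- Iterates of a dyadic interval along times whose itineraries can be told apart have total
length at most one. -/
lemma sum_dyadic_le_one (h : SemiconjLift F g H C) {N : ℕ} {x : ℝ} (A : Finset ℕ)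
    (hA : ∀ i ∈ A, i ≤ N)
    (hsep : ∀ i ∈ A, ∀ j ∈ A, i < j → ∃ r, j + r < N ∧ digit F x (i + r) ≠ digit F x (j + r)) :
    ∑ i ∈ A, (F^[i] (dyadicRight F g N x) - F^[i] (dyadicLeft F g N x)) ≤ 1 := by
  apply sum_length_le_one A (fun i => F^[i] (dyadicLeft F g N x))
  · intro i _
    exact (h.strictMono_iterate i).monotone (h.dyadicLeft_lt_dyadicRight N x).le
  · intro i hi
    exact h.iterate_dyadic_length_le_one (hA i hi) x
  · intro i hi j hj hij k t ht ht'
    have hboth : ∀ r, i + r < N → j + r < N → digit F x (i + r) = digit F x (j + r) := by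
      intro r hir hjr
      rw [← h.digit_eq_of_mem ht hir, ← h.digit_eq_of_mem ht' hjr, h.digit_add_int]
    rcases lt_or_gt_of_ne hij with hlt | hlt
    · obtain ⟨r, hr, hne⟩ := hsep i hi j hj hlt
      exact hne (hboth r (by omega) hr)
    · obtain ⟨r, hr, hne⟩ := hsep j hj i hi hlt
      exact hne (hboth r hr (by omega)).symm

/-- If the digits of `x` contain every initial block of the digits of `y`, then `x` inherits
bounded sums from `y`. -/
lemma HasSummableTimes_of_occurs (h : SemiconjLift F g H C) {x y : ℝ}
    (hy : HasSummableTimes F g y)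
    (hocc : ∀ M : ℕ, ∃ n : ℕ, ∀ m < M, digit F x (n + m) = digit F y m) :
    HasSummableTimes F g x := by
  classical
  obtain ⟨K, hK⟩ := hy
  refine ⟨1 + K, fun N₀ => ?_⟩
  obtain ⟨M, hM, hMK⟩ := hK N₀
  have hn := Nat.find_spec (hocc M)
  have hmin : ∀ n' < Nat.find (hocc M), ¬ ∀ m < M, digit F x (n' + m) = digit F y m :=
    fun n' hn' => Nat.find_min (hocc M) hn'
  set n := Nat.find (hocc M)
  refine ⟨n + M, by omega, ?_⟩
  rw [dyadicSum, Finset.sum_range_add]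
  apply add_le_add
  · apply h.sum_dyadic_le_one
    · intro i hi
      have := Finset.mem_range.mp hi
      omega
    · intro i hi j hj hij
      have hj := Finset.mem_range.mp hj
      by_contra! hcon
      apply hmin (n - (j - i)) (by omega)
      intro m hm
      have h1 := hcon (n - j + m) (by omega)
      rw [show i + (n - j + m) = n - (j - i) + m by omega,
        show j + (n - j + m) = n + m by omega, hn m hm] at h1
      exact h1
  · refine le_trans (le_of_eq ?_) hMK
    obtain ⟨k, hk⟩ := floors_of_digits (i := n) (j := 0) (M := M) (x := x) (y := y)
      (fun r hr => by rw [zero_add]; exact hn r hr)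
    have hkM := hk M le_rfl
    rw [zero_add] at hkM
    apply Finset.sum_congr rfl
    intro l hl
    have hl := Finset.mem_range.mp hl
    rw [h.iterate_dyadicRight (by omega), h.iterate_dyadicLeft (by omega),
      h.iterate_dyadicRight hl.le, h.iterate_dyadicLeft hl.le, hkM,
      show n + M - (n + l) = M - l by omega]
    have e : ((⌊F^[M] y⌋ + 2 ^ M * k : ℤ) : ℝ) =
        (⌊F^[M] y⌋ : ℝ) + 2 ^ (M - l) * ((2 ^ l * k : ℤ) : ℝ) := by
      push_cast
      rw [← mul_assoc, ← pow_add, Nat.sub_add_cancel hl.le]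
    rw [e, add_right_comm, h.iterate_g_add_int, h.iterate_g_add_int]
    ring

/-- Points whose digits contain arbitrarily long, but no infinite, repetitions of a fixed word
have bounded sums. -/
lemma HasSummableTimes_of_repetitions (h : SemiconjLift F g H C) {x : ℝ} {s : ℕ} (hs : 1 ≤ s)
    (w : ℕ → ℤ)
    (hocc : ∀ L : ℕ, ∃ n : ℕ, ∀ r < L, ∀ t < s, digit F x (n + r * s + t) = w t)
    (hfin : ∀ n : ℕ, ∃ r, ∃ t < s, digit F x (n + r * s + t) ≠ w t) :
    HasSummableTimes F g x := by
  classical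
  refine ⟨1 + s + s, fun L => ?_⟩
  have hn := Nat.find_spec (hocc L)
  have hmin : ∀ n' < Nat.find (hocc L),
      ¬ ∀ r < L, ∀ t < s, digit F x (n' + r * s + t) = w t :=
    fun n' hn' => Nat.find_min (hocc L) hn'
  set n := Nat.find (hocc L)
  obtain ⟨t₀, ht₀, hne⟩ := Nat.find_spec (hfin n)
  have hl : ∀ r < Nat.find (hfin n), ∀ t < s, digit F x (n + r * s + t) = w t := by
    intro r hr t ht
    by_contra hcon
    exact Nat.find_min (hfin n) hr ⟨t, ht, hcon⟩
  set l := Nat.find (hfin n)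
  have hLl : L ≤ l := by
    by_contra! hlt
    exact hne (hn l hlt t₀ ht₀)
  have hls : l ≤ l * s := Nat.le_mul_of_pos_right l hs
  refine ⟨n + l * s + s, by omega, ?_⟩
  rw [dyadicSum, Finset.sum_range_add, Finset.sum_range_add]
  refine add_le_add (add_le_add ?_ ?_) ?_
  · apply h.sum_dyadic_le_one
    · intro i hi
      have := Finset.mem_range.mp hi
      omega
    · intro i hi j hj hij
      have hj := Finset.mem_range.mp hj
      by_contra! hcon
      apply hmin (n - (j - i)) (by omega)
      intro r hr t ht
      have hrs : r * s + s ≤ l * s := by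
        rw [← Nat.succ_mul]
        exact Nat.mul_le_mul_right s (by omega)
      have h1 := hcon (n - j + (r * s + t)) (by omega)
      rw [show i + (n - j + (r * s + t)) = n - (j - i) + r * s + t by omega,
        show j + (n - j + (r * s + t)) = n + r * s + t by omega, hn r hr t ht] at h1
      exact h1
  · rw [← Finset.sum_fiberwise_of_maps_to (s := Finset.range (l * s)) (t := Finset.range s)
      (g := fun i => i % s) (fun i _ => Finset.mem_range.mpr (Nat.mod_lt i hs))]
    have hone : ∀ t ∈ Finset.range s, ∑ i ∈ Finset.range (l * s) with i % s = t,
        (F^[n + i] (dyadicRight F g (n + l * s + s) x) -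
          F^[n + i] (dyadicLeft F g (n + l * s + s) x)) ≤ 1 := by
      intro t _
      rw [← Finset.sum_image (g := fun i => n + i)
        (f := fun i => F^[i] (dyadicRight F g (n + l * s + s) x) -
          F^[i] (dyadicLeft F g (n + l * s + s) x)) (fun a _ b _ hab => by simpa using hab)]
      apply h.sum_dyadic_le_one
      · intro i hi
        simp only [Finset.mem_image, Finset.mem_filter, Finset.mem_range] at hi
        omega
      · intro i hi j hj hij
        simp only [Finset.mem_image, Finset.mem_filter, Finset.mem_range] at hi hj
        obtain ⟨i, ⟨hi, hit⟩, rfl⟩ := hi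
        obtain ⟨j, ⟨hj, hjt⟩, rfl⟩ := hj
        obtain ⟨d, hd⟩ : ∃ d, j = i + d * s := by
          refine ⟨j / s - i / s, ?_⟩
          have hij' : i / s ≤ j / s := Nat.div_le_div_right (by omega)
          have h1 := Nat.div_add_mod i s
          have h2 := Nat.div_add_mod j s
          rw [Nat.sub_mul, Nat.mul_comm, Nat.mul_comm (i / s)]
          have h3 := Nat.mul_le_mul_left s hij'
          omega
        have hdl : d < l := by
          by_contra! hge
          have := Nat.mul_le_mul_right s hge
          omega
        have hd0 : 0 < d := by
          rcases Nat.eq_zero_or_pos d with rfl | h0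
          · simp at hd; omega
          · exact h0
        have hsub : (l - d) * s + d * s = l * s := by
          rw [← Nat.add_mul, Nat.sub_add_cancel hdl.le]
        refine ⟨l * s + t₀ - j, by omega, ?_⟩
        rw [show n + i + (l * s + t₀ - j) = n + (l - d) * s + t₀ by omega,
          show n + j + (l * s + t₀ - j) = n + l * s + t₀ by omega,
          hl (l - d) (by omega) t₀ ht₀]
        exact hne.symm
    refine (Finset.sum_le_sum hone).trans ?_
    simp
  · refine (Finset.sum_le_sum (g := fun _ => (1 : ℝ)) ?_).trans (by simp)
    intro i hi
    have := Finset.mem_range.mp hi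
    have := h.iterate_dyadic_length_le_one
      (show n + l * s + i ≤ n + l * s + s by omega) x
    linarith

end SemiconjLift

namespace SemiconjLift

variable {F g H : ℝ → ℝ} {C : ℝ}

lemma H_iterate_g (h : SemiconjLift F g H C) (n : ℕ) (x : ℝ) : 2 ^ n * H (g^[n] x) = H x := by
  rw [← h.H_iterate, h.iterate_iterate_g]

/-- Strictly to the right of a fibre maximum there are points of dyadic `H`-value. -/
lemma exists_dyadic_right (h : SemiconjLift F g H C) {ζ R : ℝ} (hlt : H ζ < H R) :
    ∃ (m : ℕ) (j : ℤ), ζ < g^[m] j ∧ g^[m] j < R ∧ H ζ < H (g^[m] j) := by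
  obtain ⟨m, hm⟩ := pow_unbounded_of_one_lt (1 / (H R - H ζ)) one_lt_two
  rw [div_lt_iff₀ (sub_pos.mpr hlt)] at hm
  have hb := h.H_iterate_g m ((⌊2 ^ m * H ζ⌋ + 1 : ℤ) : ℝ)
  rw [h.H_int] at hb
  have h1 := Int.lt_floor_add_one (2 ^ m * H ζ)
  have h2 := Int.floor_le (2 ^ m * H ζ)
  have h2m : (0 : ℝ) < 2 ^ m := by positivity
  have h3 : H ζ < H (g^[m] ((⌊2 ^ m * H ζ⌋ + 1 : ℤ) : ℝ)) := by
    apply lt_of_mul_lt_mul_left _ h2m.le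
    rw [hb]; push_cast; linarith
  refine ⟨m, ⌊2 ^ m * H ζ⌋ + 1, h.lt_of_H_lt h3, h.lt_of_H_lt ?_, h3⟩
  apply lt_of_mul_lt_mul_left _ h2m.le
  rw [hb]; push_cast; linarith

/-- A record return of the orbit of `ζ` to the right of `ζ` pulls back the interval `(0, ζ)`
disjointly from its integer translates. -/
lemma pullback_disjoint (h : SemiconjLift F g H C) {ζ z : ℝ} (hζ : H ζ = z) (hz1 : z < 1)
    (hge : ∀ n : ℕ, z ≤ Int.fract (2 ^ n * z)) (hne : ∀ n : ℕ, 1 ≤ n → Int.fract (2 ^ n * z) ≠ z)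
    {n : ℕ} (hrec : ∀ i < n, Int.fract (2 ^ (n + 1) * z) < Int.fract (2 ^ (i + 1) * z))
    {i : ℕ} (hi : i < n) (j : ℤ) {t : ℝ}
    (ht : t ∈ Ioo (g^[n - i] ⌊2 ^ (n + 1) * z⌋) (g^[n - i] (⌊2 ^ (n + 1) * z⌋ + ζ))) :
    t ∉ Ioo (j : ℝ) (j + ζ) := by
  intro htj
  set k := ⌊2 ^ (n + 1) * z⌋ with hk
  have hζ1 : ζ < 1 := by
    apply h.lt_of_H_lt
    have := h.H_int 1
    push_cast at this
    rwa [hζ, this]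
  set P := g^[n - i] (k : ℝ) with hP
  set Q := g^[n - i] ((k : ℝ) + ζ) with hQ
  have hFP : F^[n - i] P = k := h.iterate_iterate_g _ _
  have hFQ : F^[n - i] Q = k + ζ := h.iterate_iterate_g _ _
  have hm := h.strictMono_iterate (n - i)
  have hPj : (j : ℝ) ≤ P := by
    by_contra! hlt
    have h1 := hm hlt
    have h2 := hm (htj.1.trans ht.2)
    rw [hFP, h.iterate_int] at h1
    rw [hFQ, h.iterate_int] at h2
    have h3 : k < 2 ^ (n - i) * j := by exact_mod_cast h1
    have h4 : ((2 ^ (n - i) * j : ℤ) : ℝ) < ((k + 1 : ℤ) : ℝ) := by push_cast; linarith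
    have h5 : 2 ^ (n - i) * j < k + 1 := by exact_mod_cast h4
    omega
  have hQj : Q ≤ j + ζ := by
    by_contra! hlt
    have h1 := hm (ht.1.trans htj.2)
    have h2 := hm hlt
    rw [hFP, add_comm, h.iterate_add_int] at h1
    rw [hFQ, add_comm (j : ℝ), h.iterate_add_int] at h2
    have h1' := h.monotone_H h1.le
    have h2' := h.monotone_H h2.le
    have e : (2 : ℝ) ^ (n - i) * j = ((2 ^ (n - i) * j : ℤ) : ℝ) := by push_cast; rfl
    rw [e, h.H_add_int, h.H_int, h.H_iterate, hζ] at h1'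
    rw [e, h.H_add_int, add_comm (k : ℝ), h.H_add_int, h.H_iterate, hζ] at h2'
    have hfl : ⌊2 ^ (n - i) * z⌋ = k - 2 ^ (n - i) * j := by
      rw [Int.floor_eq_iff]
      push_cast at h1' h2' ⊢
      constructor <;> linarith
    have hfr : Int.fract (2 ^ (n - i) * z) ≤ z := by
      rw [Int.fract, hfl]
      push_cast at h1' h2' ⊢
      linarith
    exact hne (n - i) (by omega) (le_antisymm hfr (hge _))
  have hHQ := h.monotone_H hQj
  have hHP := h.monotone_H hPj
  have hHPQ := h.monotone_H (ht.1.trans ht.2).le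
  rw [add_comm, h.H_add_int, hζ] at hHQ
  rw [h.H_int] at hHP
  have hQval := h.H_iterate_g (n - i) ((k : ℝ) + ζ)
  rw [add_comm (k : ℝ), h.H_add_int, hζ, add_comm ζ, ← hQ] at hQval
  have hfn : Int.fract (2 ^ (n + 1) * z) = 2 ^ (n + 1) * z - k := rfl
  have hpow : (2 : ℝ) ^ (n + 1) = 2 ^ (n - i) * 2 ^ (i + 1) := by
    rw [← pow_add]; congr 1; omega
  have h2m : (2 : ℝ) ≤ 2 ^ (n - i) := by
    calc (2 : ℝ) = 2 ^ 1 := by norm_num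
      _ ≤ 2 ^ (n - i) := pow_le_pow_right₀ one_le_two (by omega)
  have hD := hge (n + 1)
  have hD' : z < Int.fract (2 ^ (n + 1) * z) :=
    lt_of_le_of_ne hD (hne (n + 1) (by omega)).symm
  have hlt1 := Int.fract_lt_one (2 ^ (n + 1) * z)
  have hri := hrec i hi
  set D := Int.fract (2 ^ (n + 1) * z) - z with hDdef
  have hdiff : 2 ^ (n - i) * (2 ^ (i + 1) * z - H Q) = D := by
    rw [mul_sub, hQval, ← mul_assoc, ← hpow, hDdef, hfn]; ring
  have hpos : 0 < 2 ^ (i + 1) * z - H Q := by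
    by_contra! hle
    nlinarith
  have hsmall : 2 * (2 ^ (i + 1) * z - H Q) ≤ D := by nlinarith
  have hfl : ⌊2 ^ (i + 1) * z⌋ = j := by
    rw [Int.floor_eq_iff]
    constructor <;> linarith
  have : Int.fract (2 ^ (i + 1) * z) = 2 ^ (i + 1) * z - j := by rw [Int.fract, hfl]
  linarith

/-- If `z` is the infimum, approached but not attained again, of its orbit under doubling,
then the forward orbit of `z` has bounded sums. -/
lemma HasSummableTimes_of_recurrent (h : SemiconjLift F g H C) {z : ℝ} (hz0 : 0 < z) (hz1 : z < 1)
    (hge : ∀ n : ℕ, z ≤ Int.fract (2 ^ n * z)) (hne : ∀ n : ℕ, 1 ≤ n → Int.fract (2 ^ n * z) ≠ z)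
    (hacc : ∀ ε > 0, ∃ n : ℕ, 1 ≤ n ∧ Int.fract (2 ^ n * z) < z + ε) :
    ∃ y, H y = 2 * z ∧ HasSummableTimes F g y := by
  classical
  obtain ⟨ζ, hζ, hmax⟩ := h.exists_fiber_max z
  have hζ0 : 0 < ζ := h.lt_of_H_lt (by rwa [h.H_zero, hζ])
  have hζ1 : ζ < 1 := by
    apply h.lt_of_H_lt
    have := h.H_int 1
    push_cast at this
    rwa [hζ, this]
  refine ⟨F ζ, by rw [h.H_map, hζ], ?_⟩
  set δ := Real.exp (-(4 * C * 1)) with hδ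
  have hδ0 : 0 < δ := Real.exp_pos _
  have hgap : H ζ < H (ζ + δ * ζ) := by
    rw [hζ]
    by_contra! hle
    have := hmax _ hle
    have := mul_pos hδ0 hζ0
    linarith
  obtain ⟨m, l, hζb, hbR, hHb⟩ := h.exists_dyadic_right hgap
  set b := g^[m] (l : ℝ) with hb
  refine ⟨2 + m, fun N₀ => ?_⟩
  set D : ℕ → ℝ := fun n => Int.fract (2 ^ (n + 1) * z) - z with hD
  have hDpos : ∀ n, 0 < D n := fun n =>
    sub_pos.mpr (lt_of_le_of_ne (hge _) (hne (n + 1) (by omega)).symm)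
  obtain ⟨ε, hε, hεb, hεD⟩ : ∃ ε > 0, ε ≤ H b - z ∧ ∀ i ≤ N₀, ε ≤ D i := by
    obtain ⟨i₀, -, hi₀⟩ := Finset.exists_min_image (Finset.range (N₀ + 1)) D ⟨0, by simp⟩
    refine ⟨min (H b - z) (D i₀), lt_min (by rw [hζ] at hHb; linarith) (hDpos _),
      min_le_left _ _, fun i hi => (min_le_right _ _).trans (hi₀ i (by simp; omega))⟩
  have hex : ∃ n, D n < ε := by
    obtain ⟨n, hn, hlt⟩ := hacc ε hε
    obtain ⟨n, rfl⟩ := Nat.exists_eq_add_of_le' hn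
    exact ⟨n, by simp only [hD]; linarith⟩
  have hn := Nat.find_spec hex
  have hmin : ∀ i < Nat.find hex, ε ≤ D i := fun i hi => not_lt.mp (Nat.find_min hex hi)
  set n := Nat.find hex
  have hN₀ : N₀ < n := by
    by_contra! hle
    exact absurd (hεD n hle) (not_le.mpr hn)
  have hrec : ∀ i < n, Int.fract (2 ^ (n + 1) * z) < Int.fract (2 ^ (i + 1) * z) := by
    intro i hi
    have := hn.trans_le (hmin i hi)
    simp only [hD] at this
    linarith
  set k := ⌊2 ^ (n + 1) * z⌋ with hk
  have hHy : H (F^[n] (F ζ)) = k + z + D n := by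
    rw [h.H_iterate, h.H_map, hζ, ← mul_assoc, ← pow_succ]
    simp only [hD, Int.fract, ← hk]
    ring
  have hDn := hDpos n
  have hky : k + ζ < F^[n] (F ζ) := by
    apply h.lt_of_H_lt
    rw [hHy, add_comm, h.H_add_int, hζ]
    linarith
  have hyb : F^[n] (F ζ) < k + b := by
    apply h.lt_of_H_lt
    rw [hHy, add_comm (k : ℝ) b, h.H_add_int]
    linarith
  set p := g^[n] (k : ℝ) with hp
  set q := g^[n] ((k : ℝ) + ζ) with hq
  set r := g^[n] ((k : ℝ) + b) with hr
  have hgm := h.strictMono_iterate_g n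
  have hpi : ∀ i ≤ n, F^[i] p = g^[n - i] (k : ℝ) := by
    intro i hi
    obtain ⟨d, hd⟩ := Nat.exists_eq_add_of_le hi
    rw [hp, hd, h.iterate_iterate_g_add]; simp
  have hqi : ∀ i ≤ n, F^[i] q = g^[n - i] ((k : ℝ) + ζ) := by
    intro i hi
    obtain ⟨d, hd⟩ := Nat.exists_eq_add_of_le hi
    rw [hq, hd, h.iterate_iterate_g_add]; simp
  have key : ∀ i < n, ∀ j : ℤ, ∀ t ∈ Ioo (F^[i] p) (F^[i] q), t ∉ Ioo (j : ℝ) (j + ζ) := by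
    intro i hi j t ht
    rw [hpi i hi.le, hqi i hi.le] at ht
    exact h.pullback_disjoint hζ hz1 hge hne hrec hi j ht
  have key2 : ∀ i i', i < i' → i' < n → ∀ κ : ℤ, ∀ t ∈ Ioo (F^[i] p) (F^[i] q),
      t + κ ∉ Ioo (F^[i'] p) (F^[i'] q) := by
    intro i i' hii' hi' κ t ht ht'
    have hm := h.strictMono_iterate (n - i')
    have h1 := hm ht'.1
    have h2 := hm ht'.2
    rw [hpi i' hi'.le, h.iterate_iterate_g, h.iterate_add_int] at h1
    rw [hqi i' hi'.le, h.iterate_iterate_g, h.iterate_add_int] at h2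
    have h3 := hm ht.1
    have h4 := hm ht.2
    rw [← Function.iterate_add_apply] at h3 h4
    refine key (n - i' + i) (by omega) (k - 2 ^ (n - i') * κ) _ ⟨h3, h4⟩ ⟨?_, ?_⟩
    · push_cast; linarith
    · push_cast; linarith
  have hsum1 : ∑ i ∈ Finset.range n, (F^[i] q - F^[i] p) ≤ 1 := by
    apply sum_length_le_one _ (fun i => F^[i] p) (fun i => F^[i] q)
    · intro i _
      exact (h.strictMono_iterate i).monotone (hgm (by linarith)).le
    · intro i hi
      have hi := Finset.mem_range.mp hi
      rw [hpi i hi.le, hqi i hi.le]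
      exact h.iterate_g_add_one_le _ (by linarith)
    · intro i hi j hj hij κ t ht ht'
      have hi := Finset.mem_range.mp hi
      have hj := Finset.mem_range.mp hj
      rcases lt_or_gt_of_ne hij with hlt | hlt
      · exact key2 i j hlt hj κ t ht ht'
      · refine key2 j i hlt hi (-κ) _ ht' ?_
        push_cast
        rwa [add_neg_cancel_right]
  have hsum2 : ∑ i ∈ Finset.range n, (F^[i] r - F^[i] p) ≤ 2 * 1 := by
    apply h.extend_right_of_image (q := q) (hgm (by linarith)) (hgm (by linarith)).le hsum1
    rw [h.iterate_iterate_g, h.iterate_iterate_g, h.iterate_iterate_g, ← hδ]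
    linarith
  refine ⟨n + m, by omega, ?_⟩
  have hm := h.strictMono_iterate m
  have hleft : p ≤ dyadicLeft F g (n + m) (F ζ) := by
    apply (h.strictMono_iterate (n + m)).le_iff_le.mp
    rw [dyadicLeft, h.iterate_iterate_g, add_comm n m, Function.iterate_add_apply,
      hp, h.iterate_iterate_g, h.iterate_int]
    have h1 := hm (show (k : ℝ) < F^[n] (F ζ) by linarith)
    rw [h.iterate_int, ← Function.iterate_add_apply] at h1
    have : 2 ^ m * k ≤ ⌊F^[m + n] (F ζ)⌋ := by
      rw [Int.le_floor]; push_cast; exact h1.le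
    exact_mod_cast this
  have hright : dyadicRight F g (n + m) (F ζ) ≤ r := by
    apply (h.strictMono_iterate (n + m)).le_iff_le.mp
    rw [dyadicRight, h.iterate_iterate_g, add_comm n m, Function.iterate_add_apply F m n r,
      hr, h.iterate_iterate_g, add_comm (k : ℝ), h.iterate_add_int, hb, h.iterate_iterate_g]
    have h1 := hm hyb
    rw [add_comm (k : ℝ), h.iterate_add_int, hb, h.iterate_iterate_g,
      ← Function.iterate_add_apply] at h1
    have : ⌊F^[m + n] (F ζ)⌋ < l + 2 ^ m * k := by
      rw [Int.floor_lt]; push_cast; exact h1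
    exact_mod_cast this
  rw [dyadicSum, Finset.sum_range_add]
  apply add_le_add
  · rw [mul_one] at hsum2
    refine le_trans (Finset.sum_le_sum fun i _ => ?_) hsum2
    have hm := (h.strictMono_iterate i).monotone
    exact sub_le_sub (hm hright) (hm hleft)
  · refine (Finset.sum_le_sum (g := fun _ => (1 : ℝ)) ?_).trans (by simp)
    intro i hi
    have := Finset.mem_range.mp hi
    have := h.iterate_dyadic_length_le_one (show n + i ≤ n + m by omega) (F ζ)
    linarith

end SemiconjLift

/-- The `n`-th binary digit of `v`. -/
def binDigit (v : ℝ) (n : ℕ) : ℤ := ⌊2 ^ (n + 1) * v⌋ - 2 * ⌊2 ^ n * v⌋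

lemma floor_pow_mul_add_int (v : ℝ) (k : ℤ) (n : ℕ) :
    ⌊2 ^ n * (v + k)⌋ = ⌊2 ^ n * v⌋ + 2 ^ n * k := by
  have e : 2 ^ n * (v + k) = 2 ^ n * v + ((2 ^ n * k : ℤ) : ℝ) := by push_cast; ring
  rw [e, Int.floor_add_intCast]

lemma binDigit_add_int (v : ℝ) (k : ℤ) (n : ℕ) : binDigit (v + k) n = binDigit v n := by
  rw [binDigit, binDigit, floor_pow_mul_add_int, floor_pow_mul_add_int, pow_succ]
  ring

lemma binDigit_pow_mul (v : ℝ) (n m : ℕ) : binDigit (2 ^ n * v) m = binDigit v (n + m) := by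
  simp only [binDigit]
  rw [← mul_assoc, ← mul_assoc, ← pow_add, ← pow_add, add_right_comm m, add_comm m]

lemma binDigit_not_periodic {θ : ℝ} (hθ : Irrational θ) {s : ℕ} (hs : 1 ≤ s) (n : ℕ) :
    ∃ i, binDigit θ (n + i + s) ≠ binDigit θ (n + i) := by
  by_contra! hcon
  set κ := ⌊2 ^ (n + s) * θ⌋ - ⌊2 ^ n * θ⌋ with hκ
  have key : ∀ i : ℕ, ⌊2 ^ (n + i + s) * θ⌋ - ⌊2 ^ (n + i) * θ⌋ = 2 ^ i * κ := by
    intro i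
    induction i with
    | zero => simp [hκ]
    | succ i ih =>
      have := hcon i
      simp only [binDigit] at this
      rw [← add_assoc, add_right_comm (n + i), pow_succ 2 i]
      linarith
  have hbd : ∀ i : ℕ, |2 ^ i * (2 ^ n * θ * (2 ^ s - 1) - κ)| ≤ 1 := by
    intro i
    have h0 : ((⌊2 ^ (n + i + s) * θ⌋ - ⌊2 ^ (n + i) * θ⌋ : ℤ) : ℝ) = ((2 ^ i * κ : ℤ) : ℝ) := by
      rw [key i]
    push_cast at h0
    have h1 := Int.floor_le (2 ^ (n + i + s) * θ)
    have h2 := Int.lt_floor_add_one (2 ^ (n + i + s) * θ)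
    have h3 := Int.floor_le (2 ^ (n + i) * θ)
    have h4 := Int.lt_floor_add_one (2 ^ (n + i) * θ)
    have e : 2 ^ i * (2 ^ n * θ * (2 ^ s - 1) - κ) =
        2 ^ (n + i + s) * θ - 2 ^ (n + i) * θ - 2 ^ i * κ := by ring
    rw [e, abs_le]
    constructor <;> linarith
  have hzero : 2 ^ n * θ * (2 ^ s - 1) - κ = 0 := by
    by_contra hne
    obtain ⟨i, hi⟩ := pow_unbounded_of_one_lt (1 / |2 ^ n * θ * (2 ^ s - 1) - κ|) one_lt_two
    rw [div_lt_iff₀ (abs_pos.mpr hne)] at hi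
    have := hbd i
    rw [abs_mul, abs_of_pos (by positivity : (0 : ℝ) < 2 ^ i)] at this
    linarith
  have h2s : (1 : ℝ) < 2 ^ s := one_lt_pow₀ one_lt_two (by omega)
  refine hθ ⟨κ / (2 ^ n * (2 ^ s - 1)), ?_⟩
  push_cast
  rw [div_eq_iff (by have : (2 : ℝ) ^ s - 1 ≠ 0 := by linarith
                     positivity)]
  linarith

/-- The orbit of `θ` under doubling modulo one, lifted to the line. -/
def doublingOrbit (θ : ℝ) : Set ℝ := {u | ∃ (n : ℕ) (k : ℤ), u = 2 ^ n * θ + k}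

lemma add_int_mem_closure_doublingOrbit {θ v : ℝ} (hv : v ∈ closure (doublingOrbit θ)) (k : ℤ) :
    v + k ∈ closure (doublingOrbit θ) := by
  refine map_mem_closure (f := fun v : ℝ => v + k) (by fun_prop) hv ?_
  rintro _ ⟨n, l, rfl⟩
  exact ⟨n, l + k, by push_cast; ring⟩

lemma pow_mul_mem_closure_doublingOrbit {θ v : ℝ} (hv : v ∈ closure (doublingOrbit θ)) (m : ℕ) :
    2 ^ m * v ∈ closure (doublingOrbit θ) := by
  refine map_mem_closure (f := fun v : ℝ => 2 ^ m * v) (by fun_prop) hv ?_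
  rintro _ ⟨n, l, rfl⟩
  exact ⟨m + n, 2 ^ m * l, by push_cast; ring⟩

lemma fract_mem_closure_doublingOrbit {θ v : ℝ} (hv : v ∈ closure (doublingOrbit θ)) (m : ℕ) :
    Int.fract (2 ^ m * v) ∈ closure (doublingOrbit θ) := by
  have := add_int_mem_closure_doublingOrbit (pow_mul_mem_closure_doublingOrbit hv m)
    (-⌊2 ^ m * v⌋)
  rwa [Int.cast_neg, ← sub_eq_add_neg] at this

lemma fract_pow_mul_fract (v : ℝ) (m n : ℕ) :
    Int.fract (2 ^ n * Int.fract (2 ^ m * v)) = Int.fract (2 ^ (n + m) * v) := by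
  rw [Int.fract_eq_fract]
  refine ⟨-(2 ^ n * ⌊2 ^ m * v⌋), ?_⟩
  rw [Int.fract]
  push_cast
  ring

lemma eventually_floor_eq {v : ℝ} (hv : ∀ (n : ℕ) (k : ℤ), 2 ^ n * v ≠ k) (M : ℕ) :
    ∀ᶠ u in 𝓝 v, ∀ m ∈ Finset.range (M + 1), ⌊2 ^ m * u⌋ = ⌊2 ^ m * v⌋ := by
  rw [eventually_all_finset]
  intro m _
  have hc : Tendsto (fun u : ℝ => 2 ^ m * u) (𝓝 v) (𝓝 (2 ^ m * v)) :=
    (continuous_const.mul continuous_id).tendsto v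
  have hmem : Ioo (⌊2 ^ m * v⌋ : ℝ) (⌊2 ^ m * v⌋ + 1) ∈ 𝓝 (2 ^ m * v) :=
    Ioo_mem_nhds (lt_of_le_of_ne (Int.floor_le _) (hv m _).symm) (Int.lt_floor_add_one _)
  filter_upwards [hc hmem] with u hu
  exact Int.floor_eq_iff.mpr ⟨hu.1.le, hu.2⟩

lemma exists_binDigit_eq {θ v : ℝ} (hv : v ∈ closure (doublingOrbit θ))
    (hv' : ∀ (n : ℕ) (k : ℤ), 2 ^ n * v ≠ k) (M : ℕ) :
    ∃ n, ∀ m < M, binDigit θ (n + m) = binDigit v m := by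
  obtain ⟨u, hu, n, k, rfl⟩ :=
    ((mem_closure_iff_frequently.mp hv).and_eventually (eventually_floor_eq hv' M)).exists.imp
      fun u hu => hu.symm
  refine ⟨n, fun m hm => ?_⟩
  rw [← binDigit_pow_mul, ← binDigit_add_int _ k]
  simp only [binDigit]
  rw [hu m (by simp; omega), hu (m + 1) (by simp; omega)]

lemma pow_mul_ne_int {θ : ℝ} (h0 : (0 : ℝ) ∉ closure (doublingOrbit θ)) {v : ℝ}
    (hv : v ∈ closure (doublingOrbit θ)) (n : ℕ) (k : ℤ) : 2 ^ n * v ≠ k := by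
  intro hk
  apply h0
  have := add_int_mem_closure_doublingOrbit (pow_mul_mem_closure_doublingOrbit hv n) (-k)
  rwa [hk, Int.cast_neg, add_neg_cancel] at this

/-- In an orbit closure avoiding `0` there is a point that is the infimum both of its orbit and of
its strict forward orbit. -/
lemma exists_recurrent_min {θ : ℝ} (h0 : (0 : ℝ) ∉ closure (doublingOrbit θ)) :
    ∃ z ∈ closure (doublingOrbit θ), 0 < z ∧ z < 1 ∧ (∀ n : ℕ, z ≤ Int.fract (2 ^ n * z)) ∧
      ∀ ε > 0, ∃ n : ℕ, 1 ≤ n ∧ Int.fract (2 ^ n * z) < z + ε := by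
  set Ω := closure (doublingOrbit θ) with hΩ
  set t : ℝ → ℝ := fun v => ⨅ n : ℕ, Int.fract (2 ^ n * v) with ht
  have hbdd : ∀ v : ℝ, BddBelow (range fun n : ℕ => Int.fract (2 ^ n * v)) := by
    intro v
    exact ⟨0, by rintro _ ⟨n, rfl⟩; exact Int.fract_nonneg _⟩
  have hcont : ∀ v ∈ Ω, ∀ n : ℕ, ContinuousAt (fun u : ℝ => Int.fract (2 ^ n * u)) v := by
    intro v hv n
    exact ContinuousAt.comp (f := fun u : ℝ => 2 ^ n * u) (g := Int.fract)
      (continuousAt_fract (pow_mul_ne_int h0 hv n _)) (by fun_prop)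
  have hθ : θ ∈ Ω := subset_closure ⟨0, 0, by simp⟩
  have hne : (Ω ∩ Icc 0 1).Nonempty :=
    ⟨Int.fract (2 ^ 0 * θ), fract_mem_closure_doublingOrbit hθ 0, Int.fract_nonneg _,
      (Int.fract_lt_one _).le⟩
  have husc : UpperSemicontinuousOn t (Ω ∩ Icc 0 1) := by
    apply upperSemicontinuousOn_ciInf fun v _ => hbdd v
    intro n v hv
    exact (hcont v hv.1 n).continuousWithinAt.upperSemicontinuousWithinAt
  obtain ⟨v, hv, hmax⟩ := husc.exists_isMaxOn hne (isCompact_Icc.inter_left isClosed_closure)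
  set a : ℕ → ℝ := fun n => Int.fract (2 ^ n * v) with ha
  have hcl : t v ∈ closure (range a) := csInf_mem_closure (range_nonempty a) (hbdd v)
  have hz : t v ∈ Ω := by
    apply closure_minimal _ isClosed_closure hcl
    rintro _ ⟨n, rfl⟩
    exact fract_mem_closure_doublingOrbit hv.1 n
  have hz0 : 0 < t v := by
    apply lt_of_le_of_ne (le_ciInf fun n => Int.fract_nonneg _)
    intro he
    exact h0 (he ▸ hz)
  have hz1 : t v < 1 := (ciInf_le (hbdd v) 0).trans_lt (Int.fract_lt_one _)
  refine ⟨t v, hz, hz0, hz1, fun n => ?_, fun ε hε => ?_⟩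
  · by_contra! hlt
    have hev : ∀ᶠ u in 𝓝 (t v), Int.fract (2 ^ n * u) < t v := (hcont _ hz n).eventually_lt_const hlt
    obtain ⟨_, ⟨m, rfl⟩, hm⟩ := ((mem_closure_iff_frequently.mp hcl).and_eventually hev).exists
    simp only [ha] at hm
    rw [fract_pow_mul_fract] at hm
    exact absurd (ciInf_le (hbdd v) (n + m)) (not_le.mpr hm)
  · have hle : t (Int.fract (2 ^ 1 * t v)) ≤ t v :=
      hmax ⟨fract_mem_closure_doublingOrbit hz 1, Int.fract_nonneg _, (Int.fract_lt_one _).le⟩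
    obtain ⟨n, hn⟩ := exists_lt_of_ciInf_lt (hle.trans_lt (lt_add_of_pos_right (t v) hε))
    rw [fract_pow_mul_fract] at hn
    exact ⟨n + 1, by omega, hn⟩

/-- An orbit accumulating at an integer has arbitrarily long runs of one of the digits `0`, `1`. -/
lemma exists_constant_runs {θ : ℝ} (h0 : (0 : ℝ) ∈ closure (doublingOrbit θ)) :
    ∃ w : ℤ, ∀ L : ℕ, ∃ n : ℕ, ∀ r < L, binDigit θ (n + r) = w := by
  have happ : ∀ ε > 0, ∃ (n : ℕ) (k : ℤ), |2 ^ n * θ - k| < ε := by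
    intro ε hε
    obtain ⟨_, ⟨n, k, rfl⟩, hd⟩ := Metric.mem_closure_iff.mp h0 ε hε
    rw [dist_zero_left, Real.norm_eq_abs] at hd
    exact ⟨n, -k, by push_cast; rwa [sub_neg_eq_add]⟩
  by_cases hright : ∀ ε > 0, ∃ (n : ℕ) (k : ℤ), 0 ≤ 2 ^ n * θ - k ∧ 2 ^ n * θ - k < ε
  · refine ⟨0, fun L => ?_⟩
    obtain ⟨n, k, h1, h2⟩ := hright (1 / 2 ^ L) (by positivity)
    have hfl : ∀ r ≤ L, ⌊2 ^ r * (2 ^ n * θ)⌋ = 2 ^ r * k := by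
      intro r hr
      rw [Int.floor_eq_iff]
      have h3 : (2 : ℝ) ^ r ≤ 2 ^ L := pow_le_pow_right₀ one_le_two hr
      rw [lt_div_iff₀ (by positivity)] at h2
      have h4 : 2 ^ r * (2 ^ n * θ - k) < 1 := by nlinarith
      have h5 : 0 ≤ 2 ^ r * (2 ^ n * θ - k) := by positivity
      push_cast
      constructor <;> linarith
    refine ⟨n, fun r hr => ?_⟩
    rw [← binDigit_pow_mul, binDigit, hfl r hr.le, hfl (r + 1) hr, pow_succ]
    ring
  · push Not at hright
    obtain ⟨ε₀, hε₀, hno⟩ := hright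
    refine ⟨1, fun L => ?_⟩
    obtain ⟨n, k, hlt⟩ := happ (min ε₀ (1 / 2 ^ L)) (by positivity)
    rw [abs_lt] at hlt
    have h1 : 2 ^ n * θ - k < 0 := by
      by_contra! hge
      exact absurd (hno n k hge) (not_le.mpr (hlt.2.trans_le (min_le_left _ _)))
    have h2 : -(1 / 2 ^ L) < 2 ^ n * θ - k :=
      (neg_le_neg (min_le_right _ _)).trans_lt hlt.1
    have hfl : ∀ r ≤ L, ⌊2 ^ r * (2 ^ n * θ)⌋ = 2 ^ r * k - 1 := by
      intro r hr
      rw [Int.floor_eq_iff]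
      have h3 : (2 : ℝ) ^ r ≤ 2 ^ L := pow_le_pow_right₀ one_le_two hr
      rw [neg_lt, lt_div_iff₀ (by positivity)] at h2
      have h4 : 2 ^ r * (-(2 ^ n * θ - k)) < 1 := by nlinarith
      have h5 : 0 < 2 ^ r * (-(2 ^ n * θ - k)) := mul_pos (by positivity) (neg_pos.mpr h1)
      push_cast
      constructor <;> linarith
    refine ⟨n, fun r hr => ?_⟩
    rw [← binDigit_pow_mul, binDigit, hfl r hr.le, hfl (r + 1) hr, pow_succ]
    ring

namespace SemiconjLift

variable {F g H : ℝ → ℝ} {C : ℝ}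

lemma digit_eq_binDigit (h : SemiconjLift F g H C) {x : ℝ}
    (hx : ∀ (n : ℕ) (k : ℤ), 2 ^ n * H x ≠ k) (n : ℕ) : digit F x n = binDigit (H x) n := by
  have hfl : ∀ n, ⌊F^[n] x⌋ = ⌊2 ^ n * H x⌋ := by
    intro n
    rw [h.floor_eq_floor_H (by intro k; rw [h.H_iterate]; exact hx n k), h.H_iterate]
  rw [digit, binDigit, hfl, hfl]

theorem HasSummableTimes_of_irrational (h : SemiconjLift F g H C) {x : ℝ}
    (hx : Irrational (H x)) : HasSummableTimes F g x := by
  have hxint : ∀ (n : ℕ) (k : ℤ), 2 ^ n * H x ≠ k := by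
    intro n k hk
    refine hx ⟨k / 2 ^ n, ?_⟩
    push_cast
    rw [← hk, mul_div_cancel_left₀ _ (by positivity)]
  have hdig := h.digit_eq_binDigit hxint
  have hrep : ∀ (s : ℕ) (w : ℕ → ℤ), 1 ≤ s →
      (∀ L : ℕ, ∃ n : ℕ, ∀ r < L, ∀ t < s, binDigit (H x) (n + r * s + t) = w t) →
      HasSummableTimes F g x := by
    intro s w hs hocc
    apply h.HasSummableTimes_of_repetitions hs w
    · simpa only [hdig] using hocc
    · intro n
      by_contra! hcon
      obtain ⟨i, hi⟩ := binDigit_not_periodic hx hs n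
      have hmod := Nat.mod_lt i hs
      have h1 := hcon (i / s) (i % s) hmod
      have h2 := hcon (i / s + 1) (i % s) hmod
      have hdm := Nat.div_add_mod' i s
      rw [hdig, show n + i / s * s + i % s = n + i by omega] at h1
      rw [hdig, Nat.add_mul, show n + (i / s * s + 1 * s) + i % s = n + i + s by omega] at h2
      exact hi (h2.trans h1.symm)
  by_cases h0 : (0 : ℝ) ∈ closure (doublingOrbit (H x))
  · obtain ⟨w, hw⟩ := exists_constant_runs h0
    apply hrep 1 (fun _ => w) le_rfl
    intro L
    obtain ⟨n, hn⟩ := hw L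
    refine ⟨n, fun r hr t ht => ?_⟩
    obtain rfl : t = 0 := by omega
    simpa using hn r hr
  · obtain ⟨z, hz, hz0, hz1, hge, hacc⟩ := exists_recurrent_min h0
    by_cases hper : ∃ s : ℕ, 1 ≤ s ∧ Int.fract (2 ^ s * z) = z
    · obtain ⟨s, hs, hsz⟩ := hper
      have hz' : 2 ^ s * z = z + ⌊2 ^ s * z⌋ := by
        rw [Int.fract] at hsz; linarith
      have hdz : ∀ r t, binDigit z (r * s + t) = binDigit z t := by
        intro r t
        induction r with
        | zero => simp
        | succ r ih =>
          rw [Nat.succ_mul, add_right_comm, add_comm, ← binDigit_pow_mul, hz', binDigit_add_int, ih]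
      apply hrep s (binDigit z) hs
      intro L
      obtain ⟨n, hn⟩ := exists_binDigit_eq hz (pow_mul_ne_int h0 hz) (L * s)
      refine ⟨n, fun r hr t ht => ?_⟩
      have : r * s + s ≤ L * s := by
        rw [← Nat.succ_mul]; exact Nat.mul_le_mul_right s hr
      rw [add_assoc, hn _ (by omega), hdz]
    · push Not at hper
      obtain ⟨y, hy, hsum⟩ := h.HasSummableTimes_of_recurrent hz0 hz1 hge hper hacc
      have h2z : 2 * z ∈ closure (doublingOrbit (H x)) := by
        simpa using pow_mul_mem_closure_doublingOrbit hz 1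
      refine h.HasSummableTimes_of_occurs hsum fun M => ?_
      obtain ⟨n, hn⟩ := exists_binDigit_eq h2z (pow_mul_ne_int h0 h2z) M
      refine ⟨n, fun m hm => ?_⟩
      rw [hdig, hn m hm, ← hy, h.digit_eq_binDigit (by rw [hy]; exact pow_mul_ne_int h0 h2z)]

end SemiconjLift

namespace SemiconjLift

variable {F g H : ℝ → ℝ} {C : ℝ}

/-- The points whose `H`-fibre is a singleton. -/
def injectivePoints (H : ℝ → ℝ) : Set ℝ := {x | ∀ y, H y = H x → y = x}

lemma eq_of_mem_Icc (h : SemiconjLift F g H C) {c d t : ℝ} (hH : H c = H d) (ht : t ∈ Icc c d) :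
    H t = H c :=
  le_antisymm ((h.monotone_H ht.2).trans hH.ge) (h.monotone_H ht.1)

lemma measurableSet_injectivePoints (h : SemiconjLift F g H C) :
    MeasurableSet (injectivePoints H) := by
  have e : injectivePoints H = (⋃ r : ℚ, H ⁻¹' {H r} ∩ {(r : ℝ)}ᶜ)ᶜ := by
    ext x
    simp only [injectivePoints, mem_ofPred_eq, mem_compl_iff, mem_iUnion, mem_inter_iff,
      mem_preimage, mem_singleton_iff, not_exists, not_and, not_not]
    constructor
    · intro hx r hr
      exact (hx r hr.symm).symm
    · intro hx y hy
      by_contra hne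
      rcases lt_or_gt_of_ne hne with hlt | hlt
      · obtain ⟨r, hr1, hr2⟩ := exists_rat_btwn hlt
        have := h.eq_of_mem_Icc hy ⟨hr1.le, hr2.le⟩
        exact hr2.ne' (hx r (by rw [this, hy]))
      · obtain ⟨r, hr1, hr2⟩ := exists_rat_btwn hlt
        have := h.eq_of_mem_Icc hy.symm ⟨hr1.le, hr2.le⟩
        exact hr1.ne (hx r this.symm)
  rw [e]
  refine (MeasurableSet.iUnion fun r => ?_).compl
  exact ((isClosed_singleton.preimage h.continuous_H).measurableSet).inter
    (measurableSet_singleton _).compl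

lemma exists_plateau_unit (h : SemiconjLift F g H C) {c d : ℝ} (hcd : c < d) (hH : H c = H d) :
    ∃ c' d', 0 ≤ c' ∧ c' < d' ∧ d' ≤ 1 ∧ H c' = H d' := by
  have hd1 : d < c + 1 := h.lt_of_H_lt (by rw [h.H_add_one]; linarith)
  have h1 := Int.floor_le c
  have h2 := Int.lt_floor_add_one c
  have hshift : ∀ (t : ℝ) (k : ℤ), H (t - k) = H t - k := by
    intro t k
    have := h.H_add_int t (-k)
    push_cast at this
    rwa [← sub_eq_add_neg, ← sub_eq_add_neg] at this
  rcases le_or_gt d (⌊c⌋ + 1) with hle | hlt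
  · refine ⟨c - ⌊c⌋, d - ⌊c⌋, by linarith, by linarith, by linarith, ?_⟩
    rw [hshift, hshift, hH]
  · refine ⟨0, d - (⌊c⌋ + 1 : ℤ), le_rfl, by push_cast; linarith, by push_cast; linarith, ?_⟩
    have hm := h.eq_of_mem_Icc hH (t := ((⌊c⌋ + 1 : ℤ) : ℝ)) ⟨by push_cast; exact h2.le, by push_cast; exact hlt.le⟩
    rw [hshift, ← hH, ← hm, h.H_int, h.H_zero, sub_self]

lemma dyadicLeft_le (h : SemiconjLift F g H C) (N : ℕ) (x : ℝ) : dyadicLeft F g N x ≤ x := by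
  apply (h.strictMono_iterate N).le_iff_le.mp
  rw [dyadicLeft, h.iterate_iterate_g]
  exact Int.floor_le _

lemma le_dyadicRight (h : SemiconjLift F g H C) (N : ℕ) (x : ℝ) : x ≤ dyadicRight F g N x := by
  apply (h.strictMono_iterate N).le_iff_le.mp
  rw [dyadicRight, h.iterate_iterate_g]
  exact (Int.lt_floor_add_one _).le

/-- Dyadic intervals shrink to `x` if the `H`-fibre of `x` is a singleton. -/
lemma eventually_dyadic_length_lt (h : SemiconjLift F g H C) {x : ℝ} (hx : x ∈ injectivePoints H)
    {ε : ℝ} (hε : 0 < ε) : ∃ N₀, ∀ N ≥ N₀, dyadicRight F g N x - dyadicLeft F g N x < ε := by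
  have h1 : H x < H (x + ε / 2) :=
    lt_of_le_of_ne (h.monotone_H (by linarith)) fun he => by
      have := hx _ he.symm
      linarith
  have h2 : H (x - ε / 2) < H x :=
    lt_of_le_of_ne (h.monotone_H (by linarith)) fun he => by
      have := hx _ he
      linarith
  set γ := min (H (x + ε / 2) - H x) (H x - H (x - ε / 2)) with hγ
  have hγ0 : 0 < γ := lt_min (by linarith) (by linarith)
  obtain ⟨N₀, hN₀⟩ := pow_unbounded_of_one_lt (1 / γ) one_lt_two
  rw [div_lt_iff₀ hγ0] at hN₀
  refine ⟨N₀, fun N hN => ?_⟩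
  have hpow : (2 : ℝ) ^ N₀ ≤ 2 ^ N := pow_le_pow_right₀ one_le_two hN
  have hNγ : 1 < 2 ^ N * γ := hN₀.trans_le (mul_le_mul_of_nonneg_right hpow hγ0.le)
  have hL : 2 ^ N * H (dyadicLeft F g N x) = ⌊F^[N] x⌋ := by
    rw [dyadicLeft, h.H_iterate_g, h.H_int]
  have hR : 2 ^ N * H (dyadicRight F g N x) = ⌊F^[N] x⌋ + 1 := by
    rw [dyadicRight, h.H_iterate_g, h.H_add_one, h.H_int]
  have hLx := h.monotone_H (h.dyadicLeft_le N x)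
  have hRx := h.monotone_H (h.le_dyadicRight N x)
  have h2N : (0 : ℝ) < 2 ^ N := by positivity
  have hlen : H (dyadicRight F g N x) - H (dyadicLeft F g N x) < γ := by
    apply lt_of_mul_lt_mul_left _ h2N.le
    rw [mul_sub, hL, hR]
    linarith
  have hγ1 : γ ≤ H (x + ε / 2) - H x := min_le_left _ _
  have hγ2 : γ ≤ H x - H (x - ε / 2) := min_le_right _ _
  have h3 : dyadicRight F g N x < x + ε / 2 := h.lt_of_H_lt (by linarith)
  have h4 : x - ε / 2 < dyadicLeft F g N x := h.lt_of_H_lt (by linarith)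
  linarith

/-- A dyadic interval with bounded sum has a definite proportion outside `injectivePoints H`. -/
lemma volume_injectivePoints_inter_dyadic_le (h : SemiconjLift F g H C) {c d K : ℝ} (hc : 0 ≤ c)
    (hcd : c < d) (hd : d ≤ 1) (hH : H c = H d) {N : ℕ} {x : ℝ} (hK : dyadicSum F g N x ≤ K) :
    volume (injectivePoints H ∩ Icc (dyadicLeft F g N x) (dyadicRight F g N x)) ≤
      ENNReal.ofReal ((1 - Real.exp (-(C * K)) * (d - c)) *
        (dyadicRight F g N x - dyadicLeft F g N x)) := by
  set j := ⌊F^[N] x⌋ with hj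
  set L := dyadicLeft F g N x with hL
  set R := dyadicRight F g N x with hR
  set u := g^[N] (c + j) with hu
  set v := g^[N] (d + j) with hv
  have hgm := h.strictMono_iterate_g N
  have hLu : L ≤ u := hgm.monotone (by linarith)
  have huv : u < v := hgm (by linarith)
  have hvR : v ≤ R := hgm.monotone (by linarith)
  have hLR : L < R := h.dyadicLeft_lt_dyadicRight N x
  have hFL : F^[N] L = j := h.iterate_iterate_g _ _
  have hFR : F^[N] R = j + 1 := h.iterate_iterate_g _ _
  have hdist := h.distortion_iterate N hLu huv.le hvR le_rfl hLR.le le_rfl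
  rw [hFL, hFR, hu, hv, h.iterate_iterate_g, h.iterate_iterate_g, ← hu, ← hv] at hdist
  have hexp : Real.exp (C * ∑ i ∈ Finset.range N, (F^[i] R - F^[i] L)) ≤ Real.exp (C * K) :=
    Real.exp_le_exp.mpr (mul_le_mul_of_nonneg_left hK h.nonneg)
  have hlen : Real.exp (-(C * K)) * (d - c) * (R - L) ≤ v - u := by
    have h1 : (d - c) * (R - L) ≤ Real.exp (C * K) * (v - u) := by
      have h2 := mul_le_mul_of_nonneg_right hexp (sub_nonneg.mpr huv.le)
      linarith
    have h3 := mul_le_mul_of_nonneg_left h1 (Real.exp_pos (-(C * K))).le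
    rw [← mul_assoc, ← mul_assoc, ← Real.exp_add, neg_add_cancel, Real.exp_zero, one_mul] at h3
    exact h3
  have hHuv : H u = H v := by
    have h1 := h.H_iterate_g N (c + j)
    have h2 := h.H_iterate_g N (d + j)
    rw [h.H_add_int] at h1 h2
    have h2N : (2 : ℝ) ^ N ≠ 0 := by positivity
    apply mul_left_cancel₀ h2N
    rw [h1, h2, hH]
  have hsub : injectivePoints H ∩ Icc L R ⊆ Icc L u ∪ Icc v R := by
    rintro t ⟨ht, htL, htR⟩
    rcases le_or_gt t u with hle | hlt
    · exact Or.inl ⟨htL, hle⟩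
    · refine Or.inr ⟨?_, htR⟩
      by_contra! hlt'
      have := ht u (h.eq_of_mem_Icc hHuv ⟨hlt.le, hlt'.le⟩).symm
      linarith
  calc volume (injectivePoints H ∩ Icc L R) ≤ volume (Icc L u) + volume (Icc v R) :=
        (measure_mono hsub).trans (measure_union_le _ _)
    _ = ENNReal.ofReal ((u - L) + (R - v)) := by
        rw [Real.volume_Icc, Real.volume_Icc, ENNReal.ofReal_add (by linarith) (by linarith)]
    _ ≤ _ := ENNReal.ofReal_le_ofReal (by linarith)

/-- If `H` is not injective, then almost every point has a nontrivial `H`-fibre. -/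
theorem volume_injectivePoints (h : SemiconjLift F g H C) {c d : ℝ} (hcd : c < d)
    (hH : H c = H d) : volume (injectivePoints H) = 0 := by
  obtain ⟨c, d, hc, hcd, hd, hH⟩ := h.exists_plateau_unit hcd hH
  have hmeas := h.measurableSet_injectivePoints
  have hcount : (injectivePoints H ∩ {x | ¬ Irrational (H x)}).Countable := by
    refine MapsTo.countable_of_injOn (f := H) (t := range ((↑) : ℚ → ℝ)) ?_ ?_
      (countable_range _)
    · rintro x ⟨-, hx⟩
      exact not_not.mp hx
    · rintro x - y ⟨hy, -⟩ hxy
      exact hy x hxy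
  have hirr : ∀ᵐ x ∂volume.restrict (injectivePoints H), Irrational (H x) := by
    rw [ae_restrict_iff' hmeas, ae_iff]
    convert hcount.measure_zero volume using 2
    ext x
    simp
  rw [← Measure.restrict_eq_zero, ← ae_eq_bot, ← Filter.eventually_false_iff_eq_bot]
  filter_upwards [hirr, ae_restrict_mem hmeas,
    IsUnifLocDoublingMeasure.ae_tendsto_measure_inter_div volume (injectivePoints H) 1]
    with x hxirr hxB hdens
  obtain ⟨K, hK⟩ := h.HasSummableTimes_of_irrational hxirr
  choose N hN hNK using hK
  set L := fun k => dyadicLeft F g (N k) x with hL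
  set R := fun k => dyadicRight F g (N k) x with hR
  have hLR : ∀ k, L k < R k := fun k => h.dyadicLeft_lt_dyadicRight _ x
  have hball : ∀ k, Metric.closedBall ((L k + R k) / 2) ((R k - L k) / 2) = Icc (L k) (R k) := by
    intro k
    rw [Real.closedBall_eq_Icc]
    congr 1 <;> ring
  have hlim : Tendsto (fun k => (R k - L k) / 2) atTop (𝓝[>] 0) := by
    rw [tendsto_nhdsWithin_iff]
    refine ⟨?_, Eventually.of_forall fun k => by simpa using hLR k⟩
    rw [Metric.tendsto_atTop]
    intro ε hε
    obtain ⟨N₀, hN₀⟩ := h.eventually_dyadic_length_lt hxB hε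
    refine ⟨N₀, fun k hk => ?_⟩
    have h1 := hN₀ (N k) (hk.trans (hN k))
    have h2 := hLR k
    simp only [hL, hR] at h2 ⊢
    rw [Real.dist_eq, sub_zero, abs_of_pos (by linarith)]
    linarith
  have htend := hdens (fun k => (L k + R k) / 2) _ hlim (Eventually.of_forall fun k => by
    rw [one_mul, hball]
    exact ⟨h.dyadicLeft_le _ x, h.le_dyadicRight _ x⟩)
  have hle : (1 : ENNReal) ≤ ENNReal.ofReal (1 - Real.exp (-(C * K)) * (d - c)) := by
    refine le_of_tendsto htend (Eventually.of_forall fun k => ?_)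
    rw [hball, Real.volume_Icc]
    apply ENNReal.div_le_of_le_mul
    rw [← ENNReal.ofReal_mul' (sub_nonneg.mpr (hLR k).le)]
    exact h.volume_injectivePoints_inter_dyadic_le hc hcd hd hH (hNK k)
  rw [ENNReal.one_le_ofReal] at hle
  have := mul_pos (Real.exp_pos (-(C * K))) (sub_pos.mpr hcd)
  linarith

end SemiconjLift

lemma exists_bound_of_periodic {f : ℝ → ℝ} (hf : Continuous f) (hper : ∀ x, f (x + 1) = f x) :
    ∃ M, 0 ≤ M ∧ ∀ x, |f x| ≤ M := by
  obtain ⟨M, hM⟩ := isCompact_Icc.exists_bound_of_continuousOn (s := Icc (0 : ℝ) 1) hf.continuousOn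
  refine ⟨M, (norm_nonneg _).trans (hM 0 (by simp)), fun x => ?_⟩
  obtain ⟨y, hy, hxy⟩ := Function.Periodic.exists_mem_Ico₀ (f := f) (c := 1) hper one_pos x
  rw [hxy]
  exact hM y ⟨hy.1, hy.2.le⟩

lemma deriv_add_one {f : ℝ → ℝ} {c : ℝ} (hper : ∀ x, f (x + 1) = f x + c) (x : ℝ) :
    deriv f (x + 1) = deriv f x := by
  have : (fun x => f (x + 1)) = fun x => f x + c := funext hper
  rw [← deriv_comp_add_const, this, deriv_add_const]

/-- The logarithm of the derivative of a `C²` degree-two lift is Lipschitz. -/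
lemma exists_deriv_le_exp {F : ℝ → ℝ} (hC2 : ContDiff ℝ 2 F) (hpos : ∀ x, 0 < deriv F x)
    (hadd : ∀ x, F (x + 1) = F x + 2) :
    ∃ C, 0 ≤ C ∧ ∀ ξ η, deriv F ξ ≤ Real.exp (C * |ξ - η|) * deriv F η := by
  have hd1 : ContDiff ℝ 1 (deriv F) := hC2.deriv' (n := 1)
  set l : ℝ → ℝ := fun x => Real.log (deriv F x) with hl
  have hlC : ContDiff ℝ 1 l := hd1.log fun x => (hpos x).ne'
  have hlper : ∀ x, l (x + 1) = l x + 0 := by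
    intro x
    simp only [hl]
    rw [deriv_add_one hadd, add_zero]
  obtain ⟨C, hC0, hC⟩ := exists_bound_of_periodic hlC.continuous_deriv_one (deriv_add_one hlper)
  refine ⟨C, hC0, fun ξ η => ?_⟩
  have hlip := convex_univ.norm_image_sub_le_of_norm_deriv_le (f := l) (C := C) (x := η) (y := ξ)
    (fun x _ => (hlC.differentiable one_ne_zero).differentiableAt) (fun x _ => hC x)
    (mem_univ _) (mem_univ _)
  rw [Real.norm_eq_abs, Real.norm_eq_abs] at hlip
  have hle : l ξ ≤ C * |ξ - η| + l η := by linarith [le_abs_self (l ξ - l η)]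
  have := Real.exp_le_exp.mpr hle
  rwa [Real.exp_add, Real.exp_log (hpos _), Real.exp_log (hpos _)] at this

lemma exists_distortion {F : ℝ → ℝ} (hC2 : ContDiff ℝ 2 F) (hpos : ∀ x, 0 < deriv F x)
    (hadd : ∀ x, F (x + 1) = F x + 2) :
    ∃ C, 0 ≤ C ∧ ∀ a b u v p q, a ≤ u → u ≤ v → v ≤ b → a ≤ p → p ≤ q → q ≤ b →
      (F v - F u) * (q - p) ≤ Real.exp (C * (b - a)) * ((F q - F p) * (v - u)) := by
  obtain ⟨C, hC0, hC⟩ := exists_deriv_le_exp hC2 hpos hadd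
  refine ⟨C, hC0, fun a b u v p q hau huv hvb hap hpq hqb => ?_⟩
  rcases huv.eq_or_lt with rfl | huv
  · simp
  rcases hpq.eq_or_lt with rfl | hpq
  · simp
  have hdiff : Differentiable ℝ F := hC2.differentiable two_ne_zero
  obtain ⟨ξ, hξ, hξe⟩ := exists_deriv_eq_slope F huv hdiff.continuous.continuousOn
    hdiff.differentiableOn
  obtain ⟨η, hη, hηe⟩ := exists_deriv_eq_slope F hpq hdiff.continuous.continuousOn
    hdiff.differentiableOn
  rw [eq_div_iff (sub_pos.mpr huv).ne'] at hξe
  rw [eq_div_iff (sub_pos.mpr hpq).ne'] at hηe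
  have habs : |ξ - η| ≤ b - a := by
    rw [abs_le]
    constructor <;> linarith [hξ.1, hξ.2, hη.1, hη.2]
  have hexp : deriv F ξ ≤ Real.exp (C * (b - a)) * deriv F η :=
    (hC ξ η).trans (mul_le_mul_of_nonneg_right
      (Real.exp_le_exp.mpr (mul_le_mul_of_nonneg_left habs hC0)) (hpos η).le)
  have hprod : 0 ≤ (v - u) * (q - p) :=
    mul_nonneg (sub_pos.mpr huv).le (sub_pos.mpr hpq).le
  rw [← hξe, ← hηe]
  linarith [mul_le_mul_of_nonneg_right hexp hprod]

lemma iterate_add_one {F : ℝ → ℝ} (hadd : ∀ x, F (x + 1) = F x + 2) (n : ℕ) (x : ℝ) :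
    F^[n] (x + 1) = F^[n] x + 2 ^ n := by
  have hnat : ∀ (m : ℕ) (x : ℝ), F (x + m) = F x + 2 * m := by
    intro m
    induction m with
    | zero => simp
    | succ m ih => intro x; push_cast; rw [← add_assoc, hadd, ih]; ring
  induction n with
  | zero => simp
  | succ n ih =>
    rw [Function.iterate_succ_apply', Function.iterate_succ_apply', ih]
    have := hnat (2 ^ n) (F^[n] x)
    push_cast at this
    rw [this, pow_succ]
    ring

/-- A degree-two lift is semiconjugate to multiplication by two. -/
lemma exists_semiconj {F : ℝ → ℝ} (hcont : Continuous F) (hmono : StrictMono F)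
    (hadd : ∀ x, F (x + 1) = F x + 2) :
    ∃ H : ℝ → ℝ, Monotone H ∧ Continuous H ∧ (∀ x, H (x + 1) = H x + 1) ∧
      ∀ x, H (F x) = 2 * H x := by
  obtain ⟨M, hM0, hM⟩ := exists_bound_of_periodic (f := fun x => F x - 2 * x) (by fun_prop)
    (fun x => by simp only [hadd]; ring)
  have hbd : ∀ (n : ℕ) (x : ℝ), ‖(F (F^[n] x) - 2 * F^[n] x) / 2 ^ (n + 1)‖ ≤
      M / 2 * (1 / 2) ^ n := by
    intro n x
    rw [norm_div, Real.norm_eq_abs, Real.norm_of_nonneg (by positivity), one_div, inv_pow,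
      ← div_eq_mul_inv, div_div, pow_succ, mul_comm (2 ^ n)]
    exact div_le_div_of_nonneg_right (hM _) (by positivity)
  have hsum : Summable fun n : ℕ => M / 2 * (1 / 2 : ℝ) ^ n := summable_geometric_two.mul_left _
  set H : ℝ → ℝ := fun x => x + ∑' n, (F (F^[n] x) - 2 * F^[n] x) / 2 ^ (n + 1) with hH
  have hlim : ∀ x, Tendsto (fun N => F^[N] x / 2 ^ N) atTop (𝓝 (H x)) := by
    intro x
    have hs := (Summable.of_norm_bounded hsum fun n => hbd n x).hasSum.tendsto_sum_nat.const_add x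
    refine hs.congr fun N => ?_
    induction N with
    | zero => simp
    | succ N ih =>
      rw [Finset.sum_range_succ, ← add_assoc, ih, Function.iterate_succ_apply']
      field_simp
      ring
  refine ⟨H, fun x y hxy => ?_, ?_, fun x => ?_, fun x => ?_⟩
  · refine le_of_tendsto_of_tendsto' (hlim x) (hlim y) fun N => ?_
    exact div_le_div_of_nonneg_right ((hmono.iterate N).monotone hxy) (by positivity)
  · refine continuous_id.add (continuous_tsum (fun n => ?_) hsum hbd)
    have := hcont.iterate n
    fun_prop
  · refine tendsto_nhds_unique (hlim (x + 1)) (((hlim x).add_const 1).congr fun N => ?_)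
    rw [iterate_add_one hadd, add_div, div_self (by positivity)]
  · refine tendsto_nhds_unique (hlim (F x))
      ((((hlim x).comp (tendsto_add_atTop_nat 1)).const_mul 2).congr fun N => ?_)
    simp only [Function.comp_apply, Function.iterate_succ_apply, pow_succ]
    field_simp

lemma exists_semiconjLift {F : ℝ → ℝ} (hmono : StrictMono F) (hC2 : ContDiff ℝ 2 F)
    (hpos : ∀ x, 0 < deriv F x) (hadd : ∀ x, F (x + 1) = F x + 2) (h0 : F 0 = 0) :
    ∃ (g H : ℝ → ℝ) (C : ℝ), SemiconjLift F g H C := by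
  have hcont := hC2.continuous
  obtain ⟨H, hH1, hH2, hH3, hH4⟩ := exists_semiconj hcont hmono hadd
  obtain ⟨C, hC0, hC⟩ := exists_distortion hC2 hpos hadd
  obtain ⟨M, -, hM⟩ := exists_bound_of_periodic (f := fun x => F x - 2 * x) (by fun_prop)
    (fun x => by simp only [hadd]; ring)
  have hsurj : Function.Surjective F := by
    apply hcont.surjective
    · refine tendsto_atTop_mono (f := fun x => 2 * x - M) (fun x => ?_) ?_
      · linarith [(abs_le.mp (hM x)).1]
      · exact tendsto_atTop_add_const_right _ _ (tendsto_id.const_mul_atTop two_pos)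
    · refine tendsto_atBot_mono (f := fun x => 2 * x + M) (fun x => ?_) ?_
      · linarith [(abs_le.mp (hM x)).2]
      · exact tendsto_atBot_add_const_right _ _ (tendsto_id.const_mul_atBot two_pos)
  exact ⟨Function.surjInv hsurj, H, C, hmono, hadd, h0,
    Function.leftInverse_surjInv ⟨hmono.injective, hsurj⟩, Function.rightInverse_surjInv hsurj,
    hH1, hH2, hH3, hH4, hC0, hC⟩

lemma unitAddCircle_coe_eq_iff {x y : ℝ} :
    (x : UnitAddCircle) = (y : UnitAddCircle) ↔ ∃ m : ℤ, x = y + m := by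
  rw [← sub_eq_zero, ← AddCircle.coe_sub, AddCircle.coe_eq_zero_iff]
  simp only [zsmul_eq_mul, mul_one]
  exact exists_congr fun m => by rw [eq_sub_iff_add_eq', eq_comm]

lemma unitAddCircle_coe_add_int (x : ℝ) (m : ℤ) : ((x + m : ℝ) : UnitAddCircle) = x :=
  unitAddCircle_coe_eq_iff.mpr ⟨m, rfl⟩

lemma IsLiftDeg2.iterate_coe {φ : UnitAddCircle → UnitAddCircle} {F : ℝ → ℝ}
    (hF : IsLiftDeg2 φ F) (n : ℕ) (x : ℝ) :
    φ^[n] (x : UnitAddCircle) = ((F^[n] x : ℝ) : UnitAddCircle) := by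
  induction n with
  | zero => rfl
  | succ n ih => rw [Function.iterate_succ_apply', ih, hF.2.2.2, Function.iterate_succ_apply']

namespace SemiconjLift

variable {F g H : ℝ → ℝ} {C : ℝ} {φ : UnitAddCircle → UnitAddCircle}

lemma H_eq_of_isPeriodicInterval (h : SemiconjLift F g H C) (hF : IsLiftDeg2 φ F) {s : ℕ}
    (hs : 1 ≤ s) {a ℓ : ℝ} (hℓ0 : 0 < ℓ) (hℓ1 : ℓ < 1)
    (hbij : BijOn (φ^[s]) (closedArc a ℓ) (closedArc a ℓ)) : H a = H (a + ℓ) := by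
  have hlen : ∀ n : ℕ, F^[s * n] (a + ℓ) ≤ F^[s * n] a + 1 := by
    intro n
    by_contra! hlt
    have hinj : InjOn (φ^[s * n]) (closedArc a ℓ) := by
      rw [Function.iterate_mul]
      exact (hbij.iterate n).injOn
    set t := g^[s * n] (F^[s * n] a + 1) with ht
    have hFt : F^[s * n] t = F^[s * n] a + 1 := h.iterate_iterate_g _ _
    have hat : a < t := (h.strictMono_iterate (s * n)).lt_iff_lt.mp (by rw [hFt]; linarith)
    have hta : t < a + ℓ := (h.strictMono_iterate (s * n)).lt_iff_lt.mp (by rwa [hFt])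
    have heq : (t : UnitAddCircle) = (a : UnitAddCircle) := by
      apply hinj ⟨t, ⟨hat.le, hta.le⟩, rfl⟩ ⟨a, ⟨le_rfl, by linarith⟩, rfl⟩
      rw [hF.iterate_coe, hF.iterate_coe, hFt]
      exact_mod_cast unitAddCircle_coe_add_int _ 1
    obtain ⟨m, hm⟩ := unitAddCircle_coe_eq_iff.mp heq
    have h1 : (0 : ℝ) < m := by linarith
    have h2 : (m : ℝ) < 1 := by linarith
    have h3 : 0 < m := by exact_mod_cast h1
    have h4 : m < 1 := by exact_mod_cast h2
    omega
  apply le_antisymm (h.monotone_H (by linarith))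
  by_contra! hlt
  obtain ⟨n, hn⟩ := pow_unbounded_of_one_lt (1 / (H (a + ℓ) - H a)) one_lt_two
  rw [div_lt_iff₀ (sub_pos.mpr hlt)] at hn
  have h1 := h.monotone_H (hlen n)
  rw [h.H_add_one, h.H_iterate, h.H_iterate] at h1
  have h2 : (2 : ℝ) ^ n ≤ 2 ^ (s * n) :=
    pow_le_pow_right₀ one_le_two (Nat.le_mul_of_pos_left n hs)
  have h3 := mul_le_mul_of_nonneg_right h2 (sub_pos.mpr hlt).le
  linarith

/-- A nondegenerate periodic `H`-fibre projects to a maximal periodic interval. -/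
lemma isMaxPeriodicInterval_of_fiber (h : SemiconjLift F g H C) (hF : IsLiftDeg2 φ F) {s : ℕ}
    (hs : 1 ≤ s) {c d w : ℝ} {k : ℤ} (hcd : c < d) (hc : H c = w) (hd : H d = w)
    (hmin : ∀ x, w ≤ H x → c ≤ x) (hmax : ∀ x, H x ≤ w → x ≤ d) (hw : 2 ^ s * w = w + k) :
    IsMaxPeriodicInterval φ (closedArc c (d - c)) := by
  have hm := h.strictMono_iterate s
  have hd1 : d < c + 1 := h.lt_of_H_lt (by rw [h.H_add_one, hc, hd]; linarith)
  have hg : ∀ t, H t = w → H (g^[s] (t + k)) = w := by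
    intro t ht
    have := h.H_iterate_g s (t + k)
    rw [h.H_add_int, ht, ← hw] at this
    exact mul_left_cancel₀ (by positivity) this
  have hf : ∀ t, H t = w → H (F^[s] t + (-k : ℤ)) = w := by
    intro t ht
    rw [h.H_add_int, h.H_iterate, ht, hw]
    push_cast
    ring
  have hfib : ∀ t, H t = w → t ∈ Icc c d := fun t ht => ⟨hmin t ht.ge, hmax t ht.le⟩
  have hval : ∀ t ∈ Icc c d, H t = w := fun t ht => by
    rw [h.eq_of_mem_Icc (hc.trans hd.symm) ht, hc]
  refine ⟨⟨s, hs, ⟨c, d - c, by linarith, by linarith, rfl⟩, ?_, ?_, ?_⟩, ?_⟩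
  · rintro _ ⟨t, ht, rfl⟩
    rw [add_sub_cancel] at ht
    refine ⟨F^[s] t + (-k : ℤ), ?_, ?_⟩
    · rw [add_sub_cancel]
      exact hfib _ (hf t (hval t ht))
    · simp only
      rw [unitAddCircle_coe_add_int, hF.iterate_coe]
  · rintro _ ⟨t, ht, rfl⟩ _ ⟨t', ht', rfl⟩ heq
    rw [add_sub_cancel] at ht ht'
    simp only at heq
    rw [hF.iterate_coe, hF.iterate_coe, unitAddCircle_coe_eq_iff] at heq
    obtain ⟨m, hm'⟩ := heq
    have h1 := hfib _ (hf t (hval t ht))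
    have h2 := hfib _ (hf t' (hval t' ht'))
    have h3 : (m : ℝ) < 1 := by linarith [h1.2, h2.1]
    have h4 : (-1 : ℝ) < m := by linarith [h1.1, h2.2]
    have h5 : m < 1 := by exact_mod_cast h3
    have h6 : -1 < m := by exact_mod_cast h4
    obtain rfl : m = 0 := by omega
    rw [Int.cast_zero, add_zero] at hm'
    rw [hm.injective hm']
  · rintro _ ⟨u, hu, rfl⟩
    rw [add_sub_cancel] at hu
    refine ⟨_, ⟨g^[s] (u + k), ?_, rfl⟩, ?_⟩
    · rw [add_sub_cancel]
      exact hfib _ (hg u (hval u hu))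
    · simp only
      rw [hF.iterate_coe, h.iterate_iterate_g, unitAddCircle_coe_add_int]
  · rintro _ ⟨s', hs', ⟨a, ℓ, hℓ0, hℓ1, rfl⟩, hbij⟩ hsub
    apply Subset.antisymm hsub
    have hH := h.H_eq_of_isPeriodicInterval hF hs' hℓ0 hℓ1 hbij
    obtain ⟨t, ht, htc⟩ := hsub ⟨c, ⟨le_rfl, by linarith⟩, rfl⟩
    obtain ⟨m, rfl⟩ := unitAddCircle_coe_eq_iff.mp htc
    rintro _ ⟨u, hu, rfl⟩
    refine ⟨u + (-m : ℤ), ?_, unitAddCircle_coe_add_int u _⟩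
    rw [add_sub_cancel]
    apply hfib
    have h1 := h.eq_of_mem_Icc hH ht
    have h2 := h.eq_of_mem_Icc hH hu
    rw [h.H_add_int, hc] at h1
    rw [h.H_add_int]
    push_cast
    linarith

lemma mem_injectivePoints_of_mem_lambdaSet (h : SemiconjLift F g H C) (hF : IsLiftDeg2 φ F)
    {x : ℝ} (hx : (x : UnitAddCircle) ∈ lambdaSet φ) : x ∈ injectivePoints H := by
  by_contra hcon
  simp only [injectivePoints, mem_ofPred_eq, not_forall] at hcon
  obtain ⟨y, hy, hyx⟩ := hcon
  obtain ⟨i, j, hij, k, hk⟩ : ∃ i j : ℕ, i < j ∧ ∃ k : ℤ, 2 ^ j * H x = 2 ^ i * H x + k := by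
    rcases lt_or_gt_of_ne hyx with hlt | hlt
    · rw [← hy]
      exact h.eventually_periodic_of_fiber hlt hy
    · exact h.eventually_periodic_of_fiber hlt hy.symm
  obtain ⟨c, hc, hmin⟩ := h.exists_fiber_min (2 ^ i * H x)
  obtain ⟨d, hd, hmax⟩ := h.exists_fiber_max (2 ^ i * H x)
  have hxi : H (F^[i] x) = 2 ^ i * H x := h.H_iterate i x
  have hyi : H (F^[i] y) = 2 ^ i * H x := by rw [h.H_iterate, hy]
  have hne : F^[i] x ≠ F^[i] y := fun he => hyx ((h.strictMono_iterate i).injective he).symm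
  have hcd : c < d := by
    rcases lt_or_gt_of_ne hne with hlt | hlt
    · exact (hmin _ hxi.ge).trans_lt (hlt.trans_le (hmax _ hyi.le))
    · exact (hmin _ hyi.ge).trans_lt (hlt.trans_le (hmax _ hxi.le))
  have hI := h.isMaxPeriodicInterval_of_fiber hF (s := j - i) (by omega) hcd hc hd hmin hmax
    (k := k) (by rw [← mul_assoc, ← pow_add, Nat.sub_add_cancel hij.le, hk])
  refine hx.2 (mem_iUnion.mpr ⟨i, mem_iUnion₂.mpr ⟨_, hI, ?_⟩⟩)
  rw [hF.iterate_coe]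
  exact ⟨F^[i] x, by rw [add_sub_cancel]; exact ⟨hmin _ hxi.ge, hmax _ hxi.le⟩, rfl⟩

lemma volume_lambdaSet (h : SemiconjLift F g H C) (hF : IsLiftDeg2 φ F)
    (hne : {I | IsMaxPeriodicInterval φ I}.Nonempty) : volume (lambdaSet φ) = 0 := by
  obtain ⟨_, ⟨s, hs, ⟨a, ℓ, hℓ0, hℓ1, rfl⟩, hbij⟩, -⟩ := hne
  have hB := h.volume_injectivePoints (show a < a + ℓ by linarith)
    (h.H_eq_of_isPeriodicInterval hF hs hℓ0 hℓ1 hbij)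
  set e := AddCircle.measurableEquivIoc (1 : ℝ) 0 with he
  have hcoe : ∀ p, (((e p : ℝ)) : UnitAddCircle) = p := fun p =>
    (AddCircle.equivIoc (1 : ℝ) 0).symm_apply_apply p
  set S : Set UnitAddCircle := {p | (e p : ℝ) ∈ injectivePoints H} with hS
  have hSm : MeasurableSet S :=
    (measurable_subtype_coe.comp e.measurable) h.measurableSet_injectivePoints
  have hsub : lambdaSet φ ⊆ S := fun p hp =>
    h.mem_injectivePoints_of_mem_lambdaSet hF (by rwa [hcoe])
  refine measure_mono_null hsub ?_
  rw [← (UnitAddCircle.measurePreserving_mk 0).measure_preimage hSm.nullMeasurableSet,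
    Measure.restrict_apply' measurableSet_Ioc]
  refine measure_mono_null ?_ hB
  rintro x ⟨hxS, hx⟩
  have hex : (e (x : UnitAddCircle) : ℝ) = x := by
    have := (AddCircle.equivIoc (1 : ℝ) 0).apply_symm_apply ⟨x, hx⟩
    exact congrArg Subtype.val this
  rw [mem_preimage, hS, mem_ofPred_eq, hex] at hxS
  exact hxS

end SemiconjLift

/-- if the `C²` action of `T_φ` admits the exceptional minimal set `Λ`,
then `Λ` has Lebesgue measure zero. -/
theorem thompson_exceptional_measure_zero
    (φ : UnitAddCircle → UnitAddCircle) (F : ℝ → ℝ)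
    (hF : IsLiftDeg2 φ F) (hC2 : ContDiff ℝ 2 F) (hpos : ∀ x : ℝ, 0 < deriv F x)
    (h0 : φ 0 = 0) (hd1 : deriv F 0 = 1) (hd2 : deriv (deriv F) 0 = 0)
    (hnc : ¬ ConjugateToDoubling φ)
    (hfin : {I | IsMaxPeriodicInterval φ I}.Finite)
    (hne : {I | IsMaxPeriodicInterval φ I}.Nonempty) :
    volume (lambdaSet φ) = 0 := by
  obtain ⟨k, hk⟩ : ∃ k : ℤ, F 0 = k := by
    have h1 := hF.2.2.2 0
    rw [AddCircle.coe_zero, h0, eq_comm, ← AddCircle.coe_zero, unitAddCircle_coe_eq_iff] at h1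
    simpa using h1
  have hF' : IsLiftDeg2 φ (fun x => F x - k) := by
    refine ⟨hF.1.sub continuous_const, fun x y hxy => sub_lt_sub_right (hF.2.1 hxy) _,
      fun x => by simp only [hF.2.2.1]; ring, fun x => ?_⟩
    have := unitAddCircle_coe_add_int (F x) (-k)
    rw [Int.cast_neg, ← sub_eq_add_neg] at this
    rw [this, hF.2.2.2]
  obtain ⟨g, H, C, h⟩ := exists_semiconjLift hF'.2.1 (hC2.sub contDiff_const)
    (fun x => by rw [deriv_sub_const]; exact hpos x) hF'.2.2.1 (by rw [hk, sub_self])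
  exact h.volume_lambdaSet hF' hne
end
end

section
/- Let φ be a circle covering map of degree two of class C² with positive derivative, with φ(0)=0, φ′(0)=1 and φ″(0)=0, and suppose φ is topologically conjugate to the doubling map (so the action of T_φ on the circle is minimal). Then the action of T_φ satisfies property (∗): for every x ∈ 𝕊¹ such that g′(x) ≤ 1 for all g ∈ T_φ, there exist g₊, g₋ ∈ T_φ with g₊(x) = x = g₋(x), g₊′(x) = 1 = g₋′(x), and there exists δ > 0 such that, denoting by ĝ₊ and ĝ₋ the lifts of g₊ and g₋ fixing a lift x̃ of x, one has ĝ₊(y) > y for all y ∈ (x̃, x̃+δ) and ĝ₋(y) < y for all y ∈ (x̃−δ, x̃); that is, g₊ is parabolic repelling from the right at x and g₋ is parabolic repelling from the left at x. -/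
open Set Filter MeasureTheory Topology

noncomputable section

/-- A normalized `C²` lift `F` of a degree two circle covering fixing `0` whose dyadic partitions
have mesh tending to zero. -/
structure ExpandingLift (F : ℝ → ℝ) : Prop where
  cont : Continuous F
  mono : StrictMono F
  map_add_one : ∀ x, F (x + 1) = F x + 2
  map_zero : F 0 = 0
  contDiff : ContDiff ℝ 2 F
  deriv_pos : ∀ x, 0 < deriv F x
  mesh : ∀ ε > 0, ∃ N, ∀ n ≥ N, ∀ a b, F^[n] b ≤ F^[n] a + 1 → b - a ≤ ε

namespace ExpandingLift

variable {F : ℝ → ℝ} (hF : ExpandingLift F)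
include hF

theorem iter_cont (n : ℕ) : Continuous F^[n] := hF.cont.iterate n

theorem iter_mono (n : ℕ) : StrictMono F^[n] := hF.mono.iterate n

theorem map_add_int (x : ℝ) (k : ℤ) : F (x + k) = F x + 2 * k := by
  induction k using Int.induction_on with
  | zero => simp
  | succ i ih =>
    have := hF.map_add_one (x + i)
    push_cast at *
    rw [← add_assoc, this, ih]; ring
  | pred i ih =>
    have := hF.map_add_one (x + (-i - 1))
    push_cast at *
    rw [show x + (-(i : ℝ) - 1) + 1 = x + -i by ring, ih] at this
    linarith

theorem iter_add_int (n : ℕ) (x : ℝ) (k : ℤ) : F^[n] (x + k) = F^[n] x + 2 ^ n * k := by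
  induction n with
  | zero => simp
  | succ n ih =>
    have := hF.map_add_int (F^[n] x) (2 ^ n * k)
    push_cast at this
    rw [Function.iterate_succ_apply', ih, this, Function.iterate_succ_apply']; ring

theorem iter_int (n : ℕ) (k : ℤ) : F^[n] (k : ℝ) = 2 ^ n * k := by
  have h0 : F^[n] 0 = 0 := Function.iterate_fixed hF.map_zero n
  simpa [h0] using hF.iter_add_int n 0 k

theorem surjective : Function.Surjective F := by
  intro t
  have h1 := hF.iter_int 1 ⌊t / 2⌋
  have h2 := hF.iter_int 1 (⌊t / 2⌋ + 1)
  simp only [Function.iterate_one, pow_one] at h1 h2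
  have := Int.floor_le (t / 2)
  have := Int.lt_floor_add_one (t / 2)
  obtain ⟨y, -, hy⟩ := intermediate_value_Icc (a := (⌊t / 2⌋ : ℝ)) (b := ((⌊t / 2⌋ + 1 : ℤ) : ℝ))
    (by push_cast; linarith) hF.cont.continuousOn
    (show t ∈ Icc _ _ by rw [h1, h2]; push_cast; constructor <;> linarith)
  exact ⟨y, hy⟩

theorem iter_surjective (n : ℕ) : Function.Surjective F^[n] := hF.surjective.iterate n

theorem floor_iter_add (m s : ℕ) (y : ℝ) : ⌊F^[m] y⌋ = ⌊F^[m + s] y⌋ / 2 ^ s := by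
  have h1 := (hF.iter_mono s).monotone (Int.floor_le (F^[m] y))
  have h2 := hF.iter_mono s (Int.lt_floor_add_one (F^[m] y))
  rw [← Function.iterate_add_apply, add_comm s m] at h1 h2
  have e := hF.iter_int s (⌊F^[m] y⌋ + 1)
  push_cast at e
  rw [hF.iter_int] at h1
  rw [e] at h2
  have h1' : 2 ^ s * ⌊F^[m] y⌋ ≤ ⌊F^[m + s] y⌋ := Int.le_floor.2 (by push_cast; exact h1)
  have h2' : ⌊F^[m + s] y⌋ < 2 ^ s * (⌊F^[m] y⌋ + 1) := Int.floor_lt.2 (by push_cast; exact h2)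
  symm
  rw [Int.ediv_eq_iff_of_pos (by positivity)]
  constructor <;> nlinarith

theorem floor_iter_add_int (n : ℕ) (y : ℝ) (k : ℤ) :
    ⌊F^[n] (y + k)⌋ = ⌊F^[n] y⌋ + 2 ^ n * k := by
  rw [hF.iter_add_int]
  exact_mod_cast Int.floor_add_intCast (F^[n] y) (2 ^ n * k)

theorem differentiable : Differentiable ℝ F := hF.contDiff.differentiable (by norm_num)

theorem iter_differentiable (n : ℕ) : Differentiable ℝ F^[n] := hF.differentiable.iterate n

theorem deriv_iter_succ (n : ℕ) (y : ℝ) :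
    deriv F^[n + 1] y = deriv F (F^[n] y) * deriv F^[n] y := by
  rw [Function.iterate_succ', deriv_comp _ (hF.differentiable _) (hF.iter_differentiable n y)]

theorem deriv_iter_pos (n : ℕ) (y : ℝ) : 0 < deriv F^[n] y := by
  induction n with
  | zero => simp
  | succ n ih => rw [hF.deriv_iter_succ]; exact mul_pos (hF.deriv_pos _) ih

theorem deriv_periodic : Function.Periodic (deriv F) 1 := by
  intro x
  rw [← deriv_comp_add_const, show (fun x => F (x + 1)) = fun x => F x + 2 from
    funext hF.map_add_one, deriv_add_const]

theorem exists_lipschitz : ∃ C : ℝ, 0 ≤ C ∧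
    ∀ u v, |Real.log (deriv F u) - Real.log (deriv F v)| ≤ C * |u - v| := by
  have hd : ContDiff ℝ 1 (deriv F) := by
    have := hF.contDiff
    rw [show (2 : WithTop ℕ∞) = 1 + 1 by norm_num, contDiff_succ_iff_deriv] at this
    exact this.2.2
  have hg : ContDiff ℝ 1 (fun x => Real.log (deriv F x)) := hd.log fun x => (hF.deriv_pos x).ne'
  have hper : Function.Periodic (deriv fun x => Real.log (deriv F x)) 1 := by
    intro x
    rw [← deriv_comp_add_const]
    congr 1
    funext y
    rw [hF.deriv_periodic y]
  have hc := hg.continuous_deriv (le_refl _)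
  obtain ⟨C, hC⟩ := isCompact_Icc.exists_bound_of_continuousOn (s := Icc (0 : ℝ) 1) hc.continuousOn
  have hb : ∀ x, ‖deriv (fun x => Real.log (deriv F x)) x‖ ≤ C := by
    intro x
    have := hC (Int.fract x) ⟨Int.fract_nonneg x, (Int.fract_lt_one x).le⟩
    rwa [show Int.fract x = x - ⌊x⌋ * 1 by rw [mul_one]; rfl, hper.sub_int_mul_eq] at this
  refine ⟨C, (norm_nonneg _).trans (hb 0), fun u v => ?_⟩
  have := convex_univ.norm_image_sub_le_of_norm_deriv_le
    (fun x _ => hg.differentiable (by norm_num) x) (fun x _ => hb x) (mem_univ v) (mem_univ u)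
  simpa using this

theorem exists_deriv_le : ∃ M : ℝ, 0 < M ∧ ∀ x, deriv F x ≤ M := by
  obtain ⟨M, hM⟩ := isCompact_Icc.exists_bound_of_continuousOn (s := Icc (0 : ℝ) 1)
    (hF.contDiff.continuous_deriv (by norm_num)).continuousOn
  have hb : ∀ x, deriv F x ≤ M := by
    intro x
    have := hM (Int.fract x) ⟨Int.fract_nonneg x, (Int.fract_lt_one x).le⟩
    rw [show Int.fract x = x - ⌊x⌋ * 1 by rw [mul_one]; rfl, hF.deriv_periodic.sub_int_mul_eq]
      at this
    exact (le_abs_self _).trans this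
  exact ⟨M, (hF.deriv_pos 0).trans_le (hb 0), hb⟩

theorem exists_iter_sub_le (d : ℕ) : ∃ M : ℝ, 0 < M ∧
    ∀ a b, a ≤ b → F^[d] b - F^[d] a ≤ M * (b - a) := by
  obtain ⟨M, hM0, hM⟩ := hF.exists_deriv_le
  induction d with
  | zero => exact ⟨1, one_pos, fun a b _ => by simp⟩
  | succ d ih =>
    obtain ⟨K, hK0, hK⟩ := ih
    refine ⟨M * K, by positivity, fun a b hab => ?_⟩
    rw [Function.iterate_succ_apply', Function.iterate_succ_apply']
    have h1 := image_sub_le_mul_sub_of_deriv_le hF.differentiable hM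
      ((hF.iter_mono d).monotone hab)
    have h2 := mul_le_mul_of_nonneg_left (hK a b hab) hM0.le
    linarith

/-- Distortion of `F^[n]` on `[α, β]` is controlled by the total length of the iterates. -/
theorem distortion {C : ℝ}
    (hC : ∀ u v, |Real.log (deriv F u) - Real.log (deriv F v)| ≤ C * |u - v|) (hC0 : 0 ≤ C)
    (n : ℕ) {α β u v : ℝ} (hu : u ∈ Icc α β) (hv : v ∈ Icc α β) :
    Real.log (deriv F^[n] u) - Real.log (deriv F^[n] v) ≤
      C * ∑ i ∈ Finset.range n, (F^[i] β - F^[i] α) := by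
  induction n with
  | zero => simp
  | succ n ih =>
    rw [hF.deriv_iter_succ, hF.deriv_iter_succ, Finset.sum_range_succ,
      Real.log_mul (hF.deriv_pos _).ne' (hF.deriv_iter_pos _ _).ne',
      Real.log_mul (hF.deriv_pos _).ne' (hF.deriv_iter_pos _ _).ne']
    have h1 := (le_abs_self _).trans (hC (F^[n] u) (F^[n] v))
    have hm := (hF.iter_mono n).monotone
    have h2 : |F^[n] u - F^[n] v| ≤ F^[n] β - F^[n] α := by
      have := hm hu.1; have := hm hu.2; have := hm hv.1; have := hm hv.2
      rw [abs_le]; constructor <;> linarith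
    have h3 := mul_le_mul_of_nonneg_left h2 hC0
    linarith

theorem exists_deriv_iter_eq (n : ℕ) {a b : ℝ} (hab : a < b) :
    ∃ ξ ∈ Ioo a b, F^[n] b - F^[n] a = deriv F^[n] ξ * (b - a) := by
  obtain ⟨ξ, hξ, h⟩ := exists_deriv_eq_slope F^[n] hab (hF.iter_cont n).continuousOn
    (hF.iter_differentiable n).differentiableOn
  refine ⟨ξ, hξ, ?_⟩
  rw [h, div_mul_cancel₀ _ (sub_pos.2 hab).ne']

theorem iter_le_add_one {i k : ℕ} (hik : i ≤ k) {a b : ℝ} (h : F^[k] b ≤ F^[k] a + 1) :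
    F^[i] b ≤ F^[i] a + 1 := by
  by_contra! hlt
  obtain ⟨s, rfl⟩ := Nat.exists_eq_add_of_le' hik
  have h1 := hF.iter_mono s hlt
  have h2 := hF.iter_add_int s (F^[i] a) 1
  push_cast at h2
  rw [h2, ← Function.iterate_add_apply, ← Function.iterate_add_apply] at h1
  have : (1 : ℝ) ≤ 2 ^ s := one_le_pow₀ (by norm_num)
  linarith

/-- If the left parts `[F^[i] α, F^[i] z]` have total length at most one, then so does, up to a
factor two, any extension to the right which is short at the final time. -/
theorem extension_le {C : ℝ} (hC0 : 0 ≤ C)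
    (hC : ∀ u v, |Real.log (deriv F u) - Real.log (deriv F v)| ≤ C * |u - v|)
    (k : ℕ) : ∀ {α z β : ℝ}, α < z → z < β →
    ∑ i ∈ Finset.range k, (F^[i] z - F^[i] α) ≤ 1 → F^[k] β ≤ F^[k] α + 1 →
    F^[k] β - F^[k] z ≤ Real.exp (-(3 * C)) * (F^[k] z - F^[k] α) →
    ∀ i ≤ k, F^[i] β - F^[i] z ≤ F^[i] z - F^[i] α := by
  induction k with
  | zero =>
    intro α z β h1 h2 _ _ h i hi
    obtain rfl := Nat.le_zero.1 hi
    refine h.trans ?_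
    simp only [Function.iterate_zero, id]
    have : Real.exp (-(3 * C)) ≤ 1 := Real.exp_le_one_iff.2 (by linarith)
    nlinarith
  | succ k ih =>
    intro α z β h1 h2 hs hβ h i hi
    rw [Finset.sum_range_succ'] at hs
    have hs' : ∑ i ∈ Finset.range k, (F^[i] (F z) - F^[i] (F α)) ≤ 1 := by
      simp only [Function.iterate_succ_apply, Function.iterate_zero, id] at hs
      linarith
    have ih' := ih (hF.mono h1) (hF.mono h2) hs' hβ h
    obtain _ | i := i
    swap
    · exact ih' i (by omega)
    have hsum : ∑ i ∈ Finset.range (k + 1), (F^[i] β - F^[i] α) ≤ 3 := by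
      rw [Finset.sum_range_succ']
      have e1 : ∑ i ∈ Finset.range k, (F^[i + 1] β - F^[i + 1] α) ≤
          ∑ i ∈ Finset.range k, 2 * (F^[i] (F z) - F^[i] (F α)) := by
        refine Finset.sum_le_sum fun i hi => ?_
        have := ih' i (by have := Finset.mem_range.1 hi; omega)
        simp only [Function.iterate_succ_apply]
        linarith
      rw [← Finset.mul_sum] at e1
      have e2 := hF.iter_le_add_one (Nat.zero_le _) hβ
      simp only [Function.iterate_zero, id] at e2 ⊢
      linarith
    obtain ⟨ξ, hξ, e1⟩ := hF.exists_deriv_iter_eq (k + 1) h1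
    obtain ⟨η, hη, e2⟩ := hF.exists_deriv_iter_eq (k + 1) h2
    have hd := hF.distortion hC hC0 (k + 1) (α := α) (β := β) (u := ξ) (v := η)
      ⟨hξ.1.le, by linarith [hξ.2]⟩ ⟨by linarith [hη.1], hη.2.le⟩
    have hd' : Real.log (deriv F^[k + 1] ξ) ≤ Real.log (deriv F^[k + 1] η) + 3 * C := by nlinarith
    have pξ := hF.deriv_iter_pos (k + 1) ξ
    have pη := hF.deriv_iter_pos (k + 1) η
    have hd2 : deriv F^[k + 1] ξ ≤ deriv F^[k + 1] η * Real.exp (3 * C) := by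
      have := Real.exp_le_exp.2 hd'
      rwa [Real.exp_add, Real.exp_log pξ, Real.exp_log pη] at this
    simp only [Function.iterate_zero, id]
    rw [e1, e2, Real.exp_neg] at h
    have pe := Real.exp_pos (3 * C)
    have h3 : deriv F^[k + 1] η * (β - z) * Real.exp (3 * C) ≤ deriv F^[k + 1] ξ * (z - α) := by
      have := mul_le_mul_of_nonneg_right h pe.le
      rwa [mul_comm (Real.exp (3 * C))⁻¹, inv_mul_cancel_right₀ pe.ne'] at this
    have h4 := mul_le_mul_of_nonneg_right hd2 (sub_pos.2 h1).le
    have h5 : (deriv F^[k + 1] η * Real.exp (3 * C)) * (β - z) ≤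
      (deriv F^[k + 1] η * Real.exp (3 * C)) * (z - α) := by linarith
    exact le_of_mul_le_mul_left h5 (by positivity)

end ExpandingLift

/-- Intervals of the line which embed disjointly into the circle have total length at most one. -/
theorem sum_sub_le_one_of_disjoint_mod_int {n : ℕ} {a b : ℕ → ℝ} (hab : ∀ i < n, a i ≤ b i)
    (hb : ∀ i < n, b i ≤ ⌊a i⌋ + 1)
    (hd : ∀ i j, i < j → j < n → ∀ u ∈ Ico (a i) (b i), ∀ v ∈ Ico (a j) (b j), ∀ l : ℤ,
      u ≠ v + l) :
    ∑ i ∈ Finset.range n, (b i - a i) ≤ 1 := by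
  set S : ℕ → Set ℝ := fun i => Ico (a i - ⌊a i⌋) (b i - ⌊a i⌋) with hS
  have hdis : (↑(Finset.range n) : Set ℕ).PairwiseDisjoint S := by
    have key : ∀ i j, i < j → j < n → Disjoint (S i) (S j) := by
      intro i j hij hj
      rw [Set.disjoint_left]
      intro t hti htj
      refine hd i j hij hj (t + ⌊a i⌋) ⟨?_, ?_⟩ (t + ⌊a j⌋) ⟨?_, ?_⟩ (⌊a i⌋ - ⌊a j⌋) ?_
      · linarith [hti.1]
      · linarith [hti.2]
      · linarith [htj.1]
      · linarith [htj.2]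
      · push_cast; ring
    intro i hi j hj hij
    have hi' := Finset.mem_range.1 (Finset.mem_coe.1 hi)
    have hj' := Finset.mem_range.1 (Finset.mem_coe.1 hj)
    rcases lt_or_gt_of_ne hij with h | h
    · exact key i j h hj'
    · exact (key j i h hi').symm
  have h1 := measure_biUnion_finset (μ := volume) hdis (fun i _ => measurableSet_Ico)
  have hsub : (⋃ i ∈ Finset.range n, S i) ⊆ Ico (0 : ℝ) 1 := by
    intro t ht
    simp only [mem_iUnion, Finset.mem_range] at ht
    obtain ⟨i, hi, ht⟩ := ht
    have := hb i hi
    have := Int.floor_le (a i)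
    constructor <;> linarith [ht.1, ht.2]
  have h2 := measure_mono (μ := volume) hsub
  have h3 : ∑ i ∈ Finset.range n, volume (S i) =
      ENNReal.ofReal (∑ i ∈ Finset.range n, (b i - a i)) := by
    rw [ENNReal.ofReal_sum_of_nonneg fun i hi => sub_nonneg.2 (hab i (Finset.mem_range.1 hi))]
    refine Finset.sum_congr rfl fun i _ => ?_
    rw [Real.volume_Ico]; congr 1; ring
  rw [h1, h3, Real.volume_Ico, sub_zero] at h2
  exact (ENNReal.ofReal_le_ofReal_iff zero_le_one).1 h2

namespace ExpandingLift

variable {F : ℝ → ℝ} (hF : ExpandingLift F)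
include hF

theorem le_floor_add_one {n : ℕ} {a b : ℝ} {κ : ℤ} (ha : (κ : ℝ) ≤ F^[n] a)
    (hb : F^[n] b ≤ κ + 1) : b ≤ ⌊a⌋ + 1 := by
  by_contra! h
  have h1 := (hF.iter_mono n h).trans_le hb
  have h2 := ha.trans_lt (hF.iter_mono n (Int.lt_floor_add_one a))
  have e := hF.iter_int n (⌊a⌋ + 1)
  push_cast at e
  rw [e] at h1 h2
  have h1' : 2 ^ n * (⌊a⌋ + 1) < κ + 1 := by exact_mod_cast h1
  have h2' : κ < 2 ^ n * (⌊a⌋ + 1) := by exact_mod_cast h2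
  omega

theorem floor_eq_of_floor_iter_eq {m s : ℕ} {u v : ℝ} (h : ⌊F^[m + s] u⌋ = ⌊F^[m + s] v⌋) :
    ⌊F^[m] u⌋ = ⌊F^[m] v⌋ := by
  rw [hF.floor_iter_add m s, hF.floor_iter_add m s v, h]

/-- If the orbit of `y` visits the dyadic interval of degree `m` containing `F^[n] y` at time `n`
but not at times strictly between `0` and `n`, then the iterates up to time `n` of the dyadic
interval of degree `n + m` containing `y` have total length at most one. -/
theorem sum_iter_le_one_of_first_entry {n m : ℕ} {a b y : ℝ} {κ : ℤ} (ha : F^[n + m] a = κ)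
    (hb : F^[n + m] b = κ + 1) (hy : ⌊F^[n + m] y⌋ = κ)
    (hfirst : ∀ i, 0 < i → i < n → ¬ ⌊F^[m] (F^[i] y)⌋ ≡ ⌊F^[m] (F^[n] y)⌋ [ZMOD 2 ^ m]) :
    ∑ i ∈ Finset.range n, (F^[i] b - F^[i] a) ≤ 1 := by
  have hab : a < b := (hF.iter_mono (n + m)).lt_iff_lt.1 (by rw [ha, hb]; linarith)
  refine sum_sub_le_one_of_disjoint_mod_int
    (fun i _ => (hF.iter_mono i hab).le) (fun i hi => ?_) ?_
  · refine hF.le_floor_add_one (n := n + m - i) (κ := κ) ?_ ?_ <;>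
      rw [← Function.iterate_add_apply, Nat.sub_add_cancel (by omega)]
    · exact ha.ge
    · exact hb.le
  intro i j hij hj u hu v hv l huv
  obtain ⟨s, rfl⟩ := Nat.exists_eq_add_of_le hij.le
  obtain ⟨p, rfl⟩ := Nat.exists_eq_add_of_le hj.le
  have hfl : ∀ {q r : ℕ} {w : ℝ}, r + q = i + s + p + m → w ∈ Ico (F^[q] a) (F^[q] b) →
      ⌊F^[r] w⌋ = κ := by
    intro q r w hr hw
    have h1 := (hF.iter_mono r).monotone hw.1
    have h2 := hF.iter_mono r hw.2
    rw [← Function.iterate_add_apply, hr] at h1 h2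
    rw [Int.floor_eq_iff, ← ha]
    refine ⟨h1, ?_⟩
    rw [ha, ← hb]; exact h2
  have hv' : ⌊F^[m + p] v⌋ = κ := hfl (by omega) hv
  have hu' : ⌊F^[m + p + s] u⌋ = κ := hfl (by omega) hu
  have e1 : ⌊F^[m + p] u⌋ = κ + 2 ^ (m + p) * l := by
    rw [huv, hF.floor_iter_add_int, hv']
  have hy' : ⌊F^[m + p + s] (F^[i] y)⌋ = κ := by
    rw [← Function.iterate_add_apply, show m + p + s + i = i + s + p + m by omega, hy]
  have e2 := hF.floor_eq_of_floor_iter_eq (hu'.trans hy'.symm)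
  refine hfirst (p + i) (by omega) (by omega) ?_
  rw [← Function.iterate_add_apply, ← Function.iterate_add_apply, ← add_assoc,
    Function.iterate_add_apply F (m + p) i, ← e2, e1, show m + (i + s + p) = i + s + p + m by omega,
    hy, pow_add]
  exact Int.modEq_iff_dvd.2 ⟨-(2 ^ p * l), by ring⟩

/-- If the derivatives of the iterates are bounded by one along the orbit of `x`, then the dyadic
intervals visited by the orbit become small as soon as their iterates have bounded total length. -/
theorem iter_sub_lt_of_sum_le {x : ℝ} (hx : ∀ n, deriv F^[n] x ≤ 1) {B ℓ : ℝ}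
    (hℓ : 0 < ℓ) : ∃ k₀, ∀ k ≥ k₀, ∀ (d t : ℕ) (a b : ℝ) (κ : ℤ), F^[k + d] a = κ →
      F^[k + d] b = κ + 1 → F^[t] x ∈ Ico a b →
      ∑ i ∈ Finset.range k, (F^[i] b - F^[i] a) ≤ B → F^[k] b - F^[k] a < ℓ := by
  obtain ⟨C, hC0, hC⟩ := hF.exists_lipschitz
  obtain ⟨k₀, hk₀⟩ := hF.mesh (ℓ * Real.exp (-(C * (1 + B))) / 2) (by positivity)
  refine ⟨k₀, fun k hk d t a b κ ha hb hx' hs => ?_⟩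
  have hex : ∃ t', ⌊F^[k + d] (F^[t'] x)⌋ ≡ ⌊F^[k + d] (F^[t] x)⌋ [ZMOD 2 ^ (k + d)] :=
    ⟨t, rfl⟩
  classical
  set t' := Nat.find hex
  have hmin : ∀ i, 0 < i → i < t' →
      ¬ ⌊F^[k + d] (F^[i] x)⌋ ≡ ⌊F^[k + d] (F^[t'] x)⌋ [ZMOD 2 ^ (k + d)] :=
    fun i _ hi h => Nat.find_min hex hi (h.trans (Nat.find_spec hex))
  have hκ : ⌊F^[k + d] (F^[t] x)⌋ = κ := by
    rw [Int.floor_eq_iff, ← ha]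
    exact ⟨(hF.iter_mono _).monotone hx'.1, by rw [ha, ← hb]; exact hF.iter_mono _ hx'.2⟩
  obtain ⟨l, hl⟩ := (Nat.find_spec hex).symm.dvd
  have hl' : ⌊F^[k + d] (F^[t'] x)⌋ = κ + 2 ^ (k + d) * l := by linarith
  rw [← Function.iterate_add_apply, show k + d + t' = t' + (k + d) by omega] at hl'
  obtain ⟨a', ha'⟩ := hF.iter_surjective (t' + (k + d)) ((κ + 2 ^ (k + d) * l : ℤ) : ℝ)
  obtain ⟨b', hb'⟩ := hF.iter_surjective (t' + (k + d)) ((κ + 2 ^ (k + d) * l : ℤ) + 1 : ℝ)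
  have hsum := hF.sum_iter_le_one_of_first_entry ha' hb' hl' hmin
  have ea : F^[t'] a' = a + l := by
    apply (hF.iter_mono (k + d)).injective
    rw [hF.iter_add_int, ha, ← Function.iterate_add_apply, add_comm (k + d), ha']
    push_cast; ring
  have eb : F^[t'] b' = b + l := by
    apply (hF.iter_mono (k + d)).injective
    rw [hF.iter_add_int, hb, ← Function.iterate_add_apply, add_comm (k + d), hb']
    push_cast; ring
  have hab : a' < b' := (hF.iter_mono (t' + (k + d))).lt_iff_lt.1 (by rw [ha', hb']; linarith)
  have hxm : x ∈ Icc a' b' := by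
    rw [Int.floor_eq_iff] at hl'
    constructor
    · exact (hF.iter_mono (t' + (k + d))).le_iff_le.1 (by rw [ha']; exact hl'.1)
    · exact (hF.iter_mono (t' + (k + d))).le_iff_le.1 (by rw [hb']; exact hl'.2.le)
  have hsum2 : ∑ i ∈ Finset.range (t' + k), (F^[i] b' - F^[i] a') ≤ 1 + B := by
    rw [Finset.sum_range_add]
    refine add_le_add hsum (le_trans (le_of_eq ?_) hs)
    refine Finset.sum_congr rfl fun i _ => ?_
    rw [add_comm t' i, Function.iterate_add_apply, Function.iterate_add_apply, ea, eb,
      hF.iter_add_int, hF.iter_add_int]; ring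
  obtain ⟨ξ, hξ, e⟩ := hF.exists_deriv_iter_eq (t' + k) hab
  have hd := hF.distortion hC hC0 (t' + k) ⟨hξ.1.le, hξ.2.le⟩ hxm
  have hlog : Real.log (deriv F^[t' + k] x) ≤ 0 :=
    Real.log_nonpos (hF.deriv_iter_pos _ _).le (hx _)
  have hdξ : deriv F^[t' + k] ξ ≤ Real.exp (C * (1 + B)) := by
    rw [← Real.log_le_iff_le_exp (hF.deriv_iter_pos _ _)]
    have := mul_le_mul_of_nonneg_left hsum2 hC0
    linarith
  have hmesh := hk₀ (t' + (k + d)) (by omega) a' b' (by rw [ha', hb'])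
  have e' : F^[k] b - F^[k] a = F^[t' + k] b' - F^[t' + k] a' := by
    rw [add_comm t' k, Function.iterate_add_apply, Function.iterate_add_apply, ea, eb,
      hF.iter_add_int, hF.iter_add_int]; ring
  rw [e', e]
  calc deriv F^[t' + k] ξ * (b' - a') ≤
      Real.exp (C * (1 + B)) * (ℓ * Real.exp (-(C * (1 + B))) / 2) :=
        mul_le_mul hdξ hmesh (sub_pos.2 hab).le (Real.exp_pos _).le
    _ = ℓ / 2 := by rw [Real.exp_neg]; field_simp
    _ < ℓ := by linarith

theorem eq_of_abs_iter_sub_le_one {u v : ℝ} (h : ∀ n, |F^[n] u - F^[n] v| ≤ 1) : u = v := by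
  refine eq_of_forall_dist_le fun ε hε => ?_
  obtain ⟨N, hN⟩ := hF.mesh ε hε
  have := abs_le.1 (h N)
  rw [Real.dist_eq, abs_le]
  have h1 := hN N le_rfl v u (by linarith)
  have h2 := hN N le_rfl u v (by linarith)
  constructor <;> linarith

theorem exists_eq_add_int_of_digits_eq {u v : ℝ}
    (h : ∀ i, ⌊F^[i + 1] u⌋ % 2 = ⌊F^[i + 1] v⌋ % 2) : ∃ l : ℤ, v = u + l := by
  refine ⟨⌊v⌋ - ⌊u⌋, hF.eq_of_abs_iter_sub_le_one fun n => ?_⟩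
  have hw : ⌊F^[n] v⌋ - ⌊F^[n] u⌋ = 2 ^ n * (⌊v⌋ - ⌊u⌋) := by
    induction n with
    | zero => simp
    | succ n ih =>
      have e1 := hF.floor_iter_add n 1 u
      have e2 := hF.floor_iter_add n 1 v
      have e3 := h n
      rw [pow_one] at e1 e2
      have : ⌊F^[n + 1] v⌋ - ⌊F^[n + 1] u⌋ = 2 * (⌊F^[n] v⌋ - ⌊F^[n] u⌋) := by omega
      rw [this, ih, pow_succ]; ring
  rw [hF.iter_add_int]
  have hw' : (⌊F^[n] v⌋ : ℝ) - ⌊F^[n] u⌋ = 2 ^ n * ((⌊v⌋ - ⌊u⌋ : ℤ) : ℝ) := by exact_mod_cast hw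
  rw [← hw', abs_le]
  have := Int.floor_le (F^[n] v)
  have := Int.floor_le (F^[n] u)
  have := Int.lt_floor_add_one (F^[n] v)
  have := Int.lt_floor_add_one (F^[n] u)
  constructor <;> linarith

/-- For a point which is not preperiodic modulo `ℤ` and along whose orbit the derivatives are at
most one, the binary digits cannot have period `s` on arbitrarily long time intervals. -/
theorem exists_digit_ne {x : ℝ} (hx : ∀ n, deriv F^[n] x ≤ 1)
    (hnp : ∀ i s, 1 ≤ s → ∀ l : ℤ, F^[i + s] x ≠ F^[i] x + l) {s : ℕ} (hs : 1 ≤ s) :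
    ∃ n₀, ∀ t, ∃ i < n₀, ⌊F^[i + 1] (F^[t] x)⌋ % 2 ≠ ⌊F^[i + s + 1] (F^[t] x)⌋ % 2 := by
  obtain ⟨M, hM0, hM⟩ := hF.exists_iter_sub_le (s + 1)
  obtain ⟨n₀, hn₀⟩ := hF.iter_sub_lt_of_sum_le hx (B := 1) (ℓ := 1 / M) (by positivity)
  refine ⟨n₀, fun t => ?_⟩
  by_contra! hrun
  obtain ⟨y, hy⟩ : ∃ y, F^[t] x = y := ⟨_, rfl⟩
  rw [hy] at hrun
  have hex : ∃ i, ⌊F^[i + 1] y⌋ % 2 ≠ ⌊F^[i + s + 1] y⌋ % 2 := by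
    by_contra! hall
    obtain ⟨l, hl⟩ := hF.exists_eq_add_int_of_digits_eq (u := y) (v := F^[s] y) fun i => by
      rw [hall i, ← Function.iterate_add_apply, add_right_comm]
    refine hnp t s hs l ?_
    rw [add_comm, Function.iterate_add_apply, hy, hl]
  obtain ⟨n, hne, hmin⟩ : ∃ n, ⌊F^[n + 1] y⌋ % 2 ≠ ⌊F^[n + s + 1] y⌋ % 2 ∧
      ∀ i < n, ⌊F^[i + 1] y⌋ % 2 = ⌊F^[i + s + 1] y⌋ % 2 := by
    classical
    exact ⟨Nat.find hex, Nat.find_spec hex, fun i hi => not_not.1 (Nat.find_min hex hi)⟩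
  have hn : n₀ ≤ n := by
    by_contra! hlt
    exact hne (hrun n hlt)
  have hdig : ∀ w w' : ℝ, ⌊F^[s + 1] w⌋ ≡ ⌊F^[s + 1] w'⌋ [ZMOD 2 ^ (s + 1)] →
      ⌊F^[1] w⌋ % 2 = ⌊F^[s + 1] w⌋ % 2 → ⌊F^[1] w'⌋ % 2 = ⌊F^[s + 1] w'⌋ % 2 := by
    intro w w' hww h
    obtain ⟨c, hc⟩ := hww.dvd
    have e1 := hF.floor_iter_add 1 s w
    have e2 := hF.floor_iter_add 1 s w'
    rw [add_comm 1 s] at e1 e2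
    have e3 : ⌊F^[s + 1] w'⌋ = ⌊F^[s + 1] w⌋ + 2 ^ s * (2 * c) := by
      rw [pow_succ] at hc; linarith
    have e4 : ⌊F^[1] w'⌋ = ⌊F^[1] w⌋ + 2 * c := by
      rw [e1, e2, e3, Int.add_mul_ediv_left _ _ (by positivity)]
    obtain ⟨s', rfl⟩ := Nat.exists_eq_add_of_le' hs
    have e5 : ⌊F^[s' + 1 + 1] w'⌋ = ⌊F^[s' + 1 + 1] w⌋ + 2 * (2 ^ (s' + 1) * c) := by
      rw [e3]; ring
    omega
  set κ := ⌊F^[n + (s + 1)] y⌋ with hκ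
  obtain ⟨a, ha⟩ := hF.iter_surjective (n + (s + 1)) (κ : ℝ)
  obtain ⟨b, hb⟩ := hF.iter_surjective (n + (s + 1)) (κ + 1 : ℝ)
  have hsum := hF.sum_iter_le_one_of_first_entry ha hb hκ.symm fun i _ hi hcon => by
    refine hne ?_
    have := hdig _ _ hcon (by
      rw [← Function.iterate_add_apply, ← Function.iterate_add_apply, add_comm 1 i, hmin i hi,
        show s + 1 + i = i + s + 1 by omega])
    rw [← Function.iterate_add_apply, ← Function.iterate_add_apply, add_comm 1] at this
    rw [this, show s + 1 + n = n + s + 1 by omega]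
  have hlt := hn₀ n hn (s + 1) t a b κ ha hb (by
    rw [hy]
    constructor
    · exact (hF.iter_mono (n + (s + 1))).le_iff_le.1 (by rw [ha]; exact Int.floor_le _)
    · exact (hF.iter_mono (n + (s + 1))).lt_iff_lt.1
        (by rw [hb]; exact Int.lt_floor_add_one _)) hsum
  have h1 := hM (F^[n] a) (F^[n] b) ((hF.iter_mono n).monotone
    ((hF.iter_mono (n + (s + 1))).le_iff_le.1 (by rw [ha, hb]; linarith)))
  rw [← Function.iterate_add_apply, ← Function.iterate_add_apply, add_comm _ n, ha, hb] at h1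
  have h2 := mul_lt_mul_of_pos_left hlt hM0
  rw [mul_one_div_cancel hM0.ne'] at h2
  linarith

end ExpandingLift

section ClusterPoints

variable {X : Type*} [TopologicalSpace X] {f : X → X} {x₀ z : X}

theorem MapClusterPt.iterate_map (hf : Continuous f)
    (hz : MapClusterPt z atTop fun n => f^[n] x₀) (k : ℕ) :
    MapClusterPt (f^[k] z) atTop fun n => f^[n] x₀ := by
  have h1 := hz.continuousAt_comp (hf.iterate k).continuousAt
  have h2 : (f^[k] ∘ fun n => f^[n] x₀) = (fun n => f^[n] x₀) ∘ fun n => n + k := by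
    funext n
    simp only [Function.comp, add_comm n k, Function.iterate_add_apply]
  rw [h2] at h1
  exact h1.of_comp (tendsto_add_atTop_nat k)

theorem MapClusterPt.exists_iterate_eq [CompactSpace X] [T2Space X] (hf : Continuous f)
    (hz : MapClusterPt z atTop fun n => f^[n] x₀) (k : ℕ) :
    ∃ z', MapClusterPt z' atTop (fun n => f^[n] x₀) ∧ f^[k] z' = z := by
  obtain ⟨U, hU, hlim⟩ := mapClusterPt_iff_ultrafilter.1 hz
  obtain ⟨z', hv⟩ : ∃ z', Tendsto (fun n => f^[n - k] x₀) U (𝓝 z') :=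
    ⟨_, (U.map fun n => f^[n - k] x₀).le_nhds_lim⟩
  refine ⟨z', ?_, ?_⟩
  · have h1 := mapClusterPt_iff_ultrafilter.2 ⟨U, hU, hv⟩
    exact h1.of_comp (u := fun n => f^[n] x₀) (φ := fun n => n - k) (tendsto_sub_atTop_nat k)
  · have h1 := ((hf.iterate k).tendsto _).comp hv
    refine tendsto_nhds_unique (h1.congr' ?_) hlim
    filter_upwards [hU (eventually_ge_atTop k)] with n hn
    simp only [Function.comp, ← Function.iterate_add_apply, Nat.add_sub_cancel' hn]

end ClusterPoints

theorem UnitAddCircle.coe_eq_coe_iff {a b : ℝ} :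
    (a : UnitAddCircle) = b ↔ ∃ l : ℤ, a = b + l := by
  rw [← sub_eq_zero, ← AddCircle.coe_sub, AddCircle.coe_eq_zero_iff]
  simp only [zsmul_eq_mul, mul_one]
  exact exists_congr fun l => ⟨fun h => by linarith, fun h => by linarith⟩

namespace ExpandingLift

variable {F : ℝ → ℝ} (hF : ExpandingLift F) {φ : UnitAddCircle → UnitAddCircle}
  (hφ : ∀ y : ℝ, φ y = (F y : UnitAddCircle)) {x : ℝ}

include hφ in
theorem coe_iter (n : ℕ) (y : ℝ) : φ^[n] (y : UnitAddCircle) = (F^[n] y : UnitAddCircle) := by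
  induction n with
  | zero => rfl
  | succ n ih => rw [Function.iterate_succ_apply', ih, hφ, Function.iterate_succ_apply']

include hF hφ in
theorem continuous_map : Continuous φ := by
  refine (isQuotientMap_quotient_mk').continuous_iff.2 ?_
  exact ((AddCircle.continuous_mk' 1).comp hF.cont).congr fun y => (hφ y).symm

/-- The point `y` represents a limit point of the `φ`-orbit of `x`. -/
def OrbitLimit (φ : UnitAddCircle → UnitAddCircle) (x y : ℝ) : Prop :=
  MapClusterPt (y : UnitAddCircle) atTop fun n => φ^[n] (x : UnitAddCircle)

theorem OrbitLimit.add_int {y : ℝ} (h : OrbitLimit φ x y) (l : ℤ) : OrbitLimit φ x (y + l) := by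
  have : ((y + l : ℝ) : UnitAddCircle) = y := UnitAddCircle.coe_eq_coe_iff.2 ⟨l, rfl⟩
  rwa [OrbitLimit, this]

include hF hφ

theorem OrbitLimit.iter {y : ℝ} (h : OrbitLimit φ x y) (n : ℕ) : OrbitLimit φ x (F^[n] y) := by
  rw [OrbitLimit, ← coe_iter hφ]
  exact h.iterate_map (hF.continuous_map hφ) n

theorem OrbitLimit.exists_iter_eq {y : ℝ} (h : OrbitLimit φ x y) (n : ℕ) :
    ∃ z, OrbitLimit φ x z ∧ ∃ l : ℤ, F^[n] z = y + l := by
  obtain ⟨z', hz', e⟩ := MapClusterPt.exists_iterate_eq (hF.continuous_map hφ) h n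
  obtain ⟨z, rfl⟩ := QuotientAddGroup.mk_surjective z'
  exact ⟨z, hz', UnitAddCircle.coe_eq_coe_iff.1 ((coe_iter hφ n z).symm.trans e)⟩

omit hF in
theorem OrbitLimit.exists_iter_mem {y : ℝ} (h : OrbitLimit φ x y) {W : Set ℝ} (hW : W ∈ 𝓝 y) :
    ∃ n, ∃ l : ℤ, F^[n] x + l ∈ W := by
  have hW' : ((↑) : ℝ → UnitAddCircle) '' W ∈ 𝓝 (y : UnitAddCircle) :=
    QuotientAddGroup.isOpenMap_coe.image_mem_nhds hW
  obtain ⟨n, w, hw, e⟩ := (h.frequently hW').exists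
  rw [coe_iter hφ, UnitAddCircle.coe_eq_coe_iff] at e
  obtain ⟨l, rfl⟩ := e
  exact ⟨n, l, hw⟩

theorem OrbitLimit.not_periodic (hx : ∀ n, deriv F^[n] x ≤ 1)
    (hnp : ∀ i s, 1 ≤ s → ∀ l : ℤ, F^[i + s] x ≠ F^[i] x + l) {y : ℝ} (h : OrbitLimit φ x y)
    {s : ℕ} (hs : 1 ≤ s) (l : ℤ) : F^[s] y ≠ y + l := by
  intro hper
  obtain ⟨n₀, hn₀⟩ := hF.exists_digit_ne hx hnp hs
  have hshift : ∀ i, F^[i + s + 1] y = F^[i + 1] y + ((2 ^ (i + 1) * l : ℤ) : ℝ) := by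
    intro i
    rw [show i + s + 1 = i + 1 + s by omega, Function.iterate_add_apply, hper, hF.iter_add_int]
    push_cast; ring
  have hright : ∀ᶠ w in 𝓝[≥] y, ∀ j < n₀ + s + 1, ⌊F^[j] w⌋ = ⌊F^[j] y⌋ := by
    simp only [← Finset.mem_range]
    refine (eventually_all_finset _).2 fun j _ => ?_
    exact tendsto_pure.1 ((tendsto_floor_right_pure_floor _).comp
      (tendsto_nhdsWithin_of_tendsto_nhds_of_eventually_within _
        ((hF.iter_cont j).continuousAt.mono_left nhdsWithin_le_nhds)
        (eventually_nhdsWithin_of_forall fun w hw => (hF.iter_mono j).monotone hw)))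
  have hleft : ∀ᶠ w in 𝓝[<] y, ∀ j < n₀ + s + 1, ⌊F^[j] w⌋ = ⌈F^[j] y⌉ - 1 := by
    simp only [← Finset.mem_range]
    refine (eventually_all_finset _).2 fun j _ => ?_
    exact tendsto_pure.1 ((tendsto_floor_left_pure_ceil_sub_one _).comp
      (tendsto_nhdsWithin_of_tendsto_nhds_of_eventually_within _
        ((hF.iter_cont j).continuousAt.mono_left nhdsWithin_le_nhds)
        (eventually_nhdsWithin_of_forall fun w hw => hF.iter_mono j hw)))
  have key : ∀ᶠ w in 𝓝 y, ∀ i < n₀, ⌊F^[i + 1] w⌋ % 2 = ⌊F^[i + s + 1] w⌋ % 2 := by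
    rw [← nhdsLT_sup_nhdsGE, eventually_sup]
    constructor
    · filter_upwards [hleft] with w hw i hi
      rw [hw _ (by omega), hw _ (by omega), hshift, Int.ceil_add_intCast, pow_succ]
      have : (2 ^ i * 2 * l : ℤ) = 2 * (2 ^ i * l) := by ring
      omega
    · filter_upwards [hright] with w hw i hi
      rw [hw _ (by omega), hw _ (by omega), hshift, Int.floor_add_intCast, pow_succ]
      have : (2 ^ i * 2 * l : ℤ) = 2 * (2 ^ i * l) := by ring
      omega
  obtain ⟨t, c, hc⟩ := h.exists_iter_mem hφ key
  obtain ⟨i, hi, hne⟩ := hn₀ t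
  have := hc i hi
  rw [hF.floor_iter_add_int, hF.floor_iter_add_int, pow_succ, pow_succ] at this
  have e1 : (2 ^ i * 2 * c : ℤ) = 2 * (2 ^ i * c) := by ring
  have e2 : (2 ^ (i + s) * 2 * c : ℤ) = 2 * (2 ^ (i + s) * c) := by ring
  omega

/-- A point along whose orbit the derivatives are at most one is preperiodic on the circle. -/
theorem exists_preperiodic (hx : ∀ n, deriv F^[n] x ≤ 1) :
    ∃ i s, 1 ≤ s ∧ ∃ l : ℤ, F^[i + s] x = F^[i] x + l := by
  by_contra! hnp
  have hper : ∀ {y : ℝ}, OrbitLimit φ x y → ∀ {s : ℕ}, 1 ≤ s → ∀ l : ℤ, F^[s] y ≠ y + l :=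
    fun h _ hs l => h.not_periodic hF hφ hx hnp hs l
  have hni : ∀ {y : ℝ}, OrbitLimit φ x y → ∀ (n : ℕ) (l : ℤ), F^[n] y ≠ l := by
    intro y h n l e
    have h1 := h.iter hF hφ n
    rw [e] at h1
    refine hper h1 le_rfl l ?_
    rw [hF.iter_int]; ring
  obtain ⟨e, ⟨heI, heL⟩, hmin⟩ : ∃ e, IsLeast {y | y ∈ Icc (0 : ℝ) 1 ∧ OrbitLimit φ x y} e := by
    refine IsCompact.exists_isLeast ?_ ?_
    · exact isCompact_Icc.inter_right (isClosed_setOfPred_clusterPt.preimage (AddCircle.continuous_mk' 1))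
    · obtain ⟨z, hz⟩ := exists_clusterPt_of_compactSpace
        (map (fun n => φ^[n] (x : UnitAddCircle)) atTop)
      obtain ⟨y, rfl⟩ := QuotientAddGroup.mk_surjective z
      refine ⟨Int.fract y, ⟨Int.fract_nonneg y, (Int.fract_lt_one y).le⟩, ?_⟩
      have : OrbitLimit φ x y := hz
      simpa [sub_eq_add_neg, Int.fract] using this.add_int (-⌊y⌋)
  have hfloor : ∀ {y : ℝ}, OrbitLimit φ x y → ∀ c : ℤ, (c : ℝ) ≤ y → c + e ≤ y := by
    intro y h c hc
    have h1 : OrbitLimit φ x (Int.fract y) := by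
      simpa [sub_eq_add_neg, Int.fract] using h.add_int (-⌊y⌋)
    have h2 := hmin ⟨⟨Int.fract_nonneg y, (Int.fract_lt_one y).le⟩, h1⟩
    have h3 : (c : ℝ) ≤ ⌊y⌋ := by exact_mod_cast Int.le_floor.2 hc
    have := Int.floor_add_fract y
    linarith
  have he0 : 0 < e := heI.1.lt_of_ne fun h => hni heL 0 0 (by simp [← h])
  have he1 : e < 1 := heI.2.lt_of_ne fun h => hni heL 0 1 (by simp [h])
  obtain ⟨C, hC0, hC⟩ := hF.exists_lipschitz
  obtain ⟨d, hd⟩ := hF.mesh (Real.exp (-(3 * C)) * e) (by positivity)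
  obtain ⟨M, hM0, hM⟩ := hF.exists_iter_sub_le d
  obtain ⟨k, hk⟩ := hF.iter_sub_lt_of_sum_le hx (B := 2) (ℓ := 1 / M) (by positivity)
  obtain ⟨z, hz, l₀, hzk⟩ := heL.exists_iter_eq hF hφ k
  obtain ⟨α, hα⟩ := hF.iter_surjective k l₀
  obtain ⟨a, ha⟩ := hF.iter_surjective (d + k) (⌊F^[d + k] z⌋ : ℝ)
  obtain ⟨b, hb⟩ := hF.iter_surjective (d + k) (⌊F^[d + k] z⌋ + 1 : ℝ)
  have hmn := fun n => (hF.iter_mono n).monotone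
  have haz : a < z := (hF.iter_mono (d + k)).lt_iff_lt.1 (by
    rw [ha]; exact (Int.floor_le _).lt_of_ne fun h => hni hz _ _ h.symm)
  have hzb : z < b := (hF.iter_mono (d + k)).lt_iff_lt.1 (by
    rw [hb]; exact Int.lt_floor_add_one _)
  have hαz : α < z := (hF.iter_mono k).lt_iff_lt.1 (by rw [hα, hzk]; linarith)
  have hαa : α ≤ a := (hF.iter_mono (d + k)).le_iff_le.1 (by
    have h1 := hmn (d + k) hαz.le
    have h2 := hF.iter_int d l₀
    rw [ha]
    rw [Function.iterate_add_apply F d k α, hα, h2] at h1 ⊢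
    have : 2 ^ d * l₀ ≤ ⌊F^[d + k] z⌋ := Int.le_floor.2 (by push_cast; exact h1)
    exact_mod_cast this)
  have hbk : F^[k] b ≤ l₀ + 1 := (hF.iter_mono d).le_iff_le.1 (by
    rw [← Function.iterate_add_apply, hb]
    have h1 := hF.iter_mono d (show F^[k] z < ((l₀ + 1 : ℤ) : ℝ) by rw [hzk]; push_cast; linarith)
    rw [← Function.iterate_add_apply] at h1
    have h2 := hF.iter_int d (l₀ + 1)
    have h3 : ⌊F^[d + k] z⌋ < 2 ^ d * (l₀ + 1) := Int.floor_lt.2 (by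
      rw [h2] at h1; push_cast at h1 ⊢; exact h1)
    have h4 : ((⌊F^[d + k] z⌋ + 1 : ℤ) : ℝ) ≤ ((2 ^ d * (l₀ + 1) : ℤ) : ℝ) := by
      exact_mod_cast h3
    push_cast at h2 h4
    rwa [h2])
  have hsum : ∑ i ∈ Finset.range k, (F^[i] z - F^[i] α) ≤ 1 := by
    refine sum_sub_le_one_of_disjoint_mod_int (fun i _ => hmn i hαz.le) (fun i hi => ?_) ?_
    · refine hF.le_floor_add_one (n := k - i) (κ := l₀) ?_ ?_ <;>
        rw [← Function.iterate_add_apply, Nat.sub_add_cancel hi.le]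
      · exact hα.ge
      · rw [hzk]; linarith
    intro i j hij hj u hu v hv l huv
    obtain ⟨s, rfl⟩ := Nat.exists_eq_add_of_le hij.le
    obtain ⟨p, rfl⟩ := Nat.exists_eq_add_of_le hj.le
    have h1 := hmn p hv.1
    rw [← Function.iterate_add_apply, add_comm p, hα] at h1
    have h2 : F^[p] u = F^[p] v + ((2 ^ p * l : ℤ) : ℝ) := by
      rw [huv, hF.iter_add_int]; push_cast; ring
    have h3 : ((l₀ + 2 ^ p * l : ℤ) : ℝ) + e ≤ F^[p] (F^[i] z) := by
      refine hfloor ((hz.iter hF hφ i).iter hF hφ p) _ ?_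
      have := hF.iter_mono p hu.2
      push_cast at h2 ⊢
      linarith
    have h4 := hmn s h3
    rw [← Function.iterate_add_apply F p, ← Function.iterate_add_apply,
      show s + (p + i) = i + s + p by omega, hzk] at h4
    have h5 : F^[p] u ≤ ((l₀ + 2 ^ p * l : ℤ) : ℝ) + e := by
      have h6 := hF.iter_mono p hv.2
      rw [← Function.iterate_add_apply, add_comm p, hzk] at h6
      push_cast at h2 ⊢
      linarith
    have h7 := hmn s h5
    have h8 := hmn s (hmn p hu.1)
    rw [← Function.iterate_add_apply F p, ← Function.iterate_add_apply,
      show s + (p + i) = i + s + p by omega, hα] at h8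
    have h9 : OrbitLimit φ x (F^[s] (((l₀ + 2 ^ p * l : ℤ) : ℝ) + e)) := by
      rw [add_comm]
      exact (heL.add_int _).iter hF hφ s
    have h10 := hfloor h9 l₀ (h8.trans h7)
    have h11 := le_antisymm h4 (by linarith)
    rw [add_comm _ e, hF.iter_add_int] at h11
    refine hper heL (show 1 ≤ s by omega) (l₀ - 2 ^ s * (l₀ + 2 ^ p * l)) ?_
    push_cast at h11 ⊢
    linarith
  have hext := hF.extension_le hC0 hC k hαz hzb hsum (by rw [hα]; exact hbk) (by
    have h1 := hd d le_rfl (F^[k] a) (F^[k] b) (by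
      rw [← Function.iterate_add_apply, ← Function.iterate_add_apply, ha, hb])
    have h2 := hmn k haz.le
    have h3 : F^[k] z - F^[k] α = e := by rw [hα, hzk]; ring
    rw [h3]
    linarith)
  have hsum2 : ∑ i ∈ Finset.range k, (F^[i] b - F^[i] a) ≤ 2 := by
    calc ∑ i ∈ Finset.range k, (F^[i] b - F^[i] a) ≤
        ∑ i ∈ Finset.range k, 2 * (F^[i] z - F^[i] α) := by
          refine Finset.sum_le_sum fun i hi => ?_
          have := hext i (Finset.mem_range.1 hi).le
          have := hmn i hαa
          linarith
      _ ≤ 2 := by rw [← Finset.mul_sum]; linarith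
  obtain ⟨t, l, ht⟩ := hz.exists_iter_mem hφ (Ioo_mem_nhds haz hzb)
  have hsub : ∀ n w, F^[n] (w + ((-l : ℤ) : ℝ)) = F^[n] w + 2 ^ n * ((-l : ℤ) : ℝ) :=
    fun n w => hF.iter_add_int n w (-l)
  have hlt := hk k le_rfl d t (a + ((-l : ℤ) : ℝ)) (b + ((-l : ℤ) : ℝ))
    (⌊F^[d + k] z⌋ + 2 ^ (d + k) * (-l)) (by rw [hsub, add_comm k, ha]; push_cast; ring)
    (by rw [hsub, add_comm k, hb]; push_cast; ring)
    ⟨by push_cast; linarith [ht.1], by push_cast; linarith [ht.2]⟩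
    (le_trans (le_of_eq (Finset.sum_congr rfl fun i _ => by rw [hsub, hsub]; ring)) hsum2)
  rw [hsub, hsub] at hlt
  have h1 := hM (F^[k] a) (F^[k] b) (hmn k (haz.trans hzb).le)
  rw [← Function.iterate_add_apply, ← Function.iterate_add_apply, ha, hb] at h1
  have h2 := mul_lt_mul_of_pos_left hlt hM0
  rw [mul_one_div_cancel hM0.ne'] at h2
  linarith

end ExpandingLift

/-- The sequence `a, α 0, α 1, …`. -/
def consSeq {X : Type*} (a : X) (α : ℕ → X) : ℕ → X
  | 0 => a
  | k + 1 => α k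

/-- The interval `[a, b]` is a lift of a dyadic interval of degree `n`. -/
def IsDyadicPair (F : ℝ → ℝ) (n : ℕ) (a b : ℝ) : Prop :=
  (∃ K : ℤ, F^[n] a = K) ∧ F^[n] b = F^[n] a + 1

/-- The points `α 0, …, α r` are the successive endpoints of dyadic intervals of degrees `ν k`. -/
def DyadicChain (F : ℝ → ℝ) (r : ℕ) (α : ℕ → ℝ) (ν : ℕ → ℕ) : Prop :=
  ∀ k < r, IsDyadicPair F (ν k) (α k) (α (k + 1))

theorem DyadicChain.cons {F : ℝ → ℝ} {r : ℕ} {α : ℕ → ℝ} {ν : ℕ → ℕ} (h : DyadicChain F r α ν)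
    {n : ℕ} {a : ℝ} (ha : IsDyadicPair F n a (α 0)) :
    DyadicChain F (r + 1) (consSeq a α) (consSeq n ν) := by
  rintro (_ | k) hk
  · exact ha
  · exact h k (by omega)

/-- Some subdivision of `[a, b]` consists of `r` lifts of dyadic intervals. -/
def IsDyadicUnion (F : ℝ → ℝ) (r : ℕ) (a b : ℝ) : Prop :=
  ∃ α ν, DyadicChain F r α ν ∧ α 0 = a ∧ α r = b

theorem IsDyadicUnion.cons {F : ℝ → ℝ} {r n : ℕ} {a b c : ℝ} (h : IsDyadicUnion F r b c)
    (hab : IsDyadicPair F n a b) : IsDyadicUnion F (r + 1) a c := by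
  obtain ⟨α, ν, hα, rfl, rfl⟩ := h
  exact ⟨_, _, hα.cons hab, rfl, rfl⟩

theorem exists_mem_Icc_of_chain {α : ℕ → ℝ} {r : ℕ} (hr : 0 < r) {w : ℝ} (h0 : α 0 ≤ w)
    (h1 : w ≤ α r) : ∃ k < r, w ∈ Icc (α k) (α (k + 1)) := by
  induction r with
  | zero => omega
  | succ r ih =>
    rcases le_total (α r) w with h | h
    · exact ⟨r, by omega, h, h1⟩
    · rcases Nat.eq_zero_or_pos r with rfl | hr'
      · exact ⟨0, by omega, h0, h1⟩
      · obtain ⟨k, hk, hw⟩ := ih hr' h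
        exact ⟨k, by omega, hw⟩

/-- Subdividing `[α 0, α 0 + 1]` by an increasing sequence gives arcs covering the circle. -/
theorem iUnion_arc_eq_univ {α : ℕ → ℝ} {r : ℕ} (hr : 0 < r) (hα : α r = α 0 + 1) :
    ⋃ k : Fin r, (fun t : ℝ => (t : UnitAddCircle)) '' Icc (α k) (α (k + 1)) = univ := by
  refine eq_univ_of_forall fun z => ?_
  obtain ⟨w, rfl⟩ := QuotientAddGroup.mk_surjective z
  obtain ⟨k, hk, hw⟩ := exists_mem_Icc_of_chain (α := α) (w := α 0 + Int.fract (w - α 0)) hr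
    (by linarith [Int.fract_nonneg (w - α 0)]) (by linarith [Int.fract_lt_one (w - α 0)])
  refine mem_iUnion.2 ⟨⟨k, hk⟩, _, hw, ?_⟩
  refine UnitAddCircle.coe_eq_coe_iff.2 ⟨-⌊w - α 0⌋, ?_⟩
  rw [Int.fract]; push_cast; ring

theorem UnitAddCircle.nhdsNE_neBot (z : UnitAddCircle) : (𝓝[≠] z).NeBot := by
  have : Nontrivial UnitAddCircle := by
    refine ⟨((0 : ℝ) : UnitAddCircle), ((1 / 2 : ℝ) : UnitAddCircle), fun h => ?_⟩
    obtain ⟨l, hl⟩ := UnitAddCircle.coe_eq_coe_iff.1 h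
    have : ((2 * l : ℤ) : ℝ) = ((-1 : ℤ) : ℝ) := by push_cast; linarith
    have := Int.cast_injective this
    omega
  exact ConnectedSpace.neBot_nhdsWithin_compl_of_nontrivial_of_t1space z

theorem arc_interior_inter_eq_empty {α : ℕ → ℝ} {r : ℕ} (hmono : ∀ k < r, α k < α (k + 1))
    (hα : α r = α 0 + 1) :
    Pairwise fun k l : Fin r =>
      interior ((fun t : ℝ => (t : UnitAddCircle)) '' Icc (α k) (α (k + 1))) ∩
      interior ((fun t : ℝ => (t : UnitAddCircle)) '' Icc (α l) (α (l + 1))) = ∅ := by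
  have hle : ∀ i j, i ≤ j → j ≤ r → α i ≤ α j := by
    intro i j hij hj
    induction j, hij using Nat.le_induction with
    | base => exact le_rfl
    | succ j _ ih => exact (ih (by omega)).trans (hmono j (by omega)).le
  have key : ∀ k l : Fin r, k < l →
      interior ((fun t : ℝ => (t : UnitAddCircle)) '' Icc (α k) (α (k + 1))) ∩
      interior ((fun t : ℝ => (t : UnitAddCircle)) '' Icc (α l) (α (l + 1))) = ∅ := by
    intro k l hkl
    rw [← not_nonempty_iff_eq_empty]
    rintro ⟨z, hz⟩
    have := UnitAddCircle.nhdsNE_neBot z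
    have hinf := infinite_of_mem_nhds z ((isOpen_interior.inter isOpen_interior).mem_nhds hz)
    refine hinf (Set.Finite.subset (Set.toFinite {(α k : UnitAddCircle), (α (k + 1) :
      UnitAddCircle)}) ?_)
    rintro _ ⟨h1, h2⟩
    obtain ⟨s, hs, rfl⟩ := interior_subset h1
    obtain ⟨t, ht, hts⟩ := interior_subset h2
    obtain ⟨j, hj⟩ := UnitAddCircle.coe_eq_coe_iff.1 hts
    have a1 := hle 0 k (by omega) k.2.le
    have a2 := hle (k + 1) l hkl l.2.le
    have a3 := hle (l + 1) r l.2 le_rfl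
    have b1 : (0 : ℝ) ≤ j := by linarith [hs.2, ht.1]
    have b2 : (j : ℝ) ≤ 1 := by linarith [hs.1, ht.2]
    have b1' : 0 ≤ j := by exact_mod_cast b1
    have b2' : j ≤ 1 := by exact_mod_cast b2
    obtain rfl | rfl : j = 0 ∨ j = 1 := by omega
    · right
      have : s = α (k + 1) := by push_cast at hj; linarith [hs.2, ht.1]
      rw [this]; rfl
    · left
      have : s = α k := by push_cast at hj; linarith [hs.1, ht.2]
      rw [this]
  intro k l hkl
  rcases lt_or_gt_of_ne hkl with h | h
  · exact key k l h
  · rw [inter_comm]; exact key l k h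

/-- A strictly increasing continuous function increasing by one over `[α, α + 1]` agrees there with
a function commuting with the translation by one. -/
theorem exists_periodization {G₀ : ℝ → ℝ} (hc : Continuous G₀) (hm : StrictMono G₀) {α : ℝ}
    (hα : G₀ (α + 1) = G₀ α + 1) : ∃ G : ℝ → ℝ, Continuous G ∧ StrictMono G ∧
      Function.Surjective G ∧ (∀ w, G (w + 1) = G w + 1) ∧ ∀ w ∈ Icc α (α + 1), G w = G₀ w := by
  set G : ℝ → ℝ := fun w => G₀ (α + Int.fract (w - α)) + ⌊w - α⌋ with hG
  have hval : ∀ w, α ≤ w → w < α + 1 → ∀ j : ℤ, G (w + j) = G₀ w + j := by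
    intro w h1 h2 j
    have hf : ⌊w + j - α⌋ = j := by
      rw [Int.floor_eq_iff]; constructor <;> linarith
    simp only [hG, Int.fract, hf]
    congr 2; ring
  have hrepr : ∀ w : ℝ, ∃ v, α ≤ v ∧ v < α + 1 ∧ ∃ j : ℤ, w = v + j := fun w =>
    ⟨α + Int.fract (w - α), by linarith [Int.fract_nonneg (w - α)],
      by linarith [Int.fract_lt_one (w - α)], ⌊w - α⌋, by rw [Int.fract]; ring⟩
  have hmono : StrictMono G := by
    intro w w' hww
    obtain ⟨v, h1, h2, j, rfl⟩ := hrepr w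
    obtain ⟨v', h1', h2', j', rfl⟩ := hrepr w'
    rw [hval v h1 h2, hval v' h1' h2']
    have hjj : j < j' + 1 := by
      have : (j : ℝ) < j' + 1 := by linarith
      exact_mod_cast this
    rcases (Int.lt_add_one_iff.1 hjj).eq_or_lt with rfl | hlt
    · have := hm (show v < v' by linarith)
      linarith
    · have e : (j : ℝ) + 1 ≤ j' := by exact_mod_cast hlt
      have := hm h2
      have := hm.monotone h1'
      linarith
  have hsurj : Function.Surjective G := by
    intro t
    have e1 := Int.floor_le (t - G₀ α)
    have e2 := Int.lt_floor_add_one (t - G₀ α)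
    obtain ⟨u, hu, hut⟩ := intermediate_value_Icc (show α ≤ α + 1 by linarith) hc.continuousOn
      (show t - ⌊t - G₀ α⌋ ∈ Icc _ _ by rw [hα]; constructor <;> linarith)
    refine ⟨u + ⌊t - G₀ α⌋, ?_⟩
    rw [hval u hu.1 (hm.lt_iff_lt.1 (by rw [hut, hα]; linarith)), hut]
    ring
  refine ⟨G, hmono.monotone.continuous_of_surjective hsurj, hmono, hsurj, fun w => ?_,
    fun w hw => ?_⟩
  · obtain ⟨v, h1, h2, j, rfl⟩ := hrepr w
    have := hval v h1 h2 (j + 1)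
    push_cast at this
    rw [add_assoc, this, hval v h1 h2]; ring
  · rcases hw.2.eq_or_lt with rfl | h
    · have := hval α le_rfl (by linarith) 1
      push_cast at this
      rw [this, hα]
    · simpa using hval w hw.1 h 0

namespace ExpandingLift

variable {F : ℝ → ℝ} (hF : ExpandingLift F) {φ : UnitAddCircle → UnitAddCircle}
  (hφ : ∀ y : ℝ, φ y = (F y : UnitAddCircle))

section Chains
include hF

theorem lt_of_isDyadicPair {n : ℕ} {a b : ℝ} (h : IsDyadicPair F n a b) : a < b :=
  (hF.iter_mono n).lt_iff_lt.1 (by linarith [h.2])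

theorem isDyadicUnion_uniform {n : ℕ} (s : ℕ) : ∀ {a b : ℝ}, (∃ K : ℤ, F^[n] a = K) →
    F^[n] b = F^[n] a + s → IsDyadicUnion F s a b := by
  induction s with
  | zero =>
    intro a b _ hb
    refine ⟨fun _ => a, fun _ => 0, fun k hk => by omega, rfl, ?_⟩
    exact (hF.iter_mono n).injective (by simpa using hb.symm)
  | succ s ih =>
    rintro a b ⟨K, hK⟩ hb
    obtain ⟨c, hc⟩ := hF.iter_surjective n (F^[n] a + 1)
    refine (ih (a := c) ⟨K + 1, ?_⟩ ?_).cons ⟨⟨K, hK⟩, hc⟩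
    · rw [hc, hK]; push_cast; rfl
    · rw [hb, hc]; push_cast; ring

theorem isDyadicUnion_add {r : ℕ} {b c : ℝ} (h : IsDyadicUnion F r b c) (s : ℕ) :
    ∀ {n : ℕ} {a : ℝ}, IsDyadicPair F n a b → IsDyadicUnion F (r + (s + 1)) a c := by
  induction s with
  | zero => exact fun hab => h.cons hab
  | succ s ih =>
    rintro n a ⟨⟨K, hK⟩, hb⟩
    have ha1 : F^[n + 1] a = 2 * K := by
      rw [add_comm, Function.iterate_add_apply, hK, hF.iter_int, pow_one]
    have hb1 : F^[n + 1] b = 2 * (K + 1) := by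
      have := hF.iter_int 1 (K + 1)
      push_cast at this
      rw [add_comm n, Function.iterate_add_apply, hb, hK, this, pow_one]
    obtain ⟨m, hm⟩ := hF.iter_surjective (n + 1) (2 * K + 1 : ℝ)
    refine (ih (n := n + 1) (a := m) ⟨⟨2 * K + 1, by rw [hm]; push_cast; rfl⟩, ?_⟩).cons
      (n := n + 1) ⟨⟨2 * K, by rw [ha1]; push_cast; rfl⟩, ?_⟩
    · rw [hb1, hm]; ring
    · rw [hm, ha1]

/-- Two chains of the same length are matched by a homeomorphism of the line. -/
theorem exists_strictMono_of_chains {α β : ℕ → ℝ} {ν μ : ℕ → ℕ} (r : ℕ)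
    (hα : DyadicChain F r α ν) (hβ : DyadicChain F r β μ) :
    ∃ G : ℝ → ℝ, Continuous G ∧ StrictMono G ∧ G (α 0) = β 0 ∧ G (α r) = β r ∧
      ∀ k < r, ∀ w ∈ Icc (α k) (α (k + 1)),
        F^[μ k] (G w) = F^[ν k] w + (F^[μ k] (β k) - F^[ν k] (α k)) := by
  induction r with
  | zero =>
    exact ⟨fun w => w + (β 0 - α 0), by fun_prop, fun a b h => by simpa using h, by ring, by ring,
      fun k hk => by omega⟩
  | succ r ih =>
    obtain ⟨G, hc, hm, h0, hr, h⟩ := ih (fun k hk => hα k (by omega)) fun k hk => hβ k (by omega)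
    set e := (hF.iter_mono (μ r)).orderIsoOfSurjective _ (hF.iter_surjective (μ r))
    have he : ∀ t, F^[μ r] (e.symm t) = t := e.apply_symm_apply
    set P : ℝ → ℝ := fun w => e.symm (F^[ν r] w + (F^[μ r] (β r) - F^[ν r] (α r))) with hP
    have hPc : Continuous P := e.symm.continuous.comp ((hF.iter_cont _).add continuous_const)
    have hPm : StrictMono P := fun a b hab =>
      e.symm.strictMono (by simpa using hF.iter_mono (ν r) hab)
    have hPr : P (α r) = β r := (hF.iter_mono (μ r)).injective (by rw [hP]; simp only [he]; ring)
    have hPr1 : P (α (r + 1)) = β (r + 1) := (hF.iter_mono (μ r)).injective (by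
      rw [hP]; simp only [he]; rw [(hα r (by omega)).2, (hβ r (by omega)).2]; ring)
    have hle : ∀ k < r, α (k + 1) ≤ α r := by
      have hle' : ∀ i j, i ≤ j → j ≤ r → α i ≤ α j := by
        intro i j hij hj
        induction j, hij using Nat.le_induction with
        | base => exact le_rfl
        | succ j _ ih => exact (ih (by omega)).trans (hF.lt_of_isDyadicPair (hα j (by omega))).le
      exact fun k hk => hle' _ _ hk le_rfl
    have h0r : α 0 ≤ α r := by
      obtain _ | r := r
      · exact le_rfl
      · exact (hF.lt_of_isDyadicPair (hα 0 (by omega))).le.trans (hle 0 (by omega))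
    have hr1 := hF.lt_of_isDyadicPair (hα r (by omega))
    refine ⟨fun w => if w ≤ α r then G w else P w, ?_, ?_, ?_, ?_, ?_⟩
    · exact hc.if_le hPc continuous_id continuous_const fun w hw => by
        have : w = α r := hw
        rw [this, hr, hPr]
    · intro a b hab
      simp only
      split_ifs with h1 h2 h2
      · exact hm hab
      · calc G a ≤ G (α r) := hm.monotone h1
          _ = P (α r) := by rw [hr, hPr]
          _ < P b := hPm (not_le.1 h2)
      · exact absurd (hab.le.trans h2) h1
      · exact hPm hab
    · simp only [if_pos h0r, h0]
    · simp only [if_neg (not_le.2 hr1), hPr1]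
    · intro k hk w hw
      rcases Nat.lt_succ_iff_lt_or_eq.1 hk with hk' | rfl
      · simp only [if_pos (hw.2.trans (hle k hk'))]
        exact h k hk' w hw
      · have : (if w ≤ α k then G w else P w) = P w := by
          split_ifs with h1
          · rw [le_antisymm h1 hw.1, hr, hPr]
          · rfl
        simp only [this]
        exact he _

end Chains

include hF hφ

/-- Two chains of the same length subdividing fundamental domains define an element of the
Thompson group. -/
theorem exists_thompson_of_chains {α β : ℕ → ℝ} {ν μ : ℕ → ℕ} {r : ℕ} (hr : 0 < r)
    (hα : DyadicChain F r α ν) (hβ : DyadicChain F r β μ) (hα1 : α r = α 0 + 1)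
    (hβ1 : β r = β 0 + 1) :
    ∃ g G, InThompsonGroup φ F g ∧ IsOPLift g G ∧ ∀ k < r, ∀ w ∈ Icc (α k) (α (k + 1)),
      F^[μ k] (G w) = F^[ν k] w + (F^[μ k] (β k) - F^[ν k] (α k)) := by
  obtain ⟨G₀, hc₀, hm₀, h0, hrr, h⟩ := hF.exists_strictMono_of_chains r hα hβ
  obtain ⟨G, hc, hm, hs, hG1, hGG⟩ := exists_periodization hc₀ hm₀ (α := α 0)
    (by rw [← hα1, hrr, hβ1, h0])
  have hαlt : ∀ k < r, α k < α (k + 1) := fun k hk => hF.lt_of_isDyadicPair (hα k hk)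
  have hβlt : ∀ k < r, β k < β (k + 1) := fun k hk => hF.lt_of_isDyadicPair (hβ k hk)
  have hle : ∀ i j, i ≤ j → j ≤ r → α i ≤ α j := by
    intro i j hij hj
    induction j, hij using Nat.le_induction with
    | base => exact le_rfl
    | succ j _ ih => exact (ih (by omega)).trans (hαlt j (by omega)).le
  have hGp : ∀ k < r, ∀ w ∈ Icc (α k) (α (k + 1)),
      F^[μ k] (G w) = F^[ν k] w + (F^[μ k] (β k) - F^[ν k] (α k)) := by
    intro k hk w hw
    have h1 := hle 0 k (by omega) hk.le
    have h2 := hle (k + 1) r hk le_rfl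
    rw [hGG w ⟨h1.trans hw.1, by linarith [hw.2]⟩, h k hk w hw]
  have hGl : ∀ k < r, G (α k) = β k := fun k hk => (hF.iter_mono (μ k)).injective (by
    rw [hGp k hk _ ⟨le_rfl, (hαlt k hk).le⟩]; ring)
  have hGr : ∀ k < r, G (α (k + 1)) = β (k + 1) := fun k hk => (hF.iter_mono (μ k)).injective (by
    rw [hGp k hk _ ⟨(hαlt k hk).le, le_rfl⟩, (hα k hk).2, (hβ k hk).2]; ring)
  have hper : Function.Periodic (fun w => (G w : UnitAddCircle)) 1 := fun w => by
    simp only [hG1, AddCircle.coe_add_period]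
  have hlift : IsOPLift hper.lift G := ⟨hc, hm, hG1, fun w => hper.lift_coe w⟩
  refine ⟨hper.lift, G, ⟨⟨G, hlift⟩, r,
    fun k => (fun t : ℝ => (t : UnitAddCircle)) '' Icc (α k) (α (k + 1)),
    fun k => (fun t : ℝ => (t : UnitAddCircle)) '' Icc (β k) (β (k + 1)),
    fun k => ν k, fun k => μ k, hr, fun k => ?_, fun k => ?_, iUnion_arc_eq_univ hr hα1,
    iUnion_arc_eq_univ hr hβ1, arc_interior_inter_eq_empty hαlt hα1,
    arc_interior_inter_eq_empty hβlt hβ1, fun k => ?_, fun k => ?_⟩, hlift, hGp⟩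
  · exact ⟨α k, α (k + 1), hαlt k k.2, (hα k k.2).1, (hα k k.2).2, rfl⟩
  · exact ⟨β k, β (k + 1), hβlt k k.2, (hβ k k.2).1, (hβ k k.2).2, rfl⟩
  · have himg : G '' Icc (α k) (α (k + 1)) = Icc (β k) (β (k + 1)) := by
      rw [← hGl k k.2, ← hGr k k.2]
      exact (hm.orderIsoOfSurjective _ hs).image_Icc _ _
    change hper.lift '' (_ '' Icc (α k) (α (k + 1))) = _ '' Icc (β k) (β (k + 1))
    rw [← himg, image_image, image_image]
    exact image_congr fun w _ => hlift.2.2.2 w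
  · rintro _ ⟨w, hw, rfl⟩
    obtain ⟨K, hK⟩ := (hα k k.2).1
    obtain ⟨L, hL⟩ := (hβ k k.2).1
    simp only [hlift.2.2.2]
    rw [coe_iter hφ, coe_iter hφ, hGp k k.2 w hw, hK, hL]
    exact UnitAddCircle.coe_eq_coe_iff.2 ⟨L - K, by push_cast; ring⟩

/-- If `F^[n] x` and `F^[m] y` agree modulo `ℤ` and `m ≤ n` then some element of the Thompson group
sends `x` to `y` and is given near `x` by the corresponding branch of `F^[-m] ∘ F^[n]`. -/
theorem exists_thompson {m n : ℕ} (hmn : m ≤ n) {x y : ℝ} {l : ℤ} (hxy : F^[n] x = F^[m] y + l) :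
    ∃ g G, InThompsonGroup φ F g ∧ IsOPLift g G ∧ G x = y ∧
      ∀ᶠ w in 𝓝 x, F^[m] (G w) = F^[n] w - l := by
  have hN : ∀ w : ℝ, F^[2] (w - l) = F^[2] w - 4 * l := by
    intro w
    have := hF.iter_add_int 2 w (-l)
    push_cast at this
    rw [sub_eq_add_neg, this]; ring
  choose A hA using hF.iter_surjective (2 + n)
  choose B hB using hF.iter_surjective (2 + m)
  set p : ℤ := ⌊F^[2 + n] x⌋ with hp
  have hpow : 2 ^ m ≤ 2 ^ n := Nat.pow_le_pow_right (by norm_num) hmn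
  have hpow1 := Nat.one_le_two_pow (n := m)
  have hα : DyadicChain F (4 * 2 ^ n) (fun k => A (p - 1 + k)) fun _ => 2 + n := fun k _ =>
    ⟨⟨p - 1 + k, by rw [hA]; push_cast; rfl⟩, by simp only [hA]; push_cast; ring⟩
  have hα1 : A (p - 1 + (4 * 2 ^ n : ℕ)) = A (p - 1 + (0 : ℕ)) + 1 := by
    apply (hF.iter_mono (2 + n)).injective
    have := hF.iter_add_int (2 + n) (A (p - 1 + (0 : ℕ))) 1
    rw [Int.cast_one] at this
    rw [this, hA, hA, pow_add]; push_cast; ring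
  have hBd : ∀ t : ℤ, IsDyadicPair F (2 + m) (B t) (B (t + 1)) := fun t =>
    ⟨⟨t, hB _⟩, by rw [hB, hB]⟩
  obtain ⟨q, hq⟩ : ∃ q : ℤ, q = p - 4 * l := ⟨_, rfl⟩
  obtain ⟨β, μ, hβ, hβ0, hβr⟩ : IsDyadicUnion F (4 * 2 ^ m - 3 + (4 * 2 ^ n - 4 * 2 ^ m + 1))
      (B ((q : ℤ) + 1)) (B ((q - 1 : ℤ) : ℝ) + 1) := by
    refine hF.isDyadicUnion_add (b := B ((q + 1 : ℤ) + 1)) ?_ _ (n := 2 + m) ?_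
    · refine hF.isDyadicUnion_uniform (n := 2 + m) _ ⟨q + 2, ?_⟩ ?_
      · rw [hB]; push_cast; ring
      · have := hF.iter_add_int (2 + m) (B ((q - 1 : ℤ) : ℝ)) 1
        rw [Int.cast_one] at this
        rw [this, hB, hB, Nat.cast_sub (by omega), pow_add]
        push_cast; ring
    · have := hBd (q + 1)
      push_cast at this ⊢
      exact this
  have hβ' := (hβ.cons (n := 2 + m) (a := B q) (by rw [hβ0]; exact hBd q)).cons
    (n := 2 + m) (a := B ((q - 1 : ℤ) : ℝ)) (by
      have := hBd (q - 1)
      push_cast at this ⊢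
      rwa [sub_add_cancel] at this)
  rw [show 4 * 2 ^ m - 3 + (4 * 2 ^ n - 4 * 2 ^ m + 1) + 1 + 1 = 4 * 2 ^ n by omega] at hβ'
  obtain ⟨g, G, hg, hG, hGp⟩ := hF.exists_thompson_of_chains hφ (by positivity) hα hβ' hα1 (by
    rw [show 4 * 2 ^ n = 4 * 2 ^ m - 3 + (4 * 2 ^ n - 4 * 2 ^ m + 1) + 1 + 1 by omega]
    exact hβr)
  have hGp0 := hGp 0 (by omega)
  have hGp1 := hGp 1 (by omega)
  simp only [consSeq, hA, hB] at hGp0 hGp1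
  have hnear : ∀ w ∈ Icc (A (p - 1 + (0 : ℕ))) (A (p - 1 + (1 + 1 : ℕ))),
      F^[m] (G w) = F^[n] w - l := by
    intro w hw
    apply (hF.iter_mono 2).injective
    rw [hN, ← Function.iterate_add_apply, ← Function.iterate_add_apply]
    rcases le_total w (A (p - 1 + (0 + 1 : ℕ))) with h | h
    · rw [hGp0 w ⟨hw.1, h⟩, hq]; push_cast; ring
    · rw [hGp1 w ⟨h, hw.2⟩, hq]; push_cast; ring
  have hx0 : A (p - 1 + (0 : ℕ)) < x := (hF.iter_mono (2 + n)).lt_iff_lt.1 (by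
    rw [hA, hp]; push_cast; linarith [Int.floor_le (F^[2 + n] x)])
  have hx1 : x < A (p - 1 + (1 + 1 : ℕ)) := (hF.iter_mono (2 + n)).lt_iff_lt.1 (by
    rw [hA, hp]; push_cast; linarith [Int.lt_floor_add_one (F^[2 + n] x)])
  refine ⟨g, G, hg, hG, (hF.iter_mono m).injective ?_, ?_⟩
  · rw [hnear x ⟨hx0.le, hx1.le⟩, hxy]; ring
  · filter_upwards [Icc_mem_nhds hx0 hx1] with w hw using hnear w hw

end ExpandingLift

namespace ExpandingLift

variable {F : ℝ → ℝ} (hF : ExpandingLift F)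

section Growth
include hF

theorem exists_lt_iter_sub {u v : ℝ} (huv : u < v) (K : ℝ) :
    ∃ N, ∀ n ≥ N, K < F^[n] v - F^[n] u := by
  obtain ⟨N, hN⟩ := hF.mesh ((v - u) / 2) (by linarith)
  obtain ⟨m, hm⟩ := pow_unbounded_of_one_lt K (one_lt_two (α := ℝ))
  refine ⟨N + m, fun n hn => ?_⟩
  obtain ⟨k, rfl⟩ := Nat.exists_eq_add_of_le (show m ≤ n by omega)
  have h1 : F^[k] u + 1 < F^[k] v := by
    by_contra! h
    have := hN k (by omega) u v h
    linarith
  have h2 := hF.iter_mono m h1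
  have h3 := hF.iter_add_int m (F^[k] u) 1
  rw [Int.cast_one] at h3
  rw [h3, ← Function.iterate_add_apply, ← Function.iterate_add_apply] at h2
  linarith

theorem not_contracting {u v : ℝ} (huv : u < v) {s : ℕ} (hs : 1 ≤ s) {l : ℤ}
    (hu : u + l ≤ F^[s] u) (hv : F^[s] v ≤ v + l) : False := by
  have h : ∀ n, ∃ c : ℤ, u + c ≤ F^[s * n] u ∧ F^[s * n] v ≤ v + c := by
    intro n
    induction n with
    | zero => exact ⟨0, by simp, by simp⟩
    | succ n ih =>
      obtain ⟨c, h1, h2⟩ := ih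
      refine ⟨l + 2 ^ s * c, ?_, ?_⟩
      · have := (hF.iter_mono s).monotone h1
        rw [hF.iter_add_int, ← Function.iterate_add_apply] at this
        rw [Nat.mul_succ]
        push_cast at *
        rw [add_comm s] at this
        linarith
      · have := (hF.iter_mono s).monotone h2
        rw [hF.iter_add_int, ← Function.iterate_add_apply] at this
        rw [Nat.mul_succ]
        push_cast at *
        rw [add_comm s] at this
        linarith
  obtain ⟨N, hN⟩ := hF.exists_lt_iter_sub huv (v - u)
  obtain ⟨c, h1, h2⟩ := h N
  have := hN (s * N) (Nat.le_mul_of_pos_left N hs)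
  linarith

end Growth

variable {φ : UnitAddCircle → UnitAddCircle} (hφ : ∀ y : ℝ, φ y = (F y : UnitAddCircle))
include hF hφ

theorem deriv_iter_le_one {x : ℝ} (hx : NonExpandable φ F x) (n : ℕ) : deriv F^[n] x ≤ 1 := by
  obtain ⟨g, G, hg, hG, -, h⟩ := hF.exists_thompson hφ (Nat.zero_le n) (x := x) (y := F^[n] x)
    (l := 0) (by simp)
  have h' : G =ᶠ[𝓝 x] F^[n] := by filter_upwards [h] with w hw; simpa using hw
  rw [← h'.deriv_eq]
  exact hx g G hg hG x rfl

omit hφ in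
theorem differentiableAt_of_iter_comp {G : ℝ → ℝ} {m n : ℕ} {x : ℝ} {l : ℤ}
    (h : ∀ᶠ w in 𝓝 x, F^[m] (G w) = F^[n] w - l) : DifferentiableAt ℝ G x := by
  set e := (hF.iter_mono m).orderIsoOfSurjective _ (hF.iter_surjective m)
  have he : ∀ t, F^[m] (e.symm t) = t := e.apply_symm_apply
  have hd : DifferentiableAt ℝ e.symm (F^[n] x - l) :=
    (HasDerivAt.of_local_left_inverse e.symm.continuous.continuousAt
      (hF.iter_differentiable m _).hasDerivAt (hF.deriv_iter_pos m _).ne'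
      (Eventually.of_forall he)).differentiableAt
  refine (hd.comp x ((hF.iter_differentiable n x).sub_const _)).congr_of_eventuallyEq ?_
  filter_upwards [h] with w hw
  exact (hF.iter_mono m).injective (hw.trans (he _).symm)

theorem exists_parabolic {x : ℝ} (hx : NonExpandable φ F x) :
    ∃ g G, InThompsonGroup φ F g ∧ IsOPLift g G ∧ g x = x ∧ G x = x ∧ deriv G x = 1 ∧
      ∃ δ > 0, (∀ y, x < y → y < x + δ → y < G y) ∧ ∀ y, x - δ < y → y < x → G y < y := by
  obtain ⟨i, s, hs, l, hl⟩ := hF.exists_preperiodic hφ (hF.deriv_iter_le_one hφ hx)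
  obtain ⟨g, G, hg, hG, hGx, h⟩ := hF.exists_thompson hφ (Nat.le_add_right i s) hl
  obtain ⟨δ, hδ, hball⟩ := Metric.eventually_nhds_iff.1 h
  have hq : F^[s] (F^[i] x) = F^[i] x + l := by rw [← Function.iterate_add_apply, add_comm, hl]
  have hright : ∀ y, x < y → y < x + δ → y < G y := by
    intro y h1 h2
    have e := hball (show dist y x < δ by rw [Real.dist_eq, abs_lt]; constructor <;> linarith)
    by_contra! hle
    refine hF.not_contracting (hF.iter_mono i h1) hs hq.ge ?_
    have := (hF.iter_mono i).monotone hle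
    rw [← Function.iterate_add_apply, add_comm]
    linarith
  have hleft : ∀ y, x - δ < y → y < x → G y < y := by
    intro y h1 h2
    have e := hball (show dist y x < δ by rw [Real.dist_eq, abs_lt]; constructor <;> linarith)
    by_contra! hle
    refine hF.not_contracting (hF.iter_mono i h2) hs ?_ hq.le
    have := (hF.iter_mono i).monotone hle
    rw [← Function.iterate_add_apply, add_comm s]
    linarith
  refine ⟨g, G, hg, hG, by rw [hG.2.2.2, hGx], hGx, le_antisymm (hx g G hg hG x rfl) ?_, δ, hδ,
    hright, hleft⟩
  have hd := (hF.differentiableAt_of_iter_comp h).hasDerivAt.hasDerivWithinAt (s := Ioi x)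
  rw [hasDerivWithinAt_iff_tendsto_slope' (by simp)] at hd
  refine ge_of_tendsto hd ?_
  filter_upwards [Ioo_mem_nhdsGT (show x < x + δ by linarith)] with y hy
  rw [slope_def_field, hGx, le_div_iff₀ (sub_pos.2 hy.1)]
  linarith [hright y hy.1 hy.2]

end ExpandingLift

theorem doubling_iterate_coe (n : ℕ) (t : ℝ) :
    doubling^[n] (t : UnitAddCircle) = ((2 ^ n * t : ℝ) : UnitAddCircle) := by
  induction n with
  | zero => simp
  | succ n ih =>
    rw [Function.iterate_succ_apply', ih, doubling, ← AddCircle.coe_add]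
    congr 1; ring

/-- The iterated preimages of `0` under a map conjugate to the doubling map are dense. -/
theorem ConjugateToDoubling.exists_iterate_eq_zero {φ : UnitAddCircle → UnitAddCircle}
    (hconj : ConjugateToDoubling φ) (h0 : φ 0 = 0) {U : Set UnitAddCircle} (hU : IsOpen U)
    (hne : U.Nonempty) : ∃ z ∈ U, ∃ n, φ^[n] z = 0 := by
  obtain ⟨h, hh⟩ := hconj
  have h00 : h 0 = 0 := by
    have := hh 0
    rw [h0, doubling] at this
    exact left_eq_add.1 this
  have hV : IsOpen ((↑) ⁻¹' (h '' U) : Set ℝ) :=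
    (h.isOpenMap U hU).preimage (AddCircle.continuous_mk' 1)
  obtain ⟨z, hz⟩ := hne
  obtain ⟨t, ht⟩ := QuotientAddGroup.mk_surjective (h z)
  obtain ⟨ε, hε, hball⟩ := Metric.isOpen_iff.1 hV t ⟨z, hz, ht.symm⟩
  obtain ⟨n, hn⟩ := exists_pow_lt_of_lt_one hε (show (1 / 2 : ℝ) < 1 by norm_num)
  have hp : (0 : ℝ) < 2 ^ n := by positivity
  obtain ⟨w, hwU, hw⟩ : ((⌊2 ^ n * t⌋ / 2 ^ n : ℝ) : UnitAddCircle) ∈ h '' U := by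
    refine hball ?_
    rw [Metric.mem_ball, Real.dist_eq, abs_lt]
    have h1 := Int.floor_le (2 ^ n * t)
    have h2 := Int.lt_floor_add_one (2 ^ n * t)
    have h3 : (1 / 2 : ℝ) ^ n = 1 / 2 ^ n := by rw [div_pow, one_pow]
    rw [h3, div_lt_iff₀ hp] at hn
    constructor
    · rw [lt_sub_iff_add_lt, lt_div_iff₀ hp]; nlinarith
    · rw [sub_lt_iff_lt_add, div_lt_iff₀ hp]; nlinarith
  refine ⟨w, hwU, n, h.injective ?_⟩
  rw [h00, (show Function.Semiconj h φ doubling from hh).iterate_right n w, hw,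
    doubling_iterate_coe, mul_div_cancel₀ _ hp.ne']
  exact UnitAddCircle.coe_eq_coe_iff.2 ⟨⌊2 ^ n * t⌋, by simp⟩

/-- For a covering map conjugate to the doubling map, the dyadic partitions have mesh tending to
zero. -/
theorem exists_mesh_le {F : ℝ → ℝ} {φ : UnitAddCircle → UnitAddCircle}
    (hconj : ConjugateToDoubling φ) (h0 : φ 0 = 0) (hmono : StrictMono F)
    (hφ : ∀ y : ℝ, φ y = (F y : UnitAddCircle)) {ε : ℝ} (hε : 0 < ε) :
    ∃ N, ∀ n ≥ N, ∀ a b, F^[n] b ≤ F^[n] a + 1 → b - a ≤ ε := by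
  obtain ⟨M, hM⟩ := exists_nat_one_div_lt (show 0 < ε / 3 by linarith)
  have hK : (0 : ℝ) < M + 1 := by positivity
  have hdense : ∀ j : ℕ, ∃ y : ℝ, (j / (M + 1) < y ∧ y < (j + 1) / (M + 1)) ∧
      ∃ n, φ^[n] (y : UnitAddCircle) = 0 := by
    intro j
    have hlt : (j : ℝ) / (M + 1) < (j + 1) / (M + 1) := by gcongr; linarith
    obtain ⟨_, ⟨y, hy, rfl⟩, n, hn⟩ := hconj.exists_iterate_eq_zero h0
      (QuotientAddGroup.isOpenMap_coe _ isOpen_Ioo) ((nonempty_Ioo.2 hlt).image _)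
    exact ⟨y, hy, n, hn⟩
  choose y hy n hn using hdense
  set N := (Finset.range (M + 1)).sup n
  have hcell : ∀ k ≥ N, ∀ t : ℤ, ∃ w : ℝ, (t / (M + 1) < w ∧ w < (t + 1) / (M + 1)) ∧
      φ^[k] (w : UnitAddCircle) = 0 := by
    intro k hk t
    obtain ⟨j, hj⟩ := Int.eq_ofNat_of_zero_le (Int.emod_nonneg t (show (M + 1 : ℤ) ≠ 0 by omega))
    have hjM : j < M + 1 := by
      have := Int.emod_lt_of_pos t (show (0 : ℤ) < M + 1 by omega)
      omega
    have ht : (t : ℝ) = j + (M + 1) * ((t / (M + 1) : ℤ) : ℝ) := by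
      have := Int.emod_add_mul_ediv t (M + 1)
      rw [hj] at this
      exact_mod_cast this.symm
    refine ⟨y j + ((t / (M + 1) : ℤ) : ℝ), ⟨?_, ?_⟩, ?_⟩
    · rw [ht, add_div, mul_div_cancel_left₀ _ hK.ne']
      linarith [(hy j).1]
    · rw [ht, add_right_comm, add_div, mul_div_cancel_left₀ _ hK.ne']
      linarith [(hy j).2]
    · have e : ((y j + ((t / (M + 1) : ℤ) : ℝ) : ℝ) : UnitAddCircle) = y j :=
        UnitAddCircle.coe_eq_coe_iff.2 ⟨_, rfl⟩
      obtain ⟨p, rfl⟩ := Nat.exists_eq_add_of_le'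
        ((Finset.le_sup (f := n) (Finset.mem_range.2 hjM)).trans hk)
      rw [e, Function.iterate_add_apply, hn, Function.iterate_fixed h0]
  refine ⟨N, fun k hk a b hab => ?_⟩
  by_contra! hlt
  obtain ⟨w, ⟨hw1, hw2⟩, hw⟩ := hcell k hk (⌊a * (M + 1)⌋ + 1)
  obtain ⟨w', ⟨hw1', hw2'⟩, hw'⟩ := hcell k hk (⌊a * (M + 1)⌋ + 2)
  have f1 := Int.floor_le (a * (M + 1))
  have f2 := Int.lt_floor_add_one (a * (M + 1))
  push_cast at hw1 hw2 hw1' hw2'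
  have haw : a < w := lt_trans (by rw [lt_div_iff₀ hK]; exact f2) hw1
  have hww : w < w' := hw2.trans_le (le_trans (le_of_eq (by ring)) hw1'.le)
  have hwb : w' < b := by
    rw [div_lt_iff₀ hK] at hM
    refine hw2'.trans ?_
    rw [div_lt_iff₀ hK]
    nlinarith
  rw [ExpandingLift.coe_iter hφ, ← AddCircle.coe_zero, UnitAddCircle.coe_eq_coe_iff] at hw hw'
  obtain ⟨c, hc⟩ := hw
  obtain ⟨c', hc'⟩ := hw'
  have m1 := hmono.iterate k haw
  have m2 := hmono.iterate k hww
  have m3 := hmono.iterate k hwb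
  rw [hc, hc'] at m2
  have : c + 1 ≤ c' := by
    have : (c : ℝ) < c' := by linarith
    exact_mod_cast this
  have : (c : ℝ) + 1 ≤ c' := by exact_mod_cast this
  linarith

theorem ExpandingLift.iterate_add_const {F₀ F : ℝ → ℝ} (hF : ExpandingLift F₀) {c : ℤ}
    (h : ∀ y, F y = F₀ y + c) (n : ℕ) (y : ℝ) : F^[n] y = F₀^[n] y + ((2 ^ n - 1) * c : ℤ) := by
  induction n with
  | zero => simp
  | succ n ih =>
    rw [Function.iterate_succ_apply', ih, h, hF.map_add_int, Function.iterate_succ_apply']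
    push_cast; ring

theorem ExpandingLift.isDyadic_add_const {F₀ F : ℝ → ℝ} (hF : ExpandingLift F₀) {c : ℤ}
    (h : ∀ y, F y = F₀ y + c) {n : ℕ} {I : Set UnitAddCircle} (hI : IsDyadic F₀ n I) :
    IsDyadic F n I := by
  obtain ⟨a, b, hab, ⟨k, hk⟩, hb, rfl⟩ := hI
  have e := hF.iterate_add_const h n
  refine ⟨a, b, hab, ⟨k + (2 ^ n - 1) * c, ?_⟩, ?_, rfl⟩
  · rw [e, hk]; push_cast; ring
  · rw [e, e, hb]; ring

theorem ExpandingLift.inThompsonGroup_add_const {F₀ F : ℝ → ℝ} (hF : ExpandingLift F₀) {c : ℤ}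
    (h : ∀ y, F y = F₀ y + c) {φ g : UnitAddCircle → UnitAddCircle}
    (hg : InThompsonGroup φ F₀ g) : InThompsonGroup φ F g := by
  obtain ⟨hG, r, I, J, n, m, hr, hI, hJ, rest⟩ := hg
  exact ⟨hG, r, I, J, n, m, hr, fun k => hF.isDyadic_add_const h (hI k),
    fun k => hF.isDyadic_add_const h (hJ k), rest⟩

/-- every `C²` minimal action of `T_φ` satisfies property (∗). -/
theorem thompson_minimal_property_star
    (φ : UnitAddCircle → UnitAddCircle) (F : ℝ → ℝ)
    (hF : IsLiftDeg2 φ F) (hC2 : ContDiff ℝ 2 F) (hpos : ∀ x : ℝ, 0 < deriv F x)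
    (h0 : φ 0 = 0) (hd1 : deriv F 0 = 1) (hd2 : deriv (deriv F) 0 = 0)
    (hconj : ConjugateToDoubling φ)
    (x : UnitAddCircle) (hx : NonExpandable φ F x) :
    (∃ (g : UnitAddCircle → UnitAddCircle) (G : ℝ → ℝ) (x' δ : ℝ),
      InThompsonGroup φ F g ∧ IsOPLift g G ∧ (x' : UnitAddCircle) = x ∧
      g x = x ∧ G x' = x' ∧ deriv G x' = 1 ∧ 0 < δ ∧
      ∀ y : ℝ, x' < y → y < x' + δ → y < G y) ∧
    (∃ (g : UnitAddCircle → UnitAddCircle) (G : ℝ → ℝ) (x' δ : ℝ),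
      InThompsonGroup φ F g ∧ IsOPLift g G ∧ (x' : UnitAddCircle) = x ∧
      g x = x ∧ G x' = x' ∧ deriv G x' = 1 ∧ 0 < δ ∧
      ∀ y : ℝ, x' - δ < y → y < x' → G y < y) := by
  obtain ⟨hc, hm, h1, hφ⟩ := hF
  obtain ⟨c, hc0⟩ : ∃ c : ℤ, F 0 = c := by
    have h : ((F 0 : ℝ) : UnitAddCircle) = ((0 : ℝ) : UnitAddCircle) := by
      rw [← hφ, AddCircle.coe_zero, h0]
    obtain ⟨c, hc⟩ := UnitAddCircle.coe_eq_coe_iff.1 h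
    exact ⟨c, by simpa using hc⟩
  set F₀ : ℝ → ℝ := fun y => F y - c with hF₀
  have hadd : ∀ y, F y = F₀ y + c := fun y => (sub_add_cancel _ _).symm
  have hm₀ : StrictMono F₀ := fun a b hab => sub_lt_sub_right (hm hab) _
  have hφ₀ : ∀ y : ℝ, φ y = (F₀ y : UnitAddCircle) := fun y => by
    rw [hφ, UnitAddCircle.coe_eq_coe_iff]
    exact ⟨c, hadd y⟩
  have hE : ExpandingLift F₀ :=
    { cont := hc.sub continuous_const
      mono := hm₀
      map_add_one := fun y => by simp only [hF₀, h1]; ring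
      map_zero := by simp only [hF₀, hc0, sub_self]
      contDiff := hC2.sub contDiff_const
      deriv_pos := fun y => by simpa only [hF₀, deriv_sub_const] using hpos y
      mesh := fun ε hε => exists_mesh_le hconj h0 hm₀ hφ₀ hε }
  obtain ⟨x', rfl⟩ := QuotientAddGroup.mk_surjective x
  obtain ⟨g, G, hg, hG, hgx, hGx, hd, δ, hδ, hr, hl⟩ := hE.exists_parabolic hφ₀ (x := x')
    fun g G hg => hx g G (hE.inThompsonGroup_add_const hadd hg)
  have hg' := hE.inThompsonGroup_add_const hadd hg
  exact ⟨⟨g, G, x', δ, hg', hG, rfl, hgx, hGx, hd, hδ, hr⟩,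
    ⟨g, G, x', δ, hg', hG, rfl, hgx, hGx, hd, hδ, hl⟩⟩
end
end
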